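/- arXiv:1805.11064 — 2 statements merged into one kernel-verified Lean document; each statement's English description precedes it below -/
import Mathlib

section
/- Suppose (L_𝔞, L_𝔟) ≠ (1,1), γ > 0 and 0 < λ ≤ 1/4. Then every invariant probability measure μ on 𝕊^L (i.e. every μ with μ(A) = ∫_{𝕊^L} P(ℛ(1+λrU)·v ∈ A) dμ(v) for all Borel A) satisfies ∫_{𝕊^L} ‖𝔞(v)‖² dμ(v) ≤ 2 · ((L+1)/(L_𝔞+L_𝔟))^{(L_𝔞+L_𝔟−2)/(L_𝔠+2)} · ((6/γ)·(L_𝔞/L_𝔠)·λ²)^{L_𝔠/(L_𝔠+2)}. -/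
open MeasureTheory ProbabilityTheory Matrix Real
open scoped ENNReal

noncomputable section

abbrev Sph (L : ℕ) := Metric.sphere (0 : EuclideanSpace ℝ (Fin (L+1))) 1

/-- The projective action `T · v = T v / ‖T v‖` on vectors. -/
noncomputable def act {n : ℕ} (T : Matrix (Fin n) (Fin n) ℝ)
    (v : EuclideanSpace ℝ (Fin n)) : EuclideanSpace ℝ (Fin n) :=
  ‖Matrix.toEuclideanLin T v‖⁻¹ • Matrix.toEuclideanLin T v

/-- The projective action on the unit sphere (junk value `v` if `T v = 0`). -/
noncomputable def actS {L : ℕ} (T : Matrix (Fin (L+1)) (Fin (L+1)) ℝ) (v : Sph L) : Sph L :=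
  if h : ‖Matrix.toEuclideanLin T (v : EuclideanSpace ℝ (Fin (L+1)))‖ = 0 then v
  else ⟨act T v, by
    rw [mem_sphere_zero_iff_norm, act, norm_smul, norm_inv, norm_norm, inv_mul_cancel₀ h]⟩

instance {m n α : Type*} [MeasurableSpace α] : MeasurableSpace (Matrix m n α) :=
  inferInstanceAs (MeasurableSpace (m → n → α))

/-- `U` is Haar distributed on the orthogonal group `O(L+1)`: it takes values in the
orthogonal group and its law is invariant under left translation (which characterizes
the Haar probability measure on this compact group). -/
def IsHaarOrth {L : ℕ} {Ω : Type*} [MeasurableSpace Ω] (P : Measure Ω)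
    (U : Ω → Matrix (Fin (L+1)) (Fin (L+1)) ℝ) : Prop :=
  Measurable U ∧ (∀ ω, U ω ∈ Matrix.orthogonalGroup (Fin (L+1)) ℝ) ∧
    ∀ O ∈ Matrix.orthogonalGroup (Fin (L+1)) ℝ,
      Measure.map (fun ω => O * U ω) P = Measure.map U P

/-- `ν` is the normalized rotation-invariant surface measure on the sphere: it is the unique
rotation-invariant Borel probability measure. -/
def IsUniformSphere {L : ℕ} (ν : Measure (Sph L)) : Prop :=
  IsProbabilityMeasure ν ∧
    ∀ O ∈ Matrix.orthogonalGroup (Fin (L+1)) ℝ, Measure.map (actS O) ν = ν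

/-- Topological support of a measure. -/
def msupport {X : Type*} [TopologicalSpace X] [MeasurableSpace X] (μ : Measure X) : Set X :=
  {x | ∀ s : Set X, IsOpen s → x ∈ s → 0 < μ s}

/-- `‖𝔞(v)‖²`, the squared norm of the first `La` components. -/
noncomputable def naSq {n : ℕ} (La : ℕ) (v : EuclideanSpace ℝ (Fin n)) : ℝ :=
  ∑ k : Fin n, if (k : ℕ) < La then (v k)^2 else 0

/-- `‖𝔠(v)‖²`, the squared norm of the components with index `> La + Lb`. -/
noncomputable def ncSq {n : ℕ} (Lab : ℕ) (v : EuclideanSpace ℝ (Fin n)) : ℝ :=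
  ∑ k : Fin n, if Lab ≤ (k : ℕ) then (v k)^2 else 0

/-- Ordered application of the (random) matrices `M 0, …, M (N-1)` to `v`. -/
noncomputable def chainW {L : ℕ} {Ω : Type*}
    (M : ℕ → Ω → Matrix (Fin (L+1)) (Fin (L+1)) ℝ) :
    ℕ → Ω → Sph L → Sph L
  | 0, _, v => v
  | (n+1), ω, v => actS (M n ω) (chainW M n ω v)

/-- Ordered application of the matrices `M 0, …, M (N-1)` to `v` (deterministic). -/
noncomputable def chainD {L : ℕ} (M : ℕ → Matrix (Fin (L+1)) (Fin (L+1)) ℝ) :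
    ℕ → Sph L → Sph L
  | 0, v => v
  | (n+1), v => actS (M n) (chainD M n v)

open scoped Topology

/-- The Euclidean space `ℝⁿ`. -/
abbrev Euc (n : ℕ) := EuclideanSpace ℝ (Fin n)

/-- The `i`-th standard unit vector. -/
def unitVec {n : ℕ} (i : Fin n) : Euc n := EuclideanSpace.single i 1

/-- The Laplacian, as the trace of the second derivative in standard coordinates. -/
def lap {n : ℕ} (F : Euc n → ℝ) (w : Euc n) : ℝ :=
  ∑ i, fderiv ℝ (fderiv ℝ F) w (unitVec i) (unitVec i)

/-- The scalar product of the gradients of two functions. -/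
def gradDot {n : ℕ} (F G : Euc n → ℝ) (w : Euc n) : ℝ :=
  ∑ i, fderiv ℝ F w (unitVec i) * fderiv ℝ G w (unitVec i)

section Laplacian

variable {n : ℕ} {F G : Euc n → ℝ} {w : Euc n}

lemma hasFDerivAt_fderiv_of_contDiffAt (hF : ContDiffAt ℝ 2 F w) :
    HasFDerivAt (fderiv ℝ F) (fderiv ℝ (fderiv ℝ F) w) w :=
  ((hF.fderiv_right (m := 1) (by norm_num)).differentiableAt (by norm_num)).hasFDerivAt

lemma eventually_differentiableAt_of_contDiffAt (hF : ContDiffAt ℝ 2 F w) :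
    ∀ᶠ y in 𝓝 w, DifferentiableAt ℝ F y :=
  (hF.eventually (by simp)).mono fun _ hy => hy.differentiableAt (by norm_num)

lemma gradDot_comm : gradDot F G w = gradDot G F w := by
  simp only [gradDot, mul_comm]

lemma lap_mul (hF : ContDiffAt ℝ 2 F w) (hG : ContDiffAt ℝ 2 G w) :
    lap (fun y => F y * G y) w = F w * lap G w + 2 * gradDot F G w + G w * lap F w := by
  have h1 : fderiv ℝ (fun y => F y * G y) =ᶠ[𝓝 w]
      fun y => F y • fderiv ℝ G y + G y • fderiv ℝ F y := by
    filter_upwards [eventually_differentiableAt_of_contDiffAt hF,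
      eventually_differentiableAt_of_contDiffAt hG] with y h1 h2
    exact fderiv_fun_mul h1 h2
  have hF1 := (hF.differentiableAt (by norm_num)).hasFDerivAt
  have hG1 := (hG.differentiableAt (by norm_num)).hasFDerivAt
  have h2 := (hF1.smul (hasFDerivAt_fderiv_of_contDiffAt hG)).add
    (hG1.smul (hasFDerivAt_fderiv_of_contDiffAt hF))
  have h3 := h2.congr_of_eventuallyEq h1
  rw [lap, h3.fderiv]
  simp only [lap, gradDot, Finset.mul_sum, ← Finset.sum_add_distrib]
  refine Finset.sum_congr rfl fun i _ => ?_
  simp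
  ring

lemma lap_comp {g : ℝ → ℝ} (hF : ContDiffAt ℝ 2 F w) (hg : ContDiffAt ℝ 2 g (F w)) :
    lap (fun y => g (F y)) w
      = deriv g (F w) * lap F w + deriv (deriv g) (F w) * gradDot F F w := by
  have hF1 := (hF.differentiableAt (by norm_num)).hasFDerivAt
  have h1 : fderiv ℝ (fun y => g (F y)) =ᶠ[𝓝 w] fun y => deriv g (F y) • fderiv ℝ F y := by
    filter_upwards [eventually_differentiableAt_of_contDiffAt hF,
      hF.continuousAt.eventually (hg.eventually (by simp))] with y h1 h2
    exact ((h2.differentiableAt (by norm_num)).hasDerivAt.comp_hasFDerivAt y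
      h1.hasFDerivAt).fderiv
  have hg2 : HasDerivAt (deriv g) (deriv (deriv g) (F w)) (F w) :=
    ((((hg.fderiv_right (m := 1) (by norm_num)).clm_apply
      (contDiffAt_const (c := (1 : ℝ)))).differentiableAt (by norm_num))).hasDerivAt
  have h2 := (hg2.comp_hasFDerivAt w hF1).smul (hasFDerivAt_fderiv_of_contDiffAt hF)
  have h3 := h2.congr_of_eventuallyEq h1
  rw [lap, h3.fderiv]
  simp only [lap, gradDot, Finset.mul_sum, ← Finset.sum_add_distrib]
  refine Finset.sum_congr rfl fun i _ => ?_
  simp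
  ring

/-- The squared norm of the components of `w` with index in `s`. -/
def sqOn (s : Finset (Fin n)) (w : Euc n) : ℝ := ∑ i ∈ s, w i ^ 2

lemma sqOn_univ (w : Euc n) : sqOn Finset.univ w = ‖w‖ ^ 2 := by
  rw [EuclideanSpace.norm_sq_eq]; simp [sqOn]

lemma hasFDerivAt_coord (i : Fin n) (w : Euc n) :
    HasFDerivAt (fun y : Euc n => y i) (EuclideanSpace.proj (𝕜 := ℝ) i : Euc n →L[ℝ] ℝ) w :=
  (EuclideanSpace.proj (𝕜 := ℝ) i : Euc n →L[ℝ] ℝ).hasFDerivAt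

lemma fderiv_sqOn (s : Finset (Fin n)) :
    fderiv ℝ (sqOn s) = fun w => ∑ i ∈ s, (2 * w i) •
      (EuclideanSpace.proj (𝕜 := ℝ) i : Euc n →L[ℝ] ℝ) := by
  funext w
  refine HasFDerivAt.fderiv ?_
  unfold sqOn
  refine HasFDerivAt.fun_sum fun i _ => ?_
  simpa using (hasFDerivAt_coord i w).pow 2

lemma contDiff_sqOn (s : Finset (Fin n)) : ContDiff ℝ 2 (sqOn s) := by
  unfold sqOn
  exact ContDiff.sum fun i _ => by fun_prop

lemma fderiv_sqOn_unitVec (s : Finset (Fin n)) (w : Euc n) (i : Fin n) :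
    fderiv ℝ (sqOn s) w (unitVec i) = if i ∈ s then 2 * w i else 0 := by
  simp only [fderiv_sqOn, unitVec]
  rw [_root_.sum_apply]
  simp

lemma lap_sqOn (s : Finset (Fin n)) (w : Euc n) : lap (sqOn s) w = 2 * s.card := by
  have h : HasFDerivAt (fderiv ℝ (sqOn s)) (∑ i ∈ s,
      ((2 : ℝ) • (EuclideanSpace.proj (𝕜 := ℝ) i : Euc n →L[ℝ] ℝ)).smulRight
        (EuclideanSpace.proj (𝕜 := ℝ) i : Euc n →L[ℝ] ℝ)) w := by
    rw [fderiv_sqOn]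
    refine HasFDerivAt.fun_sum fun i _ => ?_
    exact ((hasFDerivAt_coord i w).const_mul (2 : ℝ)).smul_const
      (EuclideanSpace.proj (𝕜 := ℝ) i : Euc n →L[ℝ] ℝ)
  rw [lap, h.fderiv]
  simp only [_root_.sum_apply]
  rw [Finset.sum_comm]
  have : ∀ i ∈ s, (∑ j : Fin n, (((2 : ℝ) • (EuclideanSpace.proj (𝕜 := ℝ) i : Euc n →L[ℝ] ℝ)).smulRight
        (EuclideanSpace.proj (𝕜 := ℝ) i : Euc n →L[ℝ] ℝ)) (unitVec j) (unitVec j)) = 2 := by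
    intro i _
    rw [Finset.sum_eq_single i] <;> simp +contextual [unitVec, eq_comm]
  rw [Finset.sum_congr rfl this]
  simp [mul_comm]

lemma gradDot_sqOn (s t : Finset (Fin n)) (w : Euc n) :
    gradDot (sqOn s) (sqOn t) w = 4 * sqOn (s ∩ t) w := by
  simp only [gradDot, fderiv_sqOn_unitVec, sqOn, Finset.mul_sum]
  rw [← Finset.sum_filter_add_sum_filter_not Finset.univ (· ∈ s ∩ t)]
  have h1 : ∑ i ∈ Finset.univ.filter (fun x => x ∉ s ∩ t),
      (if i ∈ s then 2 * w i else 0) * (if i ∈ t then 2 * w i else 0) = 0 := by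
    refine Finset.sum_eq_zero fun i hi => ?_
    simp only [Finset.mem_filter, Finset.mem_inter, not_and] at hi
    split_ifs with h1 h2 <;> simp_all
  rw [h1, add_zero, Finset.filter_univ_mem]
  refine Finset.sum_congr rfl fun i hi => ?_
  rw [Finset.mem_inter] at hi
  simp only [hi.1, hi.2, if_true]
  ring

/-- The fraction of the squared norm carried by the components with index in `s`. -/
def sqRatio (s : Finset (Fin n)) (w : Euc n) : ℝ := sqOn s w * (‖w‖ ^ 2)⁻¹

lemma contDiffAt_inv_normSq (hw : w ≠ 0) :
    ContDiffAt ℝ 2 (fun y : Euc n => (‖y‖ ^ 2)⁻¹) w := by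
  have : ‖w‖ ^ 2 ≠ 0 := by simpa using hw
  exact ((contDiff_norm_sq ℝ).contDiffAt).inv this

lemma contDiffAt_sqRatio (s : Finset (Fin n)) (hw : w ≠ 0) :
    ContDiffAt ℝ 2 (sqRatio s) w :=
  (contDiff_sqOn s).contDiffAt.mul (contDiffAt_inv_normSq hw)

lemma gradDot_comp_right {g : ℝ → ℝ} (hG : DifferentiableAt ℝ G w)
    (hg : DifferentiableAt ℝ g (G w)) :
    gradDot F (fun y => g (G y)) w = deriv g (G w) * gradDot F G w := by
  have := (hg.hasDerivAt.comp_hasFDerivAt w hG.hasFDerivAt).fderiv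
  simp only [gradDot, Finset.mul_sum]
  refine Finset.sum_congr rfl fun i _ => ?_
  change _ * (fderiv ℝ (g ∘ G) w) _ = _
  rw [this]
  simp
  ring

lemma gradDot_mul_right {H : Euc n → ℝ} (hG : DifferentiableAt ℝ G w)
    (hH : DifferentiableAt ℝ H w) :
    gradDot F (fun y => G y * H y) w = G w * gradDot F H w + H w * gradDot F G w := by
  simp only [gradDot, Finset.mul_sum, ← Finset.sum_add_distrib]
  refine Finset.sum_congr rfl fun i _ => ?_
  rw [fderiv_fun_mul hG hH]
  simp
  ring

lemma gradDot_inv_normSq_right (hw : w ≠ 0) :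
    gradDot F (fun y => (‖y‖ ^ 2)⁻¹) w
      = -((‖w‖ ^ 2)⁻¹ ^ 2) * gradDot F (sqOn Finset.univ) w := by
  have h0 : sqOn Finset.univ w ≠ 0 := by rw [sqOn_univ]; simpa using hw
  have := gradDot_comp_right (F := F) (G := sqOn Finset.univ) (g := fun x => x⁻¹) (w := w)
    ((contDiff_sqOn _).contDiffAt.differentiableAt (by norm_num))
    (differentiableAt_inv h0)
  simp only [sqOn_univ, deriv_inv, inv_pow] at this ⊢
  exact this

lemma lap_inv_normSq (hw : w ≠ 0) :
    lap (fun y : Euc n => (‖y‖ ^ 2)⁻¹) w = -2 * (n - 4) * (‖w‖ ^ 2)⁻¹ ^ 2 := by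
  have h0 : sqOn Finset.univ w ≠ 0 := by rw [sqOn_univ]; simpa using hw
  have := lap_comp (F := sqOn Finset.univ) (g := fun x => x⁻¹) (w := w)
    ((contDiff_sqOn _).contDiffAt) (contDiffAt_inv ℝ h0)
  have hd : deriv (fun x : ℝ => x⁻¹) = fun x => -(x ^ 2)⁻¹ := by funext x; simp
  have hd2 : deriv (deriv (fun x : ℝ => x⁻¹)) (sqOn Finset.univ w)
      = 2 * ((sqOn Finset.univ w) ^ 3)⁻¹ := by
    rw [hd]
    have := ((hasDerivAt_pow 2 (sqOn Finset.univ w)).inv (pow_ne_zero 2 h0)).neg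
    rw [show (fun x : ℝ => -(x ^ 2)⁻¹) = -(fun x : ℝ => x ^ 2)⁻¹ from rfl, this.deriv]
    field_simp
    norm_num
    ring
  rw [hd2, hd, lap_sqOn, gradDot_sqOn] at this
  simp only [sqOn_univ, Finset.inter_self, Finset.card_univ, Fintype.card_fin] at this
  rw [this]
  rw [sqOn_univ] at h0
  field_simp
  ring

lemma gradDot_sqRatio (s t : Finset (Fin n)) (hw : w ≠ 0) :
    gradDot (sqRatio s) (sqRatio t) w
      = 4 * (‖w‖ ^ 2)⁻¹ * (sqRatio (s ∩ t) w - sqRatio s w * sqRatio t w) := by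
  have h0 : ‖w‖ ^ 2 ≠ 0 := by simpa using hw
  have d1 : ∀ s : Finset (Fin n), DifferentiableAt ℝ (sqOn s) w := fun s =>
    (contDiff_sqOn s).contDiffAt.differentiableAt (by norm_num)
  have d2 : DifferentiableAt ℝ (fun y : Euc n => (‖y‖ ^ 2)⁻¹) w :=
    (contDiffAt_inv_normSq hw).differentiableAt (by norm_num)
  have e1 : ∀ (H : Euc n → ℝ) (t : Finset (Fin n)),
      gradDot H (sqRatio t) w = (‖w‖ ^ 2)⁻¹ * gradDot H (sqOn t) w
        - sqOn t w * (‖w‖ ^ 2)⁻¹ ^ 2 * gradDot H (sqOn Finset.univ) w := by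
    intro H t
    unfold sqRatio
    rw [gradDot_mul_right (d1 t) d2, gradDot_inv_normSq_right hw]
    ring
  rw [e1 _ t, gradDot_comm,
    gradDot_comm (F := sqRatio s), e1 _ s, e1 _ s]
  simp only [gradDot_sqOn, Finset.univ_inter, Finset.inter_univ, sqRatio, sqOn_univ]
  rw [Finset.inter_comm t s]
  field_simp
  ring

lemma lap_sqRatio (s : Finset (Fin n)) (hw : w ≠ 0) :
    lap (sqRatio s) w = (‖w‖ ^ 2)⁻¹ * (2 * s.card - 2 * n * sqRatio s w) := by
  have h0 : ‖w‖ ^ 2 ≠ 0 := by simpa using hw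
  unfold sqRatio
  rw [lap_mul (contDiff_sqOn s).contDiffAt (contDiffAt_inv_normSq hw), lap_inv_normSq hw,
    lap_sqOn, gradDot_inv_normSq_right hw, gradDot_sqOn,
    Finset.inter_univ]
  field_simp
  ring

lemma lap_sqRatio_pow (s : Finset (Fin n)) (k : ℕ) (hw : w ≠ 0) :
    lap (fun y => sqRatio s y ^ (k + 1)) w = (‖w‖ ^ 2)⁻¹ * (2 * (k + 1)) *
      ((s.card + 2 * k) * sqRatio s w ^ k - (n + 2 * k) * sqRatio s w ^ (k + 1)) := by
  have := lap_comp (g := fun x => x ^ (k + 1)) (contDiffAt_sqRatio s hw) (by fun_prop)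
  have hd : deriv (fun x : ℝ => x ^ (k + 1)) = fun x => ((k : ℝ) + 1) * x ^ k := by
    funext x
    simp
  have hd2 : deriv (fun x : ℝ => ((k : ℝ) + 1) * x ^ k) (sqRatio s w)
      = ((k : ℝ) + 1) * (k * sqRatio s w ^ (k - 1)) := by
    simp
  rw [hd, hd2, lap_sqRatio s hw, gradDot_sqRatio s s hw, Finset.inter_self] at this
  rw [this]
  rcases k with _ | k
  · simp; ring
  · push_cast
    ring

lemma lap_sqRatio_mul (s t : Finset (Fin n)) (hst : Disjoint s t) (hw : w ≠ 0) :
    lap (fun y => sqRatio s y * sqRatio t y) w = (‖w‖ ^ 2)⁻¹ *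
      (2 * t.card * sqRatio s w + 2 * s.card * sqRatio t w
        - (4 * n + 8) * (sqRatio s w * sqRatio t w)) := by
  rw [lap_mul (contDiffAt_sqRatio s hw) (contDiffAt_sqRatio t hw), lap_sqRatio s hw,
    lap_sqRatio t hw, gradDot_sqRatio s t hw, Finset.disjoint_iff_inter_eq_empty.1 hst]
  simp only [sqRatio, sqOn, Finset.sum_empty]
  ring

end Laplacian

section Rotation

variable {L : ℕ} {τ : Measure (Sph L)}

/-- Invariance of a measure on the sphere under orthogonal transformations, tested on
continuous functions. -/
def IsRotInv (τ : Measure (Sph L)) : Prop :=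
  ∀ O ∈ unitary (Euc (L + 1) →L[ℝ] Euc (L + 1)), ∀ f : Euc (L + 1) → ℝ,
    ContinuousOn f (Metric.sphere 0 1) → ∫ ξ : Sph L, f (O ξ) ∂τ = ∫ ξ : Sph L, f ξ ∂τ

lemma norm_unitary_apply {n : ℕ} {O : Euc n →L[ℝ] Euc n}
    (hO : O ∈ unitary (Euc n →L[ℝ] Euc n)) (x : Euc n) : ‖O x‖ = ‖x‖ :=
  ContinuousLinearMap.norm_map_of_mem_unitary hO x

lemma integral_uIoc_swap_of_continuousOn [IsFiniteMeasure τ] {g : ℝ → Sph L → ℝ}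
    (hg : ContinuousOn (Function.uncurry g) (Set.Icc 0 1 ×ˢ Set.univ)) :
    ∫ s in (0 : ℝ)..1, (∫ ξ, g s ξ ∂τ) = ∫ ξ, (∫ s in (0 : ℝ)..1, g s ξ) ∂τ := by
  refine intervalIntegral_integral_swap ?_
  have h : IntegrableOn (Function.uncurry g) (Set.Icc 0 1 ×ˢ Set.univ) (volume.prod τ) :=
    hg.integrableOn_compact (isCompact_Icc.prod isCompact_univ)
  have h2 : (volume.restrict (Set.uIoc (0 : ℝ) 1)).prod τ
      = (volume.prod τ).restrict (Set.uIoc (0 : ℝ) 1 ×ˢ Set.univ) := by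
    rw [← Measure.prod_restrict, Measure.restrict_univ]
  rw [h2]
  refine h.mono_set (Set.prod_mono ?_ subset_rfl)
  rw [Set.uIoc_of_le zero_le_one]
  exact Set.Ioc_subset_Icc_self

lemma continuousOn_integral_sphere [IsFiniteMeasure τ] {g : ℝ → Sph L → ℝ}
    (hg : ContinuousOn (Function.uncurry g) (Set.Icc 0 1 ×ˢ Set.univ)) :
    ContinuousOn (fun s => ∫ ξ, g s ξ ∂τ) (Set.Icc 0 1) := by
  rw [continuousOn_iff_continuous_domRestrict]
  have h : Continuous (Function.uncurry fun (s : Set.Icc (0 : ℝ) 1) (ξ : Sph L) => g s ξ) :=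
    hg.comp_continuous (f := fun p : Set.Icc (0 : ℝ) 1 × Sph L => ((p.1 : ℝ), p.2))
      (by fun_prop) fun p => ⟨p.1.2, Set.mem_univ _⟩
  have := continuous_parametric_integral_of_continuous (μ := τ) h isCompact_univ
  simp only [Measure.restrict_univ] at this
  exact this

/-- Infinitesimal rotation invariance. -/
lemma integral_fderiv_skew_eq_zero [IsFiniteMeasure τ] (hτ : IsRotInv τ) {f : Euc (L + 1) → ℝ}
    {f' : Euc (L + 1) → Euc (L + 1) →L[ℝ] ℝ}
    (hf : ∀ ξ ∈ Metric.sphere (0 : Euc (L + 1)) 1, HasFDerivAt f (f' ξ) ξ)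
    (hf' : ContinuousOn f' (Metric.sphere 0 1))
    {K : Euc (L + 1) →L[ℝ] Euc (L + 1)} (hK : K ∈ skewAdjoint (Euc (L + 1) →L[ℝ] Euc (L + 1))) :
    ∫ ξ : Sph L, f' ξ (K ξ) ∂τ = 0 := by
  let _ : NormedAlgebra ℚ (Euc (L + 1) →L[ℝ] Euc (L + 1)) := NormedAlgebra.restrictScalars ℚ ℝ _
  set R : ℝ → Euc (L + 1) →L[ℝ] Euc (L + 1) := fun θ => NormedSpace.exp (θ • K) with hR
  have hRu : ∀ θ, R θ ∈ unitary (Euc (L + 1) →L[ℝ] Euc (L + 1)) := fun θ =>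
    NormedSpace.exp_mem_unitary_of_mem_skewAdjoint (skewAdjoint.smul_mem θ hK)
  have hRs : ∀ θ (ξ : Sph L), R θ ξ ∈ Metric.sphere (0 : Euc (L + 1)) 1 := fun θ ξ => by
    rw [mem_sphere_zero_iff_norm, norm_unitary_apply (hRu θ)]
    exact norm_eq_of_mem_sphere ξ
  have hRd : ∀ θ, HasDerivAt R (K * R θ) θ := fun θ => hasDerivAt_exp_smul_const' K θ
  have hRc : Continuous R := continuous_iff_continuousAt.2 fun θ => (hRd θ).continuousAt
  have hcf : ContinuousOn f (Metric.sphere 0 1) := fun ξ hξ =>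
    (hf ξ hξ).continuousAt.continuousWithinAt
  have hR2 : Continuous fun p : ℝ × Sph L => R p.1 p.2 :=
    (hRc.comp continuous_fst).clm_apply (continuous_subtype_val.comp continuous_snd)
  have hf'R : Continuous fun p : ℝ × Sph L => f' (R p.1 p.2) :=
    hf'.comp_continuous hR2 fun p => hRs p.1 p.2
  have hg : Continuous fun p : ℝ × Sph L => f' (R p.1 p.2) (K (R p.1 p.2)) :=
    hf'R.clm_apply (K.continuous.comp hR2)
  have hFTC : ∀ ξ : Sph L, ∫ θ in (0 : ℝ)..1, f' (R θ ξ) (K (R θ ξ)) = f (R 1 ξ) - f ξ := by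
    intro ξ
    have := intervalIntegral.integral_eq_sub_of_hasDerivAt (a := 0) (b := 1)
      (f := fun θ => f (R θ ξ)) (f' := fun θ => f' (R θ ξ) (K (R θ ξ)))
      (fun θ _ => (hf _ (hRs θ ξ)).comp_hasDerivAt θ
        (by simpa using (hRd θ).clm_apply (hasDerivAt_const θ (ξ : Euc (L + 1)))))
      ((hg.comp (Continuous.prodMk_left ξ)).intervalIntegrable _ _)
    have h0 : R 0 = 1 := by
      have h : (0 : ℝ) • K = 0 := zero_smul ℝ K
      simp only [hR]
      rw [h]
      exact NormedSpace.exp_zero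
    rw [this, h0, one_apply_eq_self]
  have hsw := integral_uIoc_swap_of_continuousOn (τ := τ)
    (g := fun θ ξ => f' (R θ ξ) (K (R θ ξ))) hg.continuousOn
  simp only [hFTC] at hsw
  have hcfS : Continuous fun ξ : Sph L => f ξ :=
    hcf.comp_continuous continuous_subtype_val fun ξ => ξ.2
  have hcfR : Continuous fun ξ : Sph L => f (R 1 ξ) :=
    hcf.comp_continuous (hR2.comp (Continuous.prodMk_right 1)) fun ξ => hRs 1 ξ
  rw [integral_sub (hcfR.integrable_of_hasCompactSupport (HasCompactSupport.of_compactSpace _))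
    (hcfS.integrable_of_hasCompactSupport (HasCompactSupport.of_compactSpace _)),
    hτ _ (hRu 1) f hcf, sub_self] at hsw
  have hinv : ∀ θ, ∫ ξ : Sph L, f' (R θ ξ) (K (R θ ξ)) ∂τ = ∫ ξ : Sph L, f' ξ (K ξ) ∂τ :=
    fun θ => hτ _ (hRu θ) (fun ξ => f' ξ (K ξ)) (hf'.clm_apply K.continuous.continuousOn)
  simpa [hinv] using hsw

/-- The generator `x ↦ x_i e_j - x_j e_i` of rotations in a coordinate plane. -/
def planeGen {n : ℕ} (i j : Fin n) : Euc n →L[ℝ] Euc n :=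
  (EuclideanSpace.proj (𝕜 := ℝ) i : Euc n →L[ℝ] ℝ).smulRight (unitVec j)
    - (EuclideanSpace.proj (𝕜 := ℝ) j : Euc n →L[ℝ] ℝ).smulRight (unitVec i)

lemma planeGen_apply {n : ℕ} (i j : Fin n) (x : Euc n) :
    planeGen i j x = x i • unitVec j - x j • unitVec i := rfl

lemma planeGen_mem_skewAdjoint {n : ℕ} (i j : Fin n) :
    planeGen i j ∈ skewAdjoint (Euc n →L[ℝ] Euc n) := by
  rw [skewAdjoint.mem_iff, ContinuousLinearMap.star_eq_adjoint, eq_comm,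
    ContinuousLinearMap.eq_adjoint_iff]
  intro x y
  simp [planeGen_apply, unitVec, inner_sub_left, inner_sub_right, inner_smul_left,
    inner_smul_right, EuclideanSpace.inner_single_left, EuclideanSpace.inner_single_right]
  ring

lemma sum_unitVec {n : ℕ} (x : Euc n) : ∑ i, x i • unitVec i = x := by
  ext j
  simp [unitVec, Pi.single_apply]

lemma sum_planeGen_planeGen {n : ℕ} (x : Euc n) :
    ∑ i, ∑ j, planeGen i j (planeGen i j x) = (-2 * ((n : ℝ) - 1)) • x := by
  have h : ∀ i j : Fin n, planeGen i j (planeGen i j x)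
      = 2 • (if i = j then x i • unitVec i else 0) - x i • unitVec i - x j • unitVec j := by
    intro i j
    rcases eq_or_ne i j with rfl | hij
    · simp [planeGen_apply]
      module
    · simp [planeGen_apply, unitVec, hij, hij.symm]
      module
  have h1 : ∑ i, ∑ _j : Fin n, x i • unitVec i = (n : ℝ) • x := by
    conv_rhs => rw [← sum_unitVec x, Finset.smul_sum]
    simp [Nat.cast_smul_eq_nsmul]
  have h2 : ∑ _i : Fin n, ∑ j, x j • unitVec j = (n : ℝ) • x := by
    simp [sum_unitVec, Nat.cast_smul_eq_nsmul]
  have h3 : ∑ i : Fin n, ∑ j : Fin n, 2 • (if i = j then x i • unitVec i else 0)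
      = (2 : ℝ) • x := by
    simp only [← Finset.smul_sum, Finset.sum_ite_eq, Finset.mem_univ, if_true, sum_unitVec]
    module
  simp only [h, Finset.sum_sub_distrib, h1, h2, h3]
  module

lemma sum_bilin_planeGen {n : ℕ} (B : Euc n →L[ℝ] Euc n →L[ℝ] ℝ) (x : Euc n) :
    ∑ i, ∑ j, B (planeGen i j x) (planeGen i j x)
      = 2 * (‖x‖ ^ 2 * ∑ i, B (unitVec i) (unitVec i) - B x x) := by
  have hx : B x x = ∑ i, ∑ j, x i * x j * B (unitVec i) (unitVec j) := by
    conv_lhs => rw [← sum_unitVec x]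
    simp only [map_sum, _root_.sum_apply, map_smul, _root_.smul_apply,
      smul_eq_mul, mul_assoc, Finset.mul_sum]
    rw [Finset.sum_comm]
    refine Finset.sum_congr rfl fun i _ => Finset.sum_congr rfl fun j _ => by ring
  have hx' : B x x = ∑ i, ∑ j, x i * x j * B (unitVec j) (unitVec i) := by
    rw [hx, Finset.sum_comm]
    refine Finset.sum_congr rfl fun i _ => Finset.sum_congr rfl fun j _ => by ring
  have h1 : ‖x‖ ^ 2 * ∑ i, B (unitVec i) (unitVec i)
      = ∑ i, ∑ j, x i ^ 2 * B (unitVec j) (unitVec j) := by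
    rw [EuclideanSpace.norm_sq_eq, Finset.sum_mul_sum]; simp
  have h2 : ‖x‖ ^ 2 * ∑ i, B (unitVec i) (unitVec i)
      = ∑ i, ∑ j, x j ^ 2 * B (unitVec i) (unitVec i) := by
    rw [h1, Finset.sum_comm]
  have h3 : 2 * (‖x‖ ^ 2 * ∑ i, B (unitVec i) (unitVec i) - B x x)
      = ‖x‖ ^ 2 * ∑ i, B (unitVec i) (unitVec i) + ‖x‖ ^ 2 * ∑ i, B (unitVec i) (unitVec i)
        - B x x - B x x := by ring
  rw [h3]
  nth_rewrite 1 [h1]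
  rw [h2]
  nth_rewrite 1 [hx]
  rw [hx']
  simp only [← Finset.sum_add_distrib, ← Finset.sum_sub_distrib]
  refine Finset.sum_congr rfl fun i _ => Finset.sum_congr rfl fun j _ => ?_
  simp only [planeGen_apply, map_sub, map_smul, _root_.sub_apply,
    _root_.smul_apply, smul_eq_mul]
  ring

lemma continuousAt_fderiv_fderiv {n : ℕ} {F : Euc n → ℝ} {w : Euc n}
    (hF : ContDiffAt ℝ 2 F w) : ContinuousAt (fderiv ℝ (fderiv ℝ F)) w :=
  ((hF.fderiv_right (m := 1) (by norm_num)).fderiv_right (m := 0) (by norm_num)).continuousAt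

/-- The averaged spherical Laplacian vanishes. -/
lemma integral_lap_sub_eq_zero [IsFiniteMeasure τ] (hτ : IsRotInv τ) {F : Euc (L + 1) → ℝ}
    {v : Euc (L + 1)} {σ : ℝ}
    (hF : ∀ ξ : Sph L, ContDiffAt ℝ 2 F (v + σ • (ξ : Euc (L + 1)))) :
    ∫ ξ : Sph L, (σ * (lap F (v + σ • (ξ : Euc (L + 1)))
        - fderiv ℝ (fderiv ℝ F) (v + σ • (ξ : Euc (L + 1))) ξ ξ)
      - L * fderiv ℝ F (v + σ • (ξ : Euc (L + 1))) ξ) ∂τ = 0 := by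
  have hlin : Continuous fun ξ : Euc (L + 1) => v + σ • ξ := by fun_prop
  have hD1 : ContinuousOn (fun ξ : Euc (L + 1) => fderiv ℝ F (v + σ • ξ))
      (Metric.sphere 0 1) := fun ξ hξ =>
    (ContinuousAt.comp (f := fun ξ : Euc (L + 1) => v + σ • ξ) (g := fderiv ℝ F)
      (hasFDerivAt_fderiv_of_contDiffAt (hF ⟨ξ, hξ⟩)).continuousAt
      hlin.continuousAt).continuousWithinAt
  have hD2 : ContinuousOn (fun ξ : Euc (L + 1) => fderiv ℝ (fderiv ℝ F) (v + σ • ξ))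
      (Metric.sphere 0 1) := fun ξ hξ =>
    (ContinuousAt.comp (f := fun ξ : Euc (L + 1) => v + σ • ξ) (g := fderiv ℝ (fderiv ℝ F))
      (continuousAt_fderiv_fderiv (hF ⟨ξ, hξ⟩)) hlin.continuousAt).continuousWithinAt
  have key : ∀ i j : Fin (L + 1), ∫ ξ : Sph L,
      (σ * fderiv ℝ (fderiv ℝ F) (v + σ • (ξ : Euc (L + 1))) (planeGen i j ξ) (planeGen i j ξ)
        + fderiv ℝ F (v + σ • (ξ : Euc (L + 1))) (planeGen i j (planeGen i j ξ))) ∂τ = 0 := by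
    intro i j
    have h := integral_fderiv_skew_eq_zero hτ
      (f := fun ξ => fderiv ℝ F (v + σ • ξ) (planeGen i j ξ))
      (f' := fun ξ => ((fderiv ℝ F (v + σ • ξ)).comp (planeGen i j)
        + (((fderiv ℝ (fderiv ℝ F) (v + σ • ξ)).comp
          (σ • ContinuousLinearMap.id ℝ (Euc (L + 1)))).flip (planeGen i j ξ))))
      (fun ξ hξ => ?_) ?_ (planeGen_mem_skewAdjoint i j)
    · rw [← h]
      refine integral_congr_ae (Filter.Eventually.of_forall fun ξ => ?_)
      simp
      ring
    · have h1 : HasFDerivAt (fun ξ : Euc (L + 1) => v + σ • ξ)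
          (σ • ContinuousLinearMap.id ℝ (Euc (L + 1))) ξ :=
        ((hasFDerivAt_id ξ).const_smul σ).const_add v
      have h2 := (hasFDerivAt_fderiv_of_contDiffAt (hF ⟨ξ, hξ⟩)).comp ξ h1
      exact h2.clm_apply (planeGen i j).hasFDerivAt
    · refine (hD1.clm_comp continuousOn_const).add ?_
      refine ContinuousOn.clm_apply ?_ (planeGen i j).continuous.continuousOn
      exact (ContinuousLinearMap.flipₗᵢ ℝ _ _ _).continuous.comp_continuousOn
        (hD2.clm_comp continuousOn_const)
  have hsum : ∀ ξ : Sph L, (-2 : ℝ)⁻¹ * ∑ i, ∑ j,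
      (σ * fderiv ℝ (fderiv ℝ F) (v + σ • (ξ : Euc (L + 1))) (planeGen i j ξ) (planeGen i j ξ)
        + fderiv ℝ F (v + σ • (ξ : Euc (L + 1))) (planeGen i j (planeGen i j ξ)))
      = -(σ * (lap F (v + σ • (ξ : Euc (L + 1)))
        - fderiv ℝ (fderiv ℝ F) (v + σ • (ξ : Euc (L + 1))) ξ ξ)
      - L * fderiv ℝ F (v + σ • (ξ : Euc (L + 1))) ξ) := by
    intro ξ
    simp only [Finset.sum_add_distrib, ← Finset.mul_sum, ← map_sum, sum_bilin_planeGen,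
      sum_planeGen_planeGen, map_smul, norm_eq_of_mem_sphere ξ, lap, smul_eq_mul]
    push_cast
    ring
  have hint : ∀ i j : Fin (L + 1), Integrable (fun ξ : Sph L =>
      (σ * fderiv ℝ (fderiv ℝ F) (v + σ • (ξ : Euc (L + 1))) (planeGen i j ξ) (planeGen i j ξ)
        + fderiv ℝ F (v + σ • (ξ : Euc (L + 1))) (planeGen i j (planeGen i j ξ)))) τ := by
    intro i j
    refine Continuous.integrable_of_hasCompactSupport ?_ (HasCompactSupport.of_compactSpace _)
    have hc : Continuous fun ξ : Sph L => planeGen i j (ξ : Euc (L + 1)) :=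
      (planeGen i j).continuous.comp continuous_subtype_val
    have h1 : Continuous fun ξ : Sph L => fderiv ℝ F (v + σ • (ξ : Euc (L + 1))) :=
      hD1.comp_continuous continuous_subtype_val fun ξ => ξ.2
    have h2 : Continuous fun ξ : Sph L => fderiv ℝ (fderiv ℝ F) (v + σ • (ξ : Euc (L + 1))) :=
      hD2.comp_continuous continuous_subtype_val fun ξ => ξ.2
    exact (continuous_const.mul ((h2.clm_apply hc).clm_apply hc)).add
      (h1.clm_apply ((planeGen i j).continuous.comp hc))
  have hneg : ∫ ξ : Sph L, -(σ * (lap F (v + σ • (ξ : Euc (L + 1)))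
        - fderiv ℝ (fderiv ℝ F) (v + σ • (ξ : Euc (L + 1))) ξ ξ)
      - L * fderiv ℝ F (v + σ • (ξ : Euc (L + 1))) ξ) ∂τ = 0 := by
    simp only [← hsum]
    rw [integral_const_mul, integral_finsetSum _ fun i _ => integrable_finsetSum _
      fun j _ => hint i j]
    simp only [integral_finsetSum _ fun j _ => hint _ j, key, Finset.sum_const_zero, mul_zero]
  rwa [integral_neg, neg_eq_zero] at hneg

end Rotation

section Green

variable {L : ℕ} {τ : Measure (Sph L)} {v : Euc (L + 1)} {t : ℝ}

/-- The radial weight in Green's formula for a ball, rescaled to the unit interval. -/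
def greenWeight (L : ℕ) (s : ℝ) : ℝ := s * (1 - s ^ (L - 1)) / (L - 1)

/-- The mean of `κ` over the sphere of radius `σ` around `v`. -/
def sphMean (τ : Measure (Sph L)) (v : Euc (L + 1)) (κ : Euc (L + 1) → ℝ) (σ : ℝ) : ℝ :=
  ∫ ξ : Sph L, κ (v + σ • (ξ : Euc (L + 1))) ∂τ

/-- The integral of `κ` against Green's function of the ball of radius `t` around `v`,
up to the factor `t ^ 2`. -/
def greenInt (τ : Measure (Sph L)) (v : Euc (L + 1)) (t : ℝ) (κ : Euc (L + 1) → ℝ) : ℝ :=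
  ∫ s in (0 : ℝ)..1, greenWeight L s * sphMean τ v κ (t * s)

lemma continuous_greenWeight : Continuous (greenWeight L) := by
  unfold greenWeight; fun_prop

lemma greenWeight_nonneg (hL : 2 ≤ L) {s : ℝ} (hs : s ∈ Set.Icc (0 : ℝ) 1) :
    0 ≤ greenWeight L s := by
  have hL' : (2 : ℝ) ≤ L := by exact_mod_cast hL
  have := pow_le_one₀ hs.1 hs.2 (n := L - 1)
  exact div_nonneg (mul_nonneg hs.1 (by linarith)) (by linarith)

lemma integral_greenWeight (hL : 2 ≤ L) :
    ∫ s in (0 : ℝ)..1, greenWeight L s = 1 / (2 * (L + 1)) := by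
  obtain ⟨k, rfl⟩ := Nat.exists_eq_add_of_le' hL
  have : ∀ s : ℝ, greenWeight (k + 2) s = (s - s ^ (k + 2)) * (1 / ((k : ℝ) + 1)) := by
    intro s
    have hk : ((k + 2 : ℕ) : ℝ) - 1 = k + 1 := by push_cast; ring
    simp only [greenWeight, show k + 2 - 1 = k + 1 from rfl, hk]
    field_simp
    ring
  simp only [this]
  rw [intervalIntegral.integral_mul_const, intervalIntegral.integral_sub (by simp) (by simp),
    integral_id, integral_pow]
  push_cast
  field_simp
  ring

lemma integral_greenWeight_mul_sq (hL : 2 ≤ L) :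
    ∫ s in (0 : ℝ)..1, greenWeight L s * s ^ 2 = 1 / (4 * (L + 3)) := by
  obtain ⟨k, rfl⟩ := Nat.exists_eq_add_of_le' hL
  have : ∀ s : ℝ, greenWeight (k + 2) s * s ^ 2
      = (s ^ 3 - s ^ (k + 4)) * (1 / ((k : ℝ) + 1)) := by
    intro s
    have hk : ((k + 2 : ℕ) : ℝ) - 1 = k + 1 := by push_cast; ring
    simp only [greenWeight, show k + 2 - 1 = k + 1 from rfl, hk]
    field_simp
    ring
  simp only [this]
  rw [intervalIntegral.integral_mul_const, intervalIntegral.integral_sub (by simp) (by simp),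
    integral_pow, integral_pow]
  push_cast
  field_simp
  ring

lemma le_norm_add_smul (hv : ‖v‖ = 1) {σ : ℝ} (hσ : 0 ≤ σ) (ξ : Sph L) :
    1 - σ ≤ ‖v + σ • (ξ : Euc (L + 1))‖ := by
  have h1 : ‖σ • (ξ : Euc (L + 1))‖ = σ := by
    rw [norm_smul, norm_eq_of_mem_sphere ξ, Real.norm_of_nonneg hσ, mul_one]
  have := norm_sub_norm_le v (-(σ • (ξ : Euc (L + 1))))
  rw [norm_neg, h1, hv, sub_neg_eq_add] at this
  exact this

lemma add_smul_ne_zero (hv : ‖v‖ = 1) {σ : ℝ} (hσ : 0 ≤ σ) (hσ1 : σ < 1) (ξ : Sph L) :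
    v + σ • (ξ : Euc (L + 1)) ≠ 0 := by
  rw [← norm_pos_iff]
  linarith [le_norm_add_smul hv hσ ξ]

lemma mul_mem_of_mem_Icc (ht : 0 ≤ t) (ht1 : t < 1) {s : ℝ} (hs : s ∈ Set.Icc (0 : ℝ) 1) :
    0 ≤ t * s ∧ t * s < 1 :=
  ⟨mul_nonneg ht hs.1, by nlinarith [hs.1, hs.2]⟩

lemma continuousOn_comp_add_smul {E : Type*} [TopologicalSpace E] {κ : Euc (L + 1) → E}
    (hκ : ∀ w ≠ 0, ContinuousAt κ w) (hv : ‖v‖ = 1) (ht : 0 ≤ t) (ht1 : t < 1) :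
    ContinuousOn (fun p : ℝ × Sph L => κ (v + (t * p.1) • (p.2 : Euc (L + 1))))
      (Set.Icc 0 1 ×ˢ Set.univ) := by
  intro p hp
  have h := mul_mem_of_mem_Icc ht ht1 hp.1
  refine ContinuousAt.continuousWithinAt (ContinuousAt.comp
    (f := fun p : ℝ × Sph L => v + (t * p.1) • (p.2 : Euc (L + 1)))
    (hκ _ (add_smul_ne_zero hv h.1 h.2 p.2)) ?_)
  exact Continuous.continuousAt (by fun_prop)

lemma continuous_comp_add_smul_sphere {κ : Euc (L + 1) → ℝ}
    (hκ : ∀ w ≠ 0, ContinuousAt κ w) (hv : ‖v‖ = 1) {σ : ℝ} (hσ : 0 ≤ σ) (hσ1 : σ < 1) :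
    Continuous fun ξ : Sph L => κ (v + σ • (ξ : Euc (L + 1))) := by
  rw [continuous_iff_continuousAt]
  intro ξ
  refine ContinuousAt.comp (f := fun ξ : Sph L => v + σ • (ξ : Euc (L + 1)))
    (hκ _ (add_smul_ne_zero hv hσ hσ1 ξ)) ?_
  exact Continuous.continuousAt (by fun_prop)

lemma integrable_sphere [IsFiniteMeasure τ] {f : Sph L → ℝ} (hf : Continuous f) :
    Integrable f τ :=
  hf.integrable_of_hasCompactSupport (HasCompactSupport.of_compactSpace _)

lemma integrable_comp_add_smul [IsFiniteMeasure τ] {κ : Euc (L + 1) → ℝ}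
    (hκ : ∀ w ≠ 0, ContinuousAt κ w) (hv : ‖v‖ = 1) {σ : ℝ} (hσ : 0 ≤ σ) (hσ1 : σ < 1) :
    Integrable (fun ξ : Sph L => κ (v + σ • (ξ : Euc (L + 1)))) τ :=
  integrable_sphere (continuous_comp_add_smul_sphere hκ hv hσ hσ1)

lemma continuousOn_sphMean [IsFiniteMeasure τ] {κ : Euc (L + 1) → ℝ}
    (hκ : ∀ w ≠ 0, ContinuousAt κ w) (hv : ‖v‖ = 1) (ht : 0 ≤ t) (ht1 : t < 1) :
    ContinuousOn (fun s => sphMean τ v κ (t * s)) (Set.Icc 0 1) := by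
  have h := continuousOn_comp_add_smul hκ hv ht ht1
  exact continuousOn_integral_sphere (τ := τ)
    (g := fun s ξ => κ (v + (t * s) • (ξ : Euc (L + 1)))) h

lemma intervalIntegrable_greenWeight_mul {h : ℝ → ℝ} (hh : ContinuousOn h (Set.Icc 0 1)) :
    IntervalIntegrable (fun s => greenWeight L s * h s) volume 0 1 := by
  refine ContinuousOn.intervalIntegrable ?_
  rw [Set.uIcc_of_le zero_le_one]
  exact continuous_greenWeight.continuousOn.mul hh

lemma continuousAt_lap {n : ℕ} {F : Euc n → ℝ} {w : Euc n} (hF : ContDiffAt ℝ 2 F w) :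
    ContinuousAt (lap F) w := by
  unfold lap
  have := continuousAt_fderiv_fderiv hF
  fun_prop

lemma hasDerivAt_comp_line {n : ℕ} {E : Type*} [NormedAddCommGroup E] [NormedSpace ℝ E]
    {G : Euc n → E} {G' : Euc n →L[ℝ] E} {v x : Euc n} {t s : ℝ}
    (hG : HasFDerivAt G G' (v + (t * s) • x)) :
    HasDerivAt (fun s : ℝ => G (v + (t * s) • x)) (t • G' x) s := by
  have h1 : HasDerivAt (fun s : ℝ => v + (t * s) • x) (t • x) s := by
    have h := (((hasDerivAt_id s).const_mul t).smul_const x).const_add v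
    simp only [mul_one] at h
    exact h
  have h2 : HasDerivAt (G ∘ fun s : ℝ => v + (t * s) • x) (G' (t • x)) s :=
    HasFDerivAt.comp_hasDerivAt s hG h1
  rw [map_smul] at h2
  exact h2

lemma hasDerivAt_greenWeight (s : ℝ) : HasDerivAt (greenWeight L)
    ((1 * (1 - s ^ (L - 1)) + s * -(((L - 1 : ℕ) : ℝ) * s ^ (L - 1 - 1))) / (L - 1)) s := by
  unfold greenWeight
  exact ((hasDerivAt_id s).mul ((hasDerivAt_pow (L - 1) s).const_sub 1)).div_const _

lemma hasDerivAt_greenWeight_mul_add (hL : 2 ≤ L) {F : Euc (L + 1) → ℝ} {s : ℝ}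
    {x : Euc (L + 1)} (hF : ContDiffAt ℝ 2 F (v + (t * s) • x)) :
    HasDerivAt (fun s => greenWeight L s * (t * fderiv ℝ F (v + (t * s) • x) x)
        + F (v + (t * s) • x))
      ((1 - s ^ (L - 1)) / (L - 1) *
        (s * (t ^ 2 * fderiv ℝ (fderiv ℝ F) (v + (t * s) • x) x x)
          + L * (t * fderiv ℝ F (v + (t * s) • x) x))) s := by
  have h1 := hasDerivAt_comp_line (hF.differentiableAt (by norm_num)).hasFDerivAt
  have h2 := (hasDerivAt_comp_line (hasFDerivAt_fderiv_of_contDiffAt hF)).clm_apply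
    (hasDerivAt_const s x)
  refine (((hasDerivAt_greenWeight s).mul (h2.const_mul t)).add h1).congr_deriv ?_
  simp only [_root_.smul_apply, map_zero, add_zero, smul_eq_mul]
  generalize fderiv ℝ F (v + (t * s) • x) x = d1
  generalize fderiv ℝ (fderiv ℝ F) (v + (t * s) • x) x x = d2
  obtain ⟨k, rfl⟩ := Nat.exists_eq_add_of_le' hL
  have hk : ((k + 2 : ℕ) : ℝ) - 1 = k + 1 := by push_cast; ring
  have hk0 : (k : ℝ) + 1 ≠ 0 := by positivity
  simp only [greenWeight, show k + 2 - 1 = k + 1 from rfl, Nat.add_sub_cancel, hk]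
  push_cast
  field_simp
  ring

/-- Green's representation formula for a ball, for a function which is `C²` away from the
origin. -/
lemma sphMean_sub_eq_greenInt_lap (hL : 2 ≤ L) [IsProbabilityMeasure τ] (hτ : IsRotInv τ)
    {F : Euc (L + 1) → ℝ} (hF : ∀ w ≠ 0, ContDiffAt ℝ 2 F w) (hv : ‖v‖ = 1) (ht : 0 ≤ t)
    (ht1 : t < 1) :
    sphMean τ v F t - F v = t ^ 2 * greenInt τ v t (lap F) := by
  have hL' : (0 : ℝ) < L - 1 := by
    have : (2 : ℝ) ≤ L := by exact_mod_cast hL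
    linarith
  set w : ℝ → Sph L → Euc (L + 1) := fun s ξ => v + (t * s) • (ξ : Euc (L + 1)) with hw
  have hw0 : ∀ s ∈ Set.Icc (0 : ℝ) 1, ∀ ξ, w s ξ ≠ 0 := fun s hs ξ =>
    add_smul_ne_zero hv (mul_mem_of_mem_Icc ht ht1 hs).1 (mul_mem_of_mem_Icc ht ht1 hs).2 ξ
  set G : ℝ → Sph L → ℝ := fun s ξ => (1 - s ^ (L - 1)) / (L - 1) *
    (s * (t ^ 2 * fderiv ℝ (fderiv ℝ F) (w s ξ) ξ ξ) + L * (t * fderiv ℝ F (w s ξ) ξ)) with hG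
  have c1 : ContinuousOn (fun p : ℝ × Sph L => fderiv ℝ F (w p.1 p.2))
      (Set.Icc 0 1 ×ˢ Set.univ) := continuousOn_comp_add_smul
    (fun y hy => (hasFDerivAt_fderiv_of_contDiffAt (hF y hy)).continuousAt) hv ht ht1
  have c2 : ContinuousOn (fun p : ℝ × Sph L => fderiv ℝ (fderiv ℝ F) (w p.1 p.2))
      (Set.Icc 0 1 ×ˢ Set.univ) := continuousOn_comp_add_smul
    (fun y hy => continuousAt_fderiv_fderiv (hF y hy)) hv ht ht1
  have c3 : Continuous fun p : ℝ × Sph L => (p.2 : Euc (L + 1)) := by fun_prop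
  have cD1 : ContinuousOn (fun p : ℝ × Sph L => fderiv ℝ F (w p.1 p.2) p.2)
      (Set.Icc 0 1 ×ˢ Set.univ) := c1.clm_apply c3.continuousOn
  have cD2 : ContinuousOn (fun p : ℝ × Sph L => fderiv ℝ (fderiv ℝ F) (w p.1 p.2) p.2 p.2)
      (Set.Icc 0 1 ×ˢ Set.univ) := (c2.clm_apply c3.continuousOn).clm_apply c3.continuousOn
  have cG : ContinuousOn (Function.uncurry G) (Set.Icc 0 1 ×ˢ Set.univ) := by
    have e1 : Continuous fun p : ℝ × Sph L => (1 - p.1 ^ (L - 1)) / ((L : ℝ) - 1) := by fun_prop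
    exact e1.continuousOn.mul ((continuous_fst.continuousOn.mul (continuousOn_const.mul cD2)).add
      (continuousOn_const.mul (continuousOn_const.mul cD1)))
  have hFTC : ∀ ξ : Sph L, ∫ s in (0 : ℝ)..1, G s ξ = F (v + t • (ξ : Euc (L + 1))) - F v := by
    intro ξ
    have hd : ∀ s ∈ Set.uIcc (0 : ℝ) 1, HasDerivAt
        (fun s => greenWeight L s * (t * fderiv ℝ F (w s ξ) ξ) + F (w s ξ)) (G s ξ) s := by
      intro s hs
      rw [Set.uIcc_of_le zero_le_one] at hs
      exact hasDerivAt_greenWeight_mul_add hL (hF _ (hw0 s hs ξ))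
    have hi : IntervalIntegrable (fun s => G s ξ) volume 0 1 := by
      refine ContinuousOn.intervalIntegrable ?_
      rw [Set.uIcc_of_le zero_le_one]
      exact cG.comp (f := fun s : ℝ => (s, ξ)) (Continuous.prodMk_left ξ).continuousOn
        fun s hs => ⟨hs, Set.mem_univ _⟩
    rw [intervalIntegral.integral_eq_sub_of_hasDerivAt hd hi]
    simp [greenWeight, hw]
  have hmean : ∀ s ∈ Set.Icc (0 : ℝ) 1, ∫ ξ, G s ξ ∂τ
      = t ^ 2 * (greenWeight L s * sphMean τ v (lap F) (t * s)) := by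
    intro s hs
    obtain ⟨hσ, hσ1⟩ := mul_mem_of_mem_Icc ht ht1 hs
    have h := integral_lap_sub_eq_zero hτ (F := F) (v := v) (σ := t * s)
      fun ξ => hF _ (hw0 s hs ξ)
    have cs : ∀ {g : ℝ × Sph L → ℝ}, ContinuousOn g (Set.Icc 0 1 ×ˢ Set.univ) →
        Integrable (fun ξ => g (s, ξ)) τ := fun hg => integrable_sphere
      (hg.comp_continuous (Continuous.prodMk_right s) fun ξ => ⟨hs, Set.mem_univ _⟩)
    have i0 : Integrable (fun ξ : Sph L => lap F (w s ξ)) τ :=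
      integrable_comp_add_smul (fun y hy => continuousAt_lap (hF y hy)) hv hσ hσ1
    have i1 : Integrable (fun ξ : Sph L => fderiv ℝ F (w s ξ) ξ) τ := cs cD1
    have i2 : Integrable (fun ξ : Sph L => fderiv ℝ (fderiv ℝ F) (w s ξ) ξ ξ) τ := cs cD2
    have i3 : Integrable
        (fun ξ : Sph L => lap F (w s ξ) - fderiv ℝ (fderiv ℝ F) (w s ξ) ξ ξ) τ := i0.sub i2
    change ∫ ξ : Sph L, (t * s * (lap F (w s ξ) - fderiv ℝ (fderiv ℝ F) (w s ξ) ξ ξ)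
      - L * fderiv ℝ F (w s ξ) ξ) ∂τ = 0 at h
    rw [integral_sub (i3.const_mul _) (i1.const_mul _), integral_const_mul,
      integral_const_mul, integral_sub i0 i2] at h
    simp only [hG]
    rw [integral_const_mul, integral_add ((i2.const_mul _).const_mul _)
      ((i1.const_mul _).const_mul _), integral_const_mul, integral_const_mul, integral_const_mul,
      integral_const_mul]
    change _ = t ^ 2 * (greenWeight L s * ∫ ξ : Sph L, lap F (w s ξ) ∂τ)
    have h' : (L : ℝ) * (t * ∫ ξ : Sph L, fderiv ℝ F (w s ξ) ξ ∂τ) = t * (t * s *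
        ((∫ ξ : Sph L, lap F (w s ξ) ∂τ) - ∫ ξ : Sph L, fderiv ℝ (fderiv ℝ F) (w s ξ) ξ ξ ∂τ)) := by
      linear_combination (-t) * h
    rw [h', greenWeight]
    ring
  have hsw := integral_uIoc_swap_of_continuousOn (τ := τ) cG
  simp only [hFTC] at hsw
  rw [integral_sub (integrable_comp_add_smul (fun y hy => (hF y hy).continuousAt) hv ht ht1)
    (integrable_const _), integral_const] at hsw
  rw [sphMean, greenInt, ← intervalIntegral.integral_const_mul]
  simp only [probReal_univ, one_smul] at hsw
  rw [← hsw]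
  refine intervalIntegral.integral_congr fun s hs => ?_
  rw [Set.uIcc_of_le zero_le_one] at hs
  exact hmean s hs

end Green

section Estimates

variable {L : ℕ} {τ : Measure (Sph L)} {v : Euc (L + 1)} {t : ℝ}

lemma sphMean_mono [IsFiniteMeasure τ] {κ₁ κ₂ : Euc (L + 1) → ℝ}
    (h₁ : ∀ w ≠ 0, ContinuousAt κ₁ w) (h₂ : ∀ w ≠ 0, ContinuousAt κ₂ w) (hv : ‖v‖ = 1)
    {σ : ℝ} (hσ : 0 ≤ σ) (hσ1 : σ < 1)
    (hle : ∀ ξ : Sph L, κ₁ (v + σ • (ξ : Euc (L + 1))) ≤ κ₂ (v + σ • (ξ : Euc (L + 1)))) :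
    sphMean τ v κ₁ σ ≤ sphMean τ v κ₂ σ :=
  integral_mono (integrable_comp_add_smul h₁ hv hσ hσ1) (integrable_comp_add_smul h₂ hv hσ hσ1) hle

lemma integral_greenWeight_mul_mono (hL : 2 ≤ L) {h₁ h₂ : ℝ → ℝ}
    (hc₁ : ContinuousOn h₁ (Set.Icc 0 1)) (hc₂ : ContinuousOn h₂ (Set.Icc 0 1))
    (hle : ∀ s ∈ Set.Icc (0 : ℝ) 1, h₁ s ≤ h₂ s) :
    ∫ s in (0 : ℝ)..1, greenWeight L s * h₁ s ≤ ∫ s in (0 : ℝ)..1, greenWeight L s * h₂ s :=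
  intervalIntegral.integral_mono_on zero_le_one (intervalIntegrable_greenWeight_mul hc₁)
    (intervalIntegrable_greenWeight_mul hc₂)
    fun s hs => mul_le_mul_of_nonneg_left (hle s hs) (greenWeight_nonneg hL hs)

lemma greenInt_mono (hL : 2 ≤ L) [IsFiniteMeasure τ] {κ₁ κ₂ : Euc (L + 1) → ℝ}
    (h₁ : ∀ w ≠ 0, ContinuousAt κ₁ w) (h₂ : ∀ w ≠ 0, ContinuousAt κ₂ w) (hv : ‖v‖ = 1)
    (ht : 0 ≤ t) (ht1 : t < 1) (hle : ∀ w ≠ 0, κ₁ w ≤ κ₂ w) :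
    greenInt τ v t κ₁ ≤ greenInt τ v t κ₂ := by
  refine integral_greenWeight_mul_mono hL (continuousOn_sphMean h₁ hv ht ht1)
    (continuousOn_sphMean h₂ hv ht ht1) fun s hs => ?_
  obtain ⟨hσ, hσ1⟩ := mul_mem_of_mem_Icc ht ht1 hs
  exact sphMean_mono h₁ h₂ hv hσ hσ1 fun ξ => hle _ (add_smul_ne_zero hv hσ hσ1 ξ)

lemma greenInt_congr (hv : ‖v‖ = 1) (ht : 0 ≤ t) (ht1 : t < 1) {κ₁ κ₂ : Euc (L + 1) → ℝ}
    (h : ∀ w ≠ 0, κ₁ w = κ₂ w) : greenInt τ v t κ₁ = greenInt τ v t κ₂ := by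
  refine intervalIntegral.integral_congr fun s hs => ?_
  rw [Set.uIcc_of_le zero_le_one] at hs
  obtain ⟨hσ, hσ1⟩ := mul_mem_of_mem_Icc ht ht1 hs
  simp only [sphMean]
  congr 1
  exact integral_congr_ae (Filter.Eventually.of_forall fun ξ =>
    h _ (add_smul_ne_zero hv hσ hσ1 ξ))

lemma greenInt_zero : greenInt τ v t (fun _ => 0) = 0 := by
  simp [greenInt, sphMean]

lemma greenInt_nonneg (hL : 2 ≤ L) [IsFiniteMeasure τ] {κ : Euc (L + 1) → ℝ}
    (hκ : ∀ w ≠ 0, ContinuousAt κ w) (hv : ‖v‖ = 1) (ht : 0 ≤ t) (ht1 : t < 1)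
    (h0 : ∀ w ≠ 0, 0 ≤ κ w) : 0 ≤ greenInt τ v t κ := by
  have := greenInt_mono (τ := τ) hL (fun w _ => continuousAt_const) hκ hv ht ht1 h0
  rwa [greenInt_zero] at this

lemma greenInt_const_mul (c : ℝ) (κ : Euc (L + 1) → ℝ) :
    greenInt τ v t (fun w => c * κ w) = c * greenInt τ v t κ := by
  simp only [greenInt, sphMean]
  rw [← intervalIntegral.integral_const_mul]
  refine intervalIntegral.integral_congr fun s _ => ?_
  simp only [integral_const_mul]
  ring

lemma greenInt_sub [IsFiniteMeasure τ] {κ₁ κ₂ : Euc (L + 1) → ℝ}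
    (h₁ : ∀ w ≠ 0, ContinuousAt κ₁ w) (h₂ : ∀ w ≠ 0, ContinuousAt κ₂ w) (hv : ‖v‖ = 1)
    (ht : 0 ≤ t) (ht1 : t < 1) :
    greenInt τ v t (fun w => κ₁ w - κ₂ w) = greenInt τ v t κ₁ - greenInt τ v t κ₂ := by
  simp only [greenInt]
  rw [← intervalIntegral.integral_sub
    (intervalIntegrable_greenWeight_mul (continuousOn_sphMean h₁ hv ht ht1))
    (intervalIntegrable_greenWeight_mul (continuousOn_sphMean h₂ hv ht ht1))]
  refine intervalIntegral.integral_congr fun s hs => ?_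
  rw [Set.uIcc_of_le zero_le_one] at hs
  obtain ⟨hσ, hσ1⟩ := mul_mem_of_mem_Icc ht ht1 hs
  simp only [sphMean]
  rw [integral_sub (integrable_comp_add_smul h₁ hv hσ hσ1)
    (integrable_comp_add_smul h₂ hv hσ hσ1)]
  ring

lemma sphMean_le_of_lap_nonpos (hL : 2 ≤ L) [IsProbabilityMeasure τ] (hτ : IsRotInv τ)
    {F : Euc (L + 1) → ℝ} (hF : ∀ w ≠ 0, ContDiffAt ℝ 2 F w) (hv : ‖v‖ = 1) (ht : 0 ≤ t)
    (ht1 : t < 1) (hlap : ∀ w ≠ 0, lap F w ≤ 0) : sphMean τ v F t ≤ F v := by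
  have h := sphMean_sub_eq_greenInt_lap hL hτ hF hv ht ht1
  have h2 := greenInt_mono (τ := τ) hL (fun w hw => continuousAt_lap (hF w hw))
    (fun w _ => continuousAt_const (y := (0 : ℝ))) hv ht ht1 hlap
  rw [greenInt_zero] at h2
  nlinarith [sq_nonneg t]

lemma greenInt_inv_normSq_le (hL : 3 ≤ L) [IsProbabilityMeasure τ] (hτ : IsRotInv τ)
    (hv : ‖v‖ = 1) (ht : 0 ≤ t) (ht1 : t < 1) :
    greenInt τ v t (fun w => (‖w‖ ^ 2)⁻¹) ≤ 1 / (2 * (L + 1)) := by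
  have hL2 : 2 ≤ L := by omega
  have hL' : (3 : ℝ) ≤ L := by exact_mod_cast hL
  rw [← integral_greenWeight hL2]
  have h := integral_greenWeight_mul_mono hL2 (continuousOn_sphMean (τ := τ)
    (fun w hw => (contDiffAt_inv_normSq hw).continuousAt) hv ht ht1)
    (continuousOn_const (c := (1 : ℝ))) fun s hs => ?_
  · simp only [mul_one] at h
    exact h
  · obtain ⟨hσ, hσ1⟩ := mul_mem_of_mem_Icc ht ht1 hs
    have := sphMean_le_of_lap_nonpos hL2 hτ (fun w hw => contDiffAt_inv_normSq hw) hv hσ hσ1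
      fun w hw => ?_
    · simpa [hv] using this
    · rw [lap_inv_normSq hw]
      push_cast
      have : (0 : ℝ) ≤ (‖w‖ ^ 2)⁻¹ ^ 2 := by positivity
      nlinarith

lemma neg_one_mem_unitary {n : ℕ} : (-1 : Euc n →L[ℝ] Euc n) ∈ unitary (Euc n →L[ℝ] Euc n) := by
  have h : star (-1 : Euc n →L[ℝ] Euc n) = -1 := by
    rw [ContinuousLinearMap.star_eq_adjoint, map_neg, ← ContinuousLinearMap.star_eq_adjoint,
      star_one]
  have h2 : (-1 : Euc n →L[ℝ] Euc n) * -1 = 1 := by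
    ext x : 1
    simp [mul_apply_eq_comp]
  rw [Unitary.mem_iff, h]
  exact ⟨h2, h2⟩

lemma integral_eq_zero_of_odd (hτ : IsRotInv τ) {f : Euc (L + 1) → ℝ} (hf : Continuous f)
    (hodd : ∀ x, f (-x) = -f x) : ∫ ξ : Sph L, f ξ ∂τ = 0 := by
  have h := hτ _ neg_one_mem_unitary f hf.continuousOn
  simp only [_root_.neg_apply, one_apply_eq_self, hodd, integral_neg] at h
  linarith

lemma integral_inner_mul_inner [IsProbabilityMeasure τ] (hτ : IsRotInv τ) (x y : Euc (L + 1)) :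
    (L + 1) * ∫ ξ : Sph L, inner ℝ x (ξ : Euc (L + 1)) * inner ℝ y (ξ : Euc (L + 1)) ∂τ
      = inner ℝ x y := by
  set F : Euc (L + 1) → ℝ := fun w => innerSL ℝ x w * innerSL ℝ y w with hF
  have h1 : ∀ w, HasFDerivAt F (innerSL ℝ x w • innerSL ℝ y + innerSL ℝ y w • innerSL ℝ x) w :=
    fun w => (innerSL ℝ x).hasFDerivAt.mul (innerSL ℝ y).hasFDerivAt
  have h1' : fderiv ℝ F = fun w => innerSL ℝ x w • innerSL ℝ y + innerSL ℝ y w • innerSL ℝ x :=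
    funext fun w => (h1 w).fderiv
  have h2 : ∀ w, fderiv ℝ (fderiv ℝ F) w = (innerSL ℝ x).smulRight (innerSL ℝ y)
      + (innerSL ℝ y).smulRight (innerSL ℝ x) := by
    intro w
    rw [h1']
    exact (((innerSL ℝ x).hasFDerivAt.smul_const (innerSL ℝ y)).add
      ((innerSL ℝ y).hasFDerivAt.smul_const (innerSL ℝ x))).fderiv
  have hlap : ∀ w, lap F w = 2 * inner ℝ x y := by
    intro w
    simp only [lap, h2, unitVec]
    simp [PiLp.inner_apply, Finset.mul_sum]
    refine Finset.sum_congr rfl fun i _ => by ring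
  have h := integral_lap_sub_eq_zero hτ (F := F) (v := 0) (σ := 1) fun ξ => by
    have : ContDiff ℝ 2 F := (innerSL ℝ x).contDiff.mul (innerSL ℝ y).contDiff
    exact this.contDiffAt
  have hint : Integrable (fun ξ : Sph L => inner ℝ x (ξ : Euc (L + 1))
      * inner ℝ y (ξ : Euc (L + 1))) τ := integrable_sphere (by fun_prop)
  have h3 : ∀ ξ : Sph L, (1 * (lap F (0 + (1 : ℝ) • (ξ : Euc (L + 1)))
      - fderiv ℝ (fderiv ℝ F) (0 + (1 : ℝ) • (ξ : Euc (L + 1))) ξ ξ)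
      - L * fderiv ℝ F (0 + (1 : ℝ) • (ξ : Euc (L + 1))) ξ)
      = 2 * inner ℝ x y - 2 * ((L : ℝ) + 1) * (inner ℝ x (ξ : Euc (L + 1))
        * inner ℝ y (ξ : Euc (L + 1))) := by
    intro ξ
    rw [hlap, h2, h1']
    simp
    ring
  simp only [h3] at h
  have h4 : ∫ ξ : Sph L, 2 * ((L : ℝ) + 1) * (inner ℝ x (ξ : Euc (L + 1))
      * inner ℝ y (ξ : Euc (L + 1))) ∂τ = 2 * ((L : ℝ) + 1) * ∫ ξ : Sph L,
      inner ℝ x (ξ : Euc (L + 1)) * inner ℝ y (ξ : Euc (L + 1)) ∂τ := integral_const_mul _ _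
  rw [integral_sub (integrable_const _) (hint.const_mul _), h4, integral_const, probReal_univ,
    one_smul] at h
  linarith

lemma continuous_sqOn {n : ℕ} (s : Finset (Fin n)) : Continuous (sqOn s) :=
  (contDiff_sqOn s).continuous

lemma sqOn_nonneg {n : ℕ} (s : Finset (Fin n)) (w : Euc n) : 0 ≤ sqOn s w :=
  Finset.sum_nonneg fun _ _ => sq_nonneg _

lemma sqRatio_nonneg {n : ℕ} (s : Finset (Fin n)) (w : Euc n) : 0 ≤ sqRatio s w :=
  mul_nonneg (sqOn_nonneg s w) (by positivity)

lemma continuousAt_inv_normSq {n : ℕ} {w : Euc n} (hw : w ≠ 0) :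
    ContinuousAt (fun y : Euc n => (‖y‖ ^ 2)⁻¹) w := (contDiffAt_inv_normSq hw).continuousAt

lemma continuousAt_sqRatio {n : ℕ} (s : Finset (Fin n)) {w : Euc n} (hw : w ≠ 0) :
    ContinuousAt (sqRatio s) w := (contDiffAt_sqRatio s hw).continuousAt

lemma three_sub_two_mul_le_inv_sq {S : ℝ} (hS : 0 < S) : 3 - 2 * S ≤ S⁻¹ ^ 2 := by
  rw [inv_pow, ← one_div, le_div_iff₀ (by positivity)]
  nlinarith [mul_nonneg (sq_nonneg (S - 1)) (by linarith : 0 ≤ 2 * S + 1)]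

/-- The coordinate projection to the components with index in `s`. -/
def restrOn {n : ℕ} (s : Finset (Fin n)) (v : Euc n) : Euc n :=
  WithLp.toLp 2 fun i => if i ∈ s then v i else 0

lemma inner_restrOn {n : ℕ} (s : Finset (Fin n)) (v x : Euc n) :
    inner ℝ (restrOn s v) x = ∑ i ∈ s, v i * x i := by
  simp [PiLp.inner_apply, restrOn, mul_comm, Finset.sum_ite_mem]

lemma sqOn_add_smul {n : ℕ} (s : Finset (Fin n)) (v x : Euc n) (σ : ℝ) :
    sqOn s (v + σ • x) = sqOn s v + 2 * σ * inner ℝ (restrOn s v) x + σ ^ 2 * sqOn s x := by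
  simp only [sqOn, inner_restrOn, Finset.mul_sum, ← Finset.sum_add_distrib]
  refine Finset.sum_congr rfl fun i _ => ?_
  simp
  ring

lemma le_sphMean_inv_normSq_mul_sqRatio (hL : 3 ≤ L) [IsProbabilityMeasure τ] (hτ : IsRotInv τ)
    (s : Finset (Fin (L + 1))) (hv : ‖v‖ = 1) {σ : ℝ} (hσ : 0 ≤ σ) (hσ1 : σ ≤ 1 / 4) :
    sqRatio s v * (1 - 4 * σ ^ 2) ≤ sphMean τ v (fun w => (‖w‖ ^ 2)⁻¹ * sqRatio s w) σ := by
  have hL' : (3 : ℝ) ≤ L := by exact_mod_cast hL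
  have hlt : σ < 1 := by linarith
  set A := sqOn s v with hA
  have hA0 : 0 ≤ A := sqOn_nonneg s v
  have hAv : sqRatio s v = A := by simp [sqRatio, hv, hA]
  set g : Euc (L + 1) → ℝ := fun x =>
    (2 * σ * (1 - 2 * σ ^ 2)) * inner ℝ (restrOn s v) x - 4 * σ * A * inner ℝ v x
      - 4 * σ ^ 3 * (sqOn s x * inner ℝ v x) with hg
  have hgc : Continuous g := by
    have := continuous_sqOn s
    fun_prop
  have hgodd : ∀ x, g (-x) = -g x := by
    intro x
    have : sqOn s (-x) = sqOn s x := by simp [sqOn]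
    simp only [hg, inner_neg_right, this]
    ring
  have hpt : ∀ ξ : Sph L, A * (1 - 2 * σ ^ 2) - 8 * σ ^ 2 * (inner ℝ (restrOn s v)
      (ξ : Euc (L + 1)) * inner ℝ v (ξ : Euc (L + 1))) + g ξ
      ≤ (‖v + σ • (ξ : Euc (L + 1))‖ ^ 2)⁻¹ * sqRatio s (v + σ • (ξ : Euc (L + 1))) := by
    intro ξ
    have hw := add_smul_ne_zero hv hσ hlt ξ
    have hS : 0 < ‖v + σ • (ξ : Euc (L + 1))‖ ^ 2 := by positivity
    have hS' : ‖v + σ • (ξ : Euc (L + 1))‖ ^ 2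
        = 1 + 2 * σ * inner ℝ v (ξ : Euc (L + 1)) + σ ^ 2 := by
      rw [norm_add_sq_real, norm_smul, norm_eq_of_mem_sphere ξ, hv, inner_smul_right]
      simp
      ring
    have h1 := three_sub_two_mul_le_inv_sq hS
    have h2 := mul_le_mul_of_nonneg_left h1 (sqOn_nonneg s (v + σ • (ξ : Euc (L + 1))))
    have h3 : (‖v + σ • (ξ : Euc (L + 1))‖ ^ 2)⁻¹ * sqRatio s (v + σ • (ξ : Euc (L + 1)))
        = sqOn s (v + σ • (ξ : Euc (L + 1))) * (‖v + σ • (ξ : Euc (L + 1))‖ ^ 2)⁻¹ ^ 2 := by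
      rw [sqRatio]; ring
    rw [h3]
    refine le_trans ?_ h2
    rw [hS', sqOn_add_smul, ← hA]
    have h4 : 0 ≤ σ ^ 2 * (1 - 2 * σ ^ 2) * sqOn s (ξ : Euc (L + 1)) :=
      mul_nonneg (mul_nonneg (sq_nonneg _) (by nlinarith)) (sqOn_nonneg _ _)
    simp only [hg]
    linarith
  have hint1 : Integrable (fun ξ : Sph L => inner ℝ (restrOn s v) (ξ : Euc (L + 1))
      * inner ℝ v (ξ : Euc (L + 1))) τ := integrable_sphere (by fun_prop)
  have hint2 : Integrable (fun ξ : Sph L => g ξ) τ :=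
    integrable_sphere (hgc.comp continuous_subtype_val)
  have hint3 : Integrable (fun ξ : Sph L => A * (1 - 2 * σ ^ 2) - 8 * σ ^ 2 *
      (inner ℝ (restrOn s v) (ξ : Euc (L + 1)) * inner ℝ v (ξ : Euc (L + 1)))) τ :=
    (integrable_const _).sub (hint1.const_mul _)
  have hmono := integral_mono (μ := τ) (hint3.add hint2)
    (integrable_comp_add_smul (fun w hw => (continuousAt_inv_normSq hw).mul
      (continuousAt_sqRatio s hw)) hv hσ hlt) hpt
  have hmom := integral_inner_mul_inner hτ (restrOn s v) v
  have hvv : inner ℝ (restrOn s v) v = A := by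
    rw [inner_restrOn, hA, sqOn]; exact Finset.sum_congr rfl fun i _ => by ring
  rw [hvv] at hmom
  have hlhs : ∫ ξ : Sph L, (A * (1 - 2 * σ ^ 2) - 8 * σ ^ 2 * (inner ℝ (restrOn s v)
      (ξ : Euc (L + 1)) * inner ℝ v (ξ : Euc (L + 1))) + g ξ) ∂τ
      = A * (1 - 2 * σ ^ 2) - 8 * σ ^ 2 * ∫ ξ : Sph L, inner ℝ (restrOn s v)
      (ξ : Euc (L + 1)) * inner ℝ v (ξ : Euc (L + 1)) ∂τ := by
    rw [integral_add hint3 hint2, integral_sub (integrable_const _) (hint1.const_mul _),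
      integral_eq_zero_of_odd hτ hgc hgodd, integral_const, probReal_univ, one_smul, add_zero]
    congr 1
    exact integral_const_mul _ _
  have hlhs2 := hlhs.symm.le.trans hmono
  rw [hAv]
  refine le_trans ?_ hlhs2
  set m := ∫ ξ : Sph L, inner ℝ (restrOn s v) (ξ : Euc (L + 1)) * inner ℝ v (ξ : Euc (L + 1)) ∂τ
  have hm : 4 * m ≤ A := by
    have hm0 : 0 ≤ m := by
      by_contra hneg
      push Not at hneg
      nlinarith
    nlinarith
  nlinarith [sq_nonneg σ]

lemma le_greenInt_inv_normSq_mul_sqRatio (hL : 3 ≤ L) [IsProbabilityMeasure τ]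
    (hτ : IsRotInv τ) (s : Finset (Fin (L + 1))) (hv : ‖v‖ = 1) (ht : 0 ≤ t)
    (ht4 : t ≤ 1 / 4) :
    7 / 8 * (1 / (2 * (L + 1))) * sqRatio s v
      ≤ greenInt τ v t (fun w => (‖w‖ ^ 2)⁻¹ * sqRatio s w) := by
  have hL2 : 2 ≤ L := by omega
  have hL' : (3 : ℝ) ≤ L := by exact_mod_cast hL
  have h := integral_greenWeight_mul_mono hL2 (h₁ := fun x => sqRatio s v * (1 - 4 * (t * x) ^ 2))
    (Continuous.continuousOn (by fun_prop))
    (continuousOn_sphMean (τ := τ) (fun w hw => (continuousAt_inv_normSq hw).mul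
      (continuousAt_sqRatio s hw)) hv ht (by linarith)) fun x hx =>
      le_sphMean_inv_normSq_mul_sqRatio hL hτ s hv (mul_nonneg ht hx.1)
        (by nlinarith [hx.1, hx.2])
  refine le_trans ?_ h
  have e : ∀ x : ℝ, greenWeight L x * (sqRatio s v * (1 - 4 * (t * x) ^ 2))
      = sqRatio s v * greenWeight L x - sqRatio s v * (4 * t ^ 2) * (greenWeight L x * x ^ 2) := by
    intro x; ring
  have c1 : Continuous (greenWeight L) := continuous_greenWeight
  simp only [e]
  rw [intervalIntegral.integral_sub (Continuous.intervalIntegrable (by fun_prop) _ _)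
    (Continuous.intervalIntegrable (by fun_prop) _ _), intervalIntegral.integral_const_mul,
    intervalIntegral.integral_const_mul, integral_greenWeight hL2, integral_greenWeight_mul_sq hL2]
  have h1 : 4 * t ^ 2 * (1 / (4 * ((L : ℝ) + 3))) ≤ 1 / 8 * (1 / (2 * (L + 1))) := by
    have ht2 : t ^ 2 ≤ 1 / 16 := by nlinarith
    have : 4 * t ^ 2 * (1 / (4 * ((L : ℝ) + 3))) = t ^ 2 / (L + 3) := by field_simp
    rw [this]
    have : 1 / 8 * (1 / (2 * ((L : ℝ) + 1))) = (1 / 16) / (L + 1) := by field_simp; norm_num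
    rw [this]
    gcongr
    norm_num
  have := mul_le_mul_of_nonneg_left h1 (sqRatio_nonneg s v)
  linarith

end Estimates

section ProductBound

variable {L : ℕ} {τ : Measure (Sph L)} {v : Euc (L + 1)} {t : ℝ}

lemma mul_greenWeight_div_le (hL : 2 ≤ L) {c x : ℝ} (hc : 0 < c) (hc1 : c ≤ 1) (hx : 0 ≤ x) :
    c * greenWeight L (x / c) ≤ greenWeight L x := by
  have hL' : (2 : ℝ) ≤ L := by exact_mod_cast hL
  have h1 : x ≤ x / c := le_div_self hx hc hc1
  have h2 : x ^ (L - 1) ≤ (x / c) ^ (L - 1) := pow_le_pow_left₀ hx h1 _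
  have h3 : c * greenWeight L (x / c) = x * (1 - (x / c) ^ (L - 1)) / (L - 1) := by
    rw [greenWeight, ← mul_div_assoc, ← mul_assoc, mul_div_cancel₀ _ hc.ne']
  rw [h3, greenWeight]
  exact div_le_div_of_nonneg_right (mul_le_mul_of_nonneg_left (by linarith) hx) (by linarith)

lemma sq_mul_integral_greenWeight_comp_le (hL : 2 ≤ L) {h : ℝ → ℝ}
    (hh : ContinuousOn h (Set.Icc 0 1)) (h0 : ∀ s ∈ Set.Icc (0 : ℝ) 1, 0 ≤ h s) {c : ℝ}
    (hc : 0 ≤ c) (hc1 : c ≤ 1) :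
    c ^ 2 * ∫ s in (0 : ℝ)..1, greenWeight L s * h (c * s)
      ≤ ∫ s in (0 : ℝ)..1, greenWeight L s * h s := by
  have hnn : ∀ s ∈ Set.Icc (0 : ℝ) 1, 0 ≤ greenWeight L s * h s := fun s hs =>
    mul_nonneg (greenWeight_nonneg hL hs) (h0 s hs)
  rcases hc.eq_or_lt with rfl | hc
  · simpa using intervalIntegral.integral_nonneg zero_le_one hnn
  have hsub : Set.Icc 0 c ⊆ Set.Icc (0 : ℝ) 1 := Set.Icc_subset_Icc_right hc1
  have e := intervalIntegral.smul_integral_comp_mul_left (a := 0) (b := 1)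
    (fun x => c * greenWeight L (x / c) * h x) c
  simp only [mul_div_cancel_left₀ _ hc.ne', smul_eq_mul, mul_zero, mul_one, mul_assoc,
    intervalIntegral.integral_const_mul] at e
  have e2 : c ^ 2 * ∫ s in (0 : ℝ)..1, greenWeight L s * h (c * s)
      = ∫ x in (0 : ℝ)..c, c * greenWeight L (x / c) * h x := by
    simp only [mul_assoc, intervalIntegral.integral_const_mul]
    rw [← e]; ring
  have hcw : ContinuousOn (fun x => greenWeight L x * h x) (Set.Icc 0 1) :=
    continuous_greenWeight.continuousOn.mul hh
  have hcw2 : ContinuousOn (fun x => c * greenWeight L (x / c) * h x) (Set.Icc 0 c) := by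
    have : Continuous fun x => c * greenWeight L (x / c) := by
      have := continuous_greenWeight (L := L)
      fun_prop
    exact this.continuousOn.mul (hh.mono hsub)
  rw [e2]
  refine (intervalIntegral.integral_mono_on hc.le
    (ContinuousOn.intervalIntegrable (by rwa [Set.uIcc_of_le hc.le]))
    (g := fun x => greenWeight L x * h x)
    (ContinuousOn.intervalIntegrable (by rw [Set.uIcc_of_le hc.le]; exact hcw.mono hsub))
    fun x hx => mul_le_mul_of_nonneg_right (mul_greenWeight_div_le hL hc hc1 hx.1)
      (h0 x (hsub hx))).trans ?_
  refine intervalIntegral.integral_mono_interval le_rfl hc.le hc1 ?_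
    (ContinuousOn.intervalIntegrable (by rwa [Set.uIcc_of_le zero_le_one]))
  rw [Filter.EventuallyLE, ae_restrict_iff' measurableSet_Ioc]
  exact Filter.Eventually.of_forall fun x hx => hnn x (Set.Ioc_subset_Icc_self hx)

lemma continuousAt_sqRatio_mul {n : ℕ} (s₁ s₂ : Finset (Fin n)) {w : Euc n} (hw : w ≠ 0) :
    ContinuousAt (fun y => sqRatio s₁ y * sqRatio s₂ y) w :=
  (continuousAt_sqRatio s₁ hw).mul (continuousAt_sqRatio s₂ hw)

lemma greenInt_inv_normSq_mul_sqRatio_mul_le (hL : 3 ≤ L) [IsProbabilityMeasure τ]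
    (hτ : IsRotInv τ) {s₁ s₂ : Finset (Fin (L + 1))} (hs : Disjoint s₁ s₂) (hv : ‖v‖ = 1)
    (ht : 0 ≤ t) (ht4 : t ≤ 1 / 4) :
    greenInt τ v t (fun w => (‖w‖ ^ 2)⁻¹ * (sqRatio s₁ w * sqRatio s₂ w))
      ≤ 4 / (3 * (L + 1)) * sphMean τ v (fun w => sqRatio s₁ w * sqRatio s₂ w) t := by
  have hL2 : 2 ≤ L := by omega
  have hL' : (3 : ℝ) ≤ L := by exact_mod_cast hL
  have ht1 : t < 1 := by linarith
  set F : Euc (L + 1) → ℝ := fun w => sqRatio s₁ w * sqRatio s₂ w with hF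
  set H : Euc (L + 1) → ℝ := fun w => (‖w‖ ^ 2)⁻¹ * F w with hH
  set E : Euc (L + 1) → ℝ := fun w => (‖w‖ ^ 2)⁻¹ *
    (2 * s₂.card * sqRatio s₁ w + 2 * s₁.card * sqRatio s₂ w) with hE
  have hFc : ∀ w ≠ 0, ContinuousAt F w := fun w hw => continuousAt_sqRatio_mul s₁ s₂ hw
  have hHc : ∀ w ≠ 0, ContinuousAt H w := fun w hw => (continuousAt_inv_normSq hw).mul (hFc w hw)
  have hEc : ∀ w ≠ 0, ContinuousAt E w := fun w hw => (continuousAt_inv_normSq hw).mul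
    ((continuousAt_const.mul (continuousAt_sqRatio s₁ hw)).add
      (continuousAt_const.mul (continuousAt_sqRatio s₂ hw)))
  have hF0 : ∀ w, 0 ≤ F w := fun w => mul_nonneg (sqRatio_nonneg _ _) (sqRatio_nonneg _ _)
  have hE0 : ∀ w, 0 ≤ E w := fun w => mul_nonneg (by positivity)
    (add_nonneg (mul_nonneg (by positivity) (sqRatio_nonneg _ _))
      (mul_nonneg (by positivity) (sqRatio_nonneg _ _)))
  have hH0 : ∀ w, 0 ≤ H w := fun w => mul_nonneg (by positivity) (hF0 w)
  set N : ℝ := 4 * L + 12 with hN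
  have hlap : ∀ w ≠ 0, lap F w = E w - N * H w := fun w hw => by
    rw [hF, lap_sqRatio_mul s₁ s₂ hs hw]
    simp only [hE, hH, hF, hN]
    push_cast
    ring
  have hgreen : ∀ σ, 0 ≤ σ → σ < 1 → sphMean τ v F σ - F v
      = σ ^ 2 * (greenInt τ v σ E - N * greenInt τ v σ H) := fun σ hσ hσ1 => by
    rw [sphMean_sub_eq_greenInt_lap hL2 hτ (fun w hw => (contDiffAt_sqRatio s₁ hw).mul
      (contDiffAt_sqRatio s₂ hw)) hv hσ hσ1, greenInt_congr hv hσ hσ1 hlap,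
      greenInt_sub (κ₂ := fun w => N * H w) hEc (fun w hw => continuousAt_const.mul (hHc w hw)) hv
        hσ hσ1,
      greenInt_const_mul]
  have hK0 := greenInt_nonneg (τ := τ) hL2 hHc hv ht ht1 fun w _ => hH0 w
  set K := greenInt τ v t H
  have hstep : ∀ c ∈ Set.Icc (0 : ℝ) 1,
      sphMean τ v F (t * c) ≤ sphMean τ v F t + t ^ 2 * N * K := by
    intro c hc
    obtain ⟨hσ, hσ1⟩ := mul_mem_of_mem_Icc ht ht1 hc
    have g1 := hgreen _ hσ hσ1
    have g2 := hgreen _ ht ht1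
    have hHσ := greenInt_nonneg (τ := τ) hL2 hHc hv hσ hσ1 fun w _ => hH0 w
    have hmon := sq_mul_integral_greenWeight_comp_le hL2 (h := fun s => sphMean τ v E (t * s))
      (continuousOn_sphMean hEc hv ht ht1) (fun s _ => integral_nonneg fun ξ => hE0 _) hc.1 hc.2
    simp only [← mul_assoc] at hmon
    change c ^ 2 * greenInt τ v (t * c) E ≤ greenInt τ v t E at hmon
    have h1 := mul_le_mul_of_nonneg_left hmon (sq_nonneg t)
    have h2 : 0 ≤ (t * c) ^ 2 * (N * greenInt τ v (t * c) H) := by positivity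
    nlinarith
  have hinv : ∀ σ, 0 ≤ σ → σ ≤ 1 / 4 → sphMean τ v H σ ≤ 16 / 9 * sphMean τ v F σ := by
    intro σ hσ hσ4
    have : 16 / 9 * sphMean τ v F σ = sphMean τ v (fun w => 16 / 9 * F w) σ :=
      (integral_const_mul _ _).symm
    rw [this]
    refine sphMean_mono hHc (fun w hw => continuousAt_const.mul (hFc w hw)) hv hσ (by linarith)
      fun ξ => mul_le_mul_of_nonneg_right ?_ (hF0 _)
    have h34 : 3 / 4 ≤ ‖v + σ • (ξ : Euc (L + 1))‖ := by
      linarith [le_norm_add_smul hv hσ ξ]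
    rw [inv_le_comm₀ (by positivity) (by norm_num)]
    nlinarith
  have hKle : K ≤ 16 / 9 * (sphMean τ v F t + t ^ 2 * N * K) * (1 / (2 * (L + 1))) := by
    rw [← integral_greenWeight hL2, ← intervalIntegral.integral_const_mul]
    have := integral_greenWeight_mul_mono hL2 (h₁ := fun s => sphMean τ v H (t * s))
      (h₂ := fun _ => 16 / 9 * (sphMean τ v F t + t ^ 2 * N * K))
      (continuousOn_sphMean hHc hv ht ht1) continuousOn_const fun s hs => by
        obtain ⟨hσ, hσ1⟩ := mul_mem_of_mem_Icc ht ht1 hs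
        exact (hinv _ hσ (by nlinarith [hs.1, hs.2])).trans
          (mul_le_mul_of_nonneg_left (hstep s hs) (by norm_num))
    refine this.trans_eq (intervalIntegral.integral_congr fun s _ => ?_)
    ring
  have ht2 : t ^ 2 ≤ 1 / 16 := by nlinarith
  have hm0 : 0 ≤ sphMean τ v F t := integral_nonneg fun ξ => hF0 _
  have h1 : t ^ 2 * N * K ≤ 1 / 16 * N * K := by gcongr
  rw [mul_one_div, le_div_iff₀ (by positivity)] at hKle
  rw [div_mul_eq_mul_div, le_div_iff₀ (by positivity)]
  have hLK := mul_le_mul_of_nonneg_right hL' hK0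
  simp only [hN] at h1 hKle
  nlinarith

end ProductBound

section Numerics

lemma antitoneOn_add_half_mul_log : AntitoneOn
    (fun x : ℝ => (x + 1 / 2) * (Real.log (x + 1) - Real.log x)) (Set.Ioi 0) := by
  intro x hx y hy hxy
  rw [Set.mem_Ioi] at hx hy
  have hs : ∀ a : ℝ, 0 < a → HasSum
      (fun k : ℕ => (1 / (2 * (k : ℝ) + 1)) * (1 / (2 * a + 1)) ^ (2 * k))
      ((a + 1 / 2) * (Real.log (a + 1) - Real.log a)) := by
    intro a ha
    have h := (Real.hasSum_log_one_add_inv ha).mul_left (a + 1 / 2)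
    have e : 1 + a⁻¹ = (a + 1) / a := by field_simp
    rw [e, Real.log_div (by positivity) ha.ne'] at h
    refine h.congr_fun ?_
    intro k
    rw [pow_succ]
    field_simp
  refine hasSum_le (fun k => ?_) (hs y hy) (hs x hx)
  gcongr

/-- The product `∏ j < k, (q + j) / (q + p + j)`. -/
def ratioProd (p q : ℝ) (k : ℕ) : ℝ := ∏ j ∈ Finset.range k, (q + j) / (q + p + j)

variable {p q : ℝ}

lemma ratioProd_pos (hp : 0 < p) (hq : 0 < q) (k : ℕ) : 0 < ratioProd p q k :=
  Finset.prod_pos fun _ _ => by positivity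

lemma log_ratioProd_le (hp : 0 < p) (hq : 0 < q) (k : ℕ) :
    Real.log (ratioProd p q k) ≤
      ((q + k - 1 / 2) * Real.log (q + k) - (q + p + k - 1 / 2) * Real.log (q + p + k))
      - ((q - 1 / 2) * Real.log q - (q + p - 1 / 2) * Real.log (q + p)) := by
  induction k with
  | zero => simp [ratioProd]
  | succ k ih =>
    have h : ratioProd p q (k + 1) = ratioProd p q k * ((q + k) / (q + p + k)) :=
      Finset.prod_range_succ _ _
    have hx : 0 < q + k := by positivity
    have hy : 0 < q + p + k := by positivity
    rw [h, Real.log_mul (ratioProd_pos hp hq k).ne' (by positivity), Real.log_div hx.ne' hy.ne']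
    have h2 := antitoneOn_add_half_mul_log (Set.mem_Ioi.2 hx) (Set.mem_Ioi.2 hy) (by linarith)
    push_cast
    simp only [← add_assoc] at h2 ⊢
    linarith

lemma ratioProd_succ_le (hp : 0 < p) (hq : 1 ≤ q) (j : ℕ) :
    ratioProd p q (j + 1) ≤ ((q + p) / q) ^ (q - 1) * ((q + p) / (q + p + (j + 1))) ^ p *
      (((q + (j + 1)) / (q + p + (j + 1))) ^ j * (1 + j * (p / (q + p + (j + 1))))) := by
  have hq0 : 0 < q := by linarith
  set k : ℝ := (j : ℝ) + 1 with hk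
  have hk0 : 0 < k := by positivity
  have h1 : 0 < q + k := by positivity
  have h2 : 0 < q + p + k := by positivity
  have h3 : 0 < q + p := by positivity
  have hlog := log_ratioProd_le hp hq0 (j + 1)
  push_cast at hlog
  rw [← hk] at hlog
  have hD : 1 + j * (p / (q + p + k)) = (q + k) / (q + p + k) * (1 + k * p / (q + k)) := by
    have : (j : ℝ) = k - 1 := by rw [hk]; ring
    rw [this]
    field_simp
    ring
  have hD0 : 0 < 1 + k * p / (q + k) := by positivity
  rw [hD, ← Real.log_le_log_iff (ratioProd_pos hp hq0 _) (by positivity),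
    Real.log_mul (by positivity) (by positivity), Real.log_mul (by positivity) (by positivity),
    Real.log_mul (by positivity) (by positivity), Real.log_mul (by positivity) (by positivity),
    Real.log_rpow (by positivity), Real.log_rpow (by positivity), Real.log_pow,
    Real.log_div h3.ne' hq0.ne', Real.log_div h3.ne' h2.ne', Real.log_div h1.ne' h2.ne']
  refine hlog.trans ?_
  have hu : Real.log (q + k) ≤ Real.log (q + p + k) := Real.log_le_log h1 (by linarith)
  have hA : (q + p) * (q + k) / (q * (q + p + k)) ≤ 1 + k * p / (q + k) := by
    have : (q + p) * (q + k) / (q * (q + p + k)) = 1 + k * p / (q * (q + p + k)) := by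
      field_simp; ring
    rw [this]
    gcongr
    nlinarith
  have hA2 := Real.log_le_log (by positivity) hA
  rw [Real.log_div (by positivity) (by positivity), Real.log_mul (by positivity) (by positivity),
    Real.log_mul (by positivity) (by positivity)] at hA2
  have hD1 : 0 ≤ Real.log (1 + k * p / (q + k)) := Real.log_nonneg (by
    have : 0 ≤ k * p / (q + k) := by positivity
    linarith)
  have hj : (j : ℝ) = k - 1 := by rw [hk]; ring
  rw [hj]
  nlinarith

lemma inv_one_add_inv_two_mul_rpow_le (hp : 0 < p) (hp2 : 1 ≤ 2 * p) :
    (1 + 1 / (2 * p))⁻¹ ^ p ≤ 0.8 := by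
  have h := one_add_mul_self_le_rpow_one_add (s := 1 / (2 * p)) (by
    have : 0 ≤ 1 / (2 * p) := by positivity
    linarith) hp2
  rw [mul_one_div_cancel (by positivity)] at h
  rw [two_mul p, Real.rpow_add (by positivity), ← two_mul p] at h
  have h0 : 0 < (1 + 1 / (2 * p)) ^ p := by positivity
  rw [Real.inv_rpow (by positivity), inv_le_comm₀ h0 (by norm_num)]
  nlinarith

lemma div_one_add_mul_le (hp : 0 < p) :
    p / (1 + p) * (1 + 1 / (2 * p) + 1 / (p + 3 / 2)) ≤ 17 / 16 := by
  have e : p / (1 + p) * (1 + 1 / (2 * p) + 1 / (p + 3 / 2))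
      = ((p + 1 / 2) * (p + 3 / 2) + p) / ((1 + p) * (p + 3 / 2)) := by
    field_simp
  rw [e, div_le_iff₀ (by positivity)]
  nlinarith [sq_nonneg (p - 11 / 4)]

lemma le_of_forall_nat_bound {p q X e : ℝ} (hp : 1 ≤ 2 * p) (hq : 3 / 2 ≤ q) (hX : 0 < X)
    (he : e ≤ 1)
    (h : ∀ (j : ℕ) (c : ℝ), 0 ≤ c → c < 1 → e ≤ 8 / 7 *
      (((j : ℝ) + 1) / (1 + j * c) * (8 / 9 * X * (p / (q + p)))
        + ratioProd p q (j + 1) / ((1 - c) ^ j * (1 + j * c)))) :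
    e ≤ 2 * ((q + p) / q) ^ ((q - 1) / (p + 1)) * X ^ (p / (p + 1)) := by
  have hp0 : 0 < p := by linarith
  have hq0 : 0 < q := by linarith
  set B := ((q + p) / q) ^ (q - 1) with hB
  have hB1 : 1 ≤ B := Real.one_le_rpow (by rw [le_div_iff₀ hq0]; linarith) (by linarith)
  have hB0 : 0 < B := by linarith
  set ε := (X / B) ^ (1 / (p + 1)) with hε
  have hε0 : 0 < ε := by positivity
  have hXε : X = B * ε ^ p * ε := by
    have : ε ^ (p + 1) = X / B := by
      rw [hε, ← Real.rpow_mul (by positivity), one_div_mul_cancel (by positivity), Real.rpow_one]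
    rw [mul_assoc, ← Real.rpow_add_one hε0.ne', this]
    field_simp
  have hRHS : ((q + p) / q) ^ ((q - 1) / (p + 1)) * X ^ (p / (p + 1)) = B * ε ^ p := by
    have h1 : ((q + p) / q) ^ ((q - 1) / (p + 1)) = B ^ (1 / (p + 1)) := by
      rw [hB, ← Real.rpow_mul (by positivity)]; congr 1; ring
    have h2 : B = B ^ (1 / (p + 1)) * B ^ (p / (p + 1)) := by
      rw [← Real.rpow_add hB0]
      have : 1 / (p + 1) + p / (p + 1) = 1 := by field_simp; ring
      rw [this, Real.rpow_one]
    have h3 : ε ^ p = X ^ (p / (p + 1)) / B ^ (p / (p + 1)) := by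
      rw [hε, ← Real.rpow_mul (by positivity), Real.div_rpow hX.le hB0.le]
      congr 2 <;> ring
    rw [h1, h3]
    nth_rewrite 2 [h2]
    have : 0 < B ^ (p / (p + 1)) := by positivity
    field_simp
  rw [mul_assoc, hRHS]
  rcases le_or_gt 1 ε with h1 | h1
  · have : 1 ≤ ε ^ p := Real.one_le_rpow h1 hp0.le
    nlinarith
  set ρ := (1 + 1 / (2 * p))⁻¹ with hρ
  have hρ0 : 0 < ρ := by positivity
  have hρ1 : ρ < 1 := inv_lt_one_of_one_lt₀ (by
    have : 0 < 1 / (2 * p) := by positivity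
    linarith)
  have hρε : ρ * ε < 1 := by nlinarith
  set x := (q + p) * ((ρ * ε)⁻¹ - 1) with hx
  have hx0 : 0 < x := mul_pos (by positivity) (by
    have := (one_lt_inv₀ (by positivity)).2 hρε
    linarith)
  obtain ⟨j, hj⟩ : ∃ j, ⌈x⌉₊ = j + 1 := Nat.exists_eq_succ_of_ne_zero (Nat.ceil_pos.2 hx0).ne'
  have hk1 : x ≤ (j : ℝ) + 1 := by
    have := Nat.le_ceil x
    rw [hj] at this
    exact_mod_cast this
  have hk2 : (j : ℝ) + 1 < x + 1 := by
    have := Nat.ceil_lt_add_one hx0.le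
    rw [hj] at this
    exact_mod_cast this
  set k : ℝ := (j : ℝ) + 1 with hk
  have hk0 : 0 < k := by positivity
  have hden : 0 < q + p + k := by positivity
  have hb := h j (p / (q + p + k)) (by positivity) (by rw [div_lt_one hden]; linarith)
  have hN := ratioProd_succ_le hp0 (by linarith) j (q := q)
  rw [← hk] at hN
  have h1c : 1 - p / (q + p + k) = (q + k) / (q + p + k) := by field_simp; ring
  rw [h1c] at hb
  have hδ : (q + p) / (q + p + k) ≤ ρ * ε := by
    rw [div_le_iff₀ hden]
    have h2 : ρ * ε * x = (q + p) * (1 - ρ * ε) := by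
      rw [hx]; field_simp
    nlinarith [mul_le_mul_of_nonneg_left hk1 (by positivity : 0 ≤ ρ * ε)]
  have hδp : ((q + p) / (q + p + k)) ^ p ≤ 0.8 * ε ^ p := by
    refine (Real.rpow_le_rpow (by positivity) hδ hp0.le).trans ?_
    rw [Real.mul_rpow hρ0.le hε0.le]
    exact mul_le_mul_of_nonneg_right (inv_one_add_inv_two_mul_rpow_le hp0 hp) (by positivity)
  have hF2 : ratioProd p q (j + 1) / (((q + k) / (q + p + k)) ^ j * (1 + j * (p / (q + p + k))))
      ≤ 0.8 * (B * ε ^ p) := by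
    rw [div_le_iff₀ (by positivity)]
    refine hN.trans (mul_le_mul_of_nonneg_right ?_ (by positivity))
    nlinarith
  have hF1 : k / (1 + j * (p / (q + p + k))) * (8 / 9 * X * (p / (q + p)))
      ≤ 8 / 9 * (17 / 16) * (B * ε ^ p) := by
    have hDk : k / (1 + j * (p / (q + p + k))) ≤ (q + p + k) / (1 + p) := by
      have : (j : ℝ) = k - 1 := by rw [hk]; ring
      rw [div_le_div_iff₀ (by positivity) (by positivity), this]
      have : (q + p + k) * (1 + (k - 1) * (p / (q + p + k))) = q + k + k * p := by
        field_simp; ring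
      rw [this]
      nlinarith
    have hsum : q + p + k ≤ (q + p) * (ρ * ε)⁻¹ + 1 := by
      have : (q + p) * (ρ * ε)⁻¹ = x + (q + p) := by rw [hx]; ring
      linarith
    have hcoef : (q + p + k) / (1 + p) * (ε * (p / (q + p))) ≤ 17 / 16 := by
      have e1 : (q + p + k) / (1 + p) * (ε * (p / (q + p)))
          = p / (1 + p) * (ε * (q + p + k) / (q + p)) := by ring
      have e2 : ε * (q + p + k) ≤ (q + p) * ρ⁻¹ + 1 := by
        have := mul_le_mul_of_nonneg_left hsum hε0.le
        have e3 : ε * ((q + p) * (ρ * ε)⁻¹ + 1) = (q + p) * ρ⁻¹ + ε := by field_simp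
        linarith
      have e4 : ε * (q + p + k) / (q + p) ≤ ρ⁻¹ + 1 / (p + 3 / 2) := by
        rw [div_le_iff₀ (by positivity)]
        refine e2.trans ?_
        have : 1 ≤ 1 / (p + 3 / 2) * (q + p) := by
          rw [one_div_mul_eq_div, le_div_iff₀ (by positivity)]; linarith
        linarith
      rw [e1]
      refine (mul_le_mul_of_nonneg_left e4 (by positivity)).trans ?_
      rw [hρ, inv_inv]
      exact div_one_add_mul_le hp0
    have hYp : 0 < B * ε ^ p := by positivity
    calc _ ≤ (q + p + k) / (1 + p) * (8 / 9 * X * (p / (q + p))) :=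
          mul_le_mul_of_nonneg_right hDk (by positivity)
      _ = 8 / 9 * ((q + p + k) / (1 + p) * (ε * (p / (q + p)))) * (B * ε ^ p) := by
          rw [hXε]; ring
      _ ≤ _ := by gcongr
  have hYp : 0 < B * ε ^ p := by positivity
  linarith

lemma one_le_tangent {u c : ℝ} (hu : 0 ≤ u) (j : ℕ) (hc0 : 0 ≤ c) (hc : c < 1) :
    1 ≤ ((j : ℝ) + 1) * (1 - u) / (1 + j * c) + u ^ (j + 1) / ((1 - c) ^ j * (1 + j * c)) := by
  have h1 : 0 < 1 - c := by linarith
  have hD : 0 < 1 + j * c := by positivity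
  have hB := one_add_mul_le_pow (a := u / (1 - c) - 1) (by
    have : 0 ≤ u / (1 - c) := by positivity
    linarith) (j + 1)
  rw [add_sub_cancel, div_pow] at hB
  push_cast at hB
  have hB2 := mul_le_mul_of_nonneg_right hB h1.le
  have e1 : (1 + ((j : ℝ) + 1) * (u / (1 - c) - 1)) * (1 - c)
      = ((j : ℝ) + 1) * u - j * (1 - c) := by field_simp; ring
  have e2 : u ^ (j + 1) / (1 - c) ^ (j + 1) * (1 - c) = u ^ (j + 1) / (1 - c) ^ j := by
    rw [pow_succ (1 - c)]; field_simp
  rw [e1, e2] at hB2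
  rw [← div_div, ← add_div, le_div_iff₀ hD]
  linarith

end Numerics

section Orbit

variable {L : ℕ} {Ω : Type*} [MeasurableSpace Ω] {P : Measure Ω}
  {U : Ω → Matrix (Fin (L + 1)) (Fin (L + 1)) ℝ}

lemma measurable_toEuclideanLin_apply {n : ℕ} {α : Type*} [MeasurableSpace α]
    {f : α → Matrix (Fin n) (Fin n) ℝ} {g : α → Euc n} (hf : Measurable f) (hg : Measurable g) :
    Measurable fun a => Matrix.toEuclideanLin (f a) (g a) := by
  have h : ∀ a, Matrix.toEuclideanLin (f a) (g a)
      = WithLp.toLp 2 fun i => ∑ j, f a i j * g a j := fun a => rfl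
  simp only [h]
  refine (WithLp.measurable_toLp 2 _).comp (measurable_pi_lambda _ fun i =>
    Finset.measurable_sum _ fun j _ => Measurable.mul ?_ ?_)
  · exact (measurable_pi_apply j).comp ((measurable_pi_apply i).comp hf)
  · exact (EuclideanSpace.proj (𝕜 := ℝ) j : Euc n →L[ℝ] ℝ).measurable.comp hg

lemma coe_actS {T : Matrix (Fin (L + 1)) (Fin (L + 1)) ℝ} {v : Sph L}
    (h : Matrix.toEuclideanLin T (v : Euc (L + 1)) ≠ 0) :
    (actS T v : Euc (L + 1))
      = ‖Matrix.toEuclideanLin T (v : Euc (L + 1))‖⁻¹ •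
        Matrix.toEuclideanLin T (v : Euc (L + 1)) := by
  rw [actS, dif_neg (norm_ne_zero_iff.2 h)]
  rfl

lemma measurable_actS {α : Type*} [MeasurableSpace α]
    {f : α → Matrix (Fin (L + 1)) (Fin (L + 1)) ℝ} {g : α → Sph L} (hf : Measurable f)
    (hg : Measurable g) : Measurable fun a => actS (f a) (g a) := by
  have h2 : Measurable fun a => (g a : Euc (L + 1)) := measurable_subtype_coe.comp hg
  have h1 := measurable_toEuclideanLin_apply hf h2
  have e : (fun a => (actS (f a) (g a) : Euc (L + 1))) = fun a =>
      if Matrix.toEuclideanLin (f a) (g a : Euc (L + 1)) = 0 then (g a : Euc (L + 1)) else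
        ‖Matrix.toEuclideanLin (f a) (g a : Euc (L + 1))‖⁻¹ •
          Matrix.toEuclideanLin (f a) (g a : Euc (L + 1)) := by
    funext a
    split_ifs with h
    · rw [actS, dif_pos (by rw [h, norm_zero])]
    · exact coe_actS h
  have h3 : Measurable fun a => (actS (f a) (g a) : Euc (L + 1)) := by
    rw [e]
    exact Measurable.ite (h1 (measurableSet_singleton 0)) h2 (h1.norm.inv.smul h1)
  have hs : MeasurableSet (Metric.sphere (0 : Euc (L + 1)) 1) :=
    Metric.isClosed_sphere.measurableSet
  refine (MeasurableEmbedding.subtype_coe hs).measurable_comp_iff.1 ?_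
  rw [Function.comp_def]
  exact h3

lemma norm_toEuclideanLin_orthogonal {n : ℕ} {O : Matrix (Fin n) (Fin n) ℝ}
    (hO : O ∈ Matrix.orthogonalGroup (Fin n) ℝ) (x : Euc n) :
    ‖Matrix.toEuclideanLin O x‖ = ‖x‖ := by
  have h : Matrix.toEuclideanCLM (𝕜 := ℝ) O ∈ unitary (Euc n →L[ℝ] Euc n) :=
    Unitary.map_mem _ hO
  exact norm_unitary_apply h x

lemma coe_actS_orthogonal {O : Matrix (Fin (L + 1)) (Fin (L + 1)) ℝ}
    (hO : O ∈ Matrix.orthogonalGroup (Fin (L + 1)) ℝ) (v : Sph L) :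
    (actS O v : Euc (L + 1)) = Matrix.toEuclideanLin O (v : Euc (L + 1)) := by
  have h : ‖Matrix.toEuclideanLin O (v : Euc (L + 1))‖ = 1 := by
    rw [norm_toEuclideanLin_orthogonal hO, norm_eq_of_mem_sphere]
  rw [coe_actS (norm_ne_zero_iff.1 (by rw [h]; exact one_ne_zero)), h, inv_one, one_smul]

/-- The law of the random orthogonal image of a point of the sphere. -/
def orbitLaw (P : Measure Ω) (U : Ω → Matrix (Fin (L + 1)) (Fin (L + 1)) ℝ) (v : Sph L) :
    Measure (Sph L) := P.map fun ω => actS (U ω) v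

lemma isProbabilityMeasure_orbitLaw [IsProbabilityMeasure P] (hU : Measurable U) (v : Sph L) :
    IsProbabilityMeasure (orbitLaw P U v) :=
  Measure.isProbabilityMeasure_map (measurable_actS hU measurable_const).aemeasurable

lemma isRotInv_orbitLaw (hU : IsHaarOrth P U) (v : Sph L) : IsRotInv (orbitLaw P U v) := by
  intro O hO f hf
  obtain ⟨M, rfl⟩ := EquivLike.surjective (Matrix.toEuclideanCLM (𝕜 := ℝ) (n := Fin (L + 1))) O
  have hM : M ∈ Matrix.orthogonalGroup (Fin (L + 1)) ℝ := by
    rw [Unitary.mem_iff, ← map_star, ← map_mul, ← map_mul] at hO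
    rw [Matrix.orthogonalGroup, Matrix.unitaryGroup, Unitary.mem_iff]
    refine ⟨EquivLike.injective (Matrix.toEuclideanCLM (𝕜 := ℝ) (n := Fin (L + 1))) ?_,
      EquivLike.injective (Matrix.toEuclideanCLM (𝕜 := ℝ) (n := Fin (L + 1))) ?_⟩
    · rw [hO.1, map_one]
    · rw [hO.2, map_one]
  have hfc : Continuous fun ξ : Sph L => f ξ := continuousOn_iff_continuous_domRestrict.1 hf
  have hMc : Continuous fun ξ : Sph L =>
      f (Matrix.toEuclideanCLM (𝕜 := ℝ) M (ξ : Euc (L + 1))) :=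
    hf.comp_continuous (by fun_prop) fun ξ => by
      rw [mem_sphere_zero_iff_norm, norm_unitary_apply hO, norm_eq_of_mem_sphere]
  have hg : Measurable fun T : Matrix (Fin (L + 1)) (Fin (L + 1)) ℝ =>
      f (actS T v : Euc (L + 1)) := by
    have h := hfc.measurable.comp (measurable_actS measurable_id (measurable_const (a := v)))
    rw [Function.comp_def] at h
    exact h
  have hm := measurable_actS hU.1 (measurable_const (a := v))
  rw [orbitLaw, integral_map hm.aemeasurable hMc.aestronglyMeasurable,
    integral_map hm.aemeasurable hfc.aestronglyMeasurable]
  have hMU : Measurable fun ω => M * U ω := by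
    refine measurable_pi_lambda _ fun i => measurable_pi_lambda _ fun j => ?_
    simp only [Matrix.mul_apply]
    exact Finset.measurable_sum _ fun k _ => Measurable.const_mul
      ((measurable_pi_apply j).comp ((measurable_pi_apply k).comp hU.1)) _
  have e1 := integral_map (μ := P) hMU.aemeasurable hg.aestronglyMeasurable
  have e2 := integral_map (μ := P) hU.1.aemeasurable hg.aestronglyMeasurable
  rw [← e2, ← hU.2.2 M hM, e1]
  refine integral_congr_ae (Filter.Eventually.of_forall fun ω => ?_)
  simp only [coe_actS_orthogonal (hU.2.1 ω), coe_actS_orthogonal (mul_mem hM (hU.2.1 ω))]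
  congr 1
  change Matrix.toEuclideanCLM (𝕜 := ℝ) M (Matrix.toEuclideanCLM (𝕜 := ℝ) (U ω) v)
    = Matrix.toEuclideanCLM (𝕜 := ℝ) (M * U ω) v
  rw [map_mul]
  rfl

lemma sphMean_orbitLaw (hU : IsHaarOrth P U) {κ : Euc (L + 1) → ℝ} (hκ : Measurable κ)
    (v : Sph L) (σ : ℝ) : sphMean (orbitLaw P U v) v κ σ
      = ∫ ω, κ (v + σ • Matrix.toEuclideanLin (U ω) (v : Euc (L + 1))) ∂P := by
  rw [sphMean, orbitLaw,
    integral_map (measurable_actS hU.1 (measurable_const (a := v))).aemeasurable]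
  · simp only [coe_actS_orthogonal (hU.2.1 _)]
  · exact (hκ.comp (by fun_prop)).aestronglyMeasurable

end Orbit

section Averages

variable {L : ℕ} {Ω : Type*} [MeasurableSpace Ω] {P : Measure Ω}
  {U : Ω → Matrix (Fin (L + 1)) (Fin (L + 1)) ℝ} {μ : Measure (Sph L)} {T : Ω → ℝ}
  {κ κ₁ κ₂ : Euc (L + 1) → ℝ}

/-- The average of `κ (v + T • U v)`, where `T` and `U` are sampled independently. -/
def avgMean (P : Measure Ω) (U : Ω → Matrix (Fin (L + 1)) (Fin (L + 1)) ℝ) (μ : Measure (Sph L))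
    (T : Ω → ℝ) (κ : Euc (L + 1) → ℝ) : ℝ :=
  ∫ p : Sph L × Ω, sphMean (orbitLaw P U p.1) p.1 κ (T p.2) ∂μ.prod P

/-- The average of the Green's potentials of `κ` over the balls of radius `T` around `v`. -/
def avgGreen (P : Measure Ω) (U : Ω → Matrix (Fin (L + 1)) (Fin (L + 1)) ℝ) (μ : Measure (Sph L))
    (T : Ω → ℝ) (κ : Euc (L + 1) → ℝ) : ℝ :=
  ∫ p : Sph L × Ω, T p.2 ^ 2 * greenInt (orbitLaw P U p.1) p.1 (T p.2) κ ∂μ.prod P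

lemma measurable_of_continuousAt_ne_zero (hκ : ∀ w ≠ 0, ContinuousAt κ w) : Measurable κ :=
  measurable_of_continuousOn_compl_singleton 0 fun w hw => (hκ w hw).continuousWithinAt

lemma exists_abs_le_of_continuousAt (hκ : ∀ w ≠ 0, ContinuousAt κ w) :
    ∃ C, ∀ w, 3 / 4 ≤ ‖w‖ → ‖w‖ ≤ 5 / 4 → ‖κ w‖ ≤ C := by
  have hc : IsCompact (Metric.closedBall (0 : Euc (L + 1)) (5 / 4) ∩ {w | 3 / 4 ≤ ‖w‖}) :=
    (isCompact_closedBall _ _).inter_right (isClosed_le continuous_const continuous_norm)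
  obtain ⟨C, hC⟩ := hc.exists_bound_of_continuousOn (f := κ) fun w hw =>
    (hκ w (norm_pos_iff.1 (lt_of_lt_of_le (by norm_num) hw.2))).continuousWithinAt
  exact ⟨C, fun w h1 h2 => hC w ⟨by simpa using h2, h1⟩⟩

lemma exists_abs_sphMean_le (hκ : ∀ w ≠ 0, ContinuousAt κ w) :
    ∃ C, 0 ≤ C ∧ ∀ (τ : Measure (Sph L)) (v : Sph L) (σ : ℝ), IsProbabilityMeasure τ → 0 ≤ σ →
      σ ≤ 1 / 4 → ‖sphMean τ v κ σ‖ ≤ C := by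
  obtain ⟨C, hC⟩ := exists_abs_le_of_continuousAt hκ
  refine ⟨max C 0, le_max_right _ _, fun τ v σ _ h0 h4 => ?_⟩
  have hv := norm_eq_of_mem_sphere v
  refine (norm_integral_le_of_norm_le_const (C := max C 0) (Filter.Eventually.of_forall fun ξ =>
    (hC _ ?_ ?_).trans (le_max_left _ _))).trans (by simp)
  · linarith [le_norm_add_smul hv h0 ξ]
  · refine (norm_add_le _ _).trans ?_
    rw [hv, norm_smul, norm_eq_of_mem_sphere, Real.norm_of_nonneg h0]
    linarith

lemma stronglyMeasurable_sphMean [IsProbabilityMeasure P] (hU : IsHaarOrth P U)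
    (hκ : Measurable κ) {α : Type*} [MeasurableSpace α] {f : α → Sph L} {g : α → ℝ}
    (hf : Measurable f) (hg : Measurable g) :
    StronglyMeasurable fun a => sphMean (orbitLaw P U (f a)) (f a) κ (g a) := by
  simp only [sphMean_orbitLaw hU hκ]
  have hf2 : Measurable fun p : α × Ω => (f p.1 : Euc (L + 1)) :=
    measurable_subtype_coe.comp (hf.comp measurable_fst)
  have h1 : Measurable fun p : α × Ω =>
      Matrix.toEuclideanLin (U p.2) (f p.1 : Euc (L + 1)) :=
    measurable_toEuclideanLin_apply (hU.1.comp measurable_snd) hf2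
  have h2 : Measurable fun p : α × Ω =>
      κ ((f p.1 : Euc (L + 1)) + g p.1 • Matrix.toEuclideanLin (U p.2) (f p.1 : Euc (L + 1))) :=
    hκ.comp (hf2.add ((hg.comp measurable_fst).smul h1))
  exact h2.stronglyMeasurable.integral_prod_right'

lemma integrable_sphMean [IsProbabilityMeasure P] [IsProbabilityMeasure μ] (hU : IsHaarOrth P U)
    (hT : Measurable T) (hT0 : ∀ ω, 0 ≤ T ω) (hT4 : ∀ ω, T ω ≤ 1 / 4)
    (hκ : ∀ w ≠ 0, ContinuousAt κ w) :
    Integrable (fun p : Sph L × Ω => sphMean (orbitLaw P U p.1) p.1 κ (T p.2)) (μ.prod P) := by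
  obtain ⟨C, _, hC⟩ := exists_abs_sphMean_le hκ
  refine Integrable.of_bound (stronglyMeasurable_sphMean hU (measurable_of_continuousAt_ne_zero hκ)
    measurable_fst (hT.comp measurable_snd)).aestronglyMeasurable C
    (Filter.Eventually.of_forall fun p => ?_)
  exact hC _ _ _ (isProbabilityMeasure_orbitLaw hU.1 p.1) (hT0 _) (hT4 _)

lemma integrable_sq_mul_greenInt (hL : 2 ≤ L) [IsProbabilityMeasure P] [IsProbabilityMeasure μ]
    (hU : IsHaarOrth P U) (hT : Measurable T) (hT0 : ∀ ω, 0 ≤ T ω) (hT4 : ∀ ω, T ω ≤ 1 / 4)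
    (hκ : ∀ w ≠ 0, ContinuousAt κ w) :
    Integrable (fun p : Sph L × Ω => T p.2 ^ 2 * greenInt (orbitLaw P U p.1) p.1 (T p.2) κ)
      (μ.prod P) := by
  obtain ⟨C, hC0, hC⟩ := exists_abs_sphMean_le hκ
  have hL' : (2 : ℝ) ≤ L := by exact_mod_cast hL
  have hm : StronglyMeasurable fun p : (Sph L × Ω) × ℝ =>
      greenWeight L p.2 * sphMean (orbitLaw P U p.1.1) p.1.1 κ (T p.1.2 * p.2) :=
    (continuous_greenWeight.measurable.comp measurable_snd).stronglyMeasurable.mul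
      (stronglyMeasurable_sphMean hU (measurable_of_continuousAt_ne_zero hκ)
        (measurable_fst.comp measurable_fst)
        ((hT.comp (measurable_snd.comp measurable_fst)).mul measurable_snd))
  have hm2 : StronglyMeasurable fun p : Sph L × Ω =>
      greenInt (orbitLaw P U p.1) p.1 (T p.2) κ := by
    simp only [greenInt, intervalIntegral.integral_of_le zero_le_one]
    exact hm.integral_prod_right'
  refine Integrable.of_bound (((hT.comp measurable_snd).pow_const 2).stronglyMeasurable.mul
    hm2).aestronglyMeasurable C (Filter.Eventually.of_forall fun p => ?_)
  have hb : ‖greenInt (orbitLaw P U p.1) p.1 (T p.2) κ‖ ≤ C * |1 - 0| := by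
    refine intervalIntegral.norm_integral_le_of_norm_le_const fun s hs => ?_
    rw [Set.uIoc_of_le zero_le_one] at hs
    have hw0 := greenWeight_nonneg hL (Set.Ioc_subset_Icc_self hs)
    have hw1 : greenWeight L s ≤ 1 := by
      rw [greenWeight, div_le_one (by linarith)]
      have := pow_nonneg hs.1.le (L - 1)
      nlinarith [hs.1, hs.2]
    have h2 := hC (orbitLaw P U p.1) p.1 (T p.2 * s) (isProbabilityMeasure_orbitLaw hU.1 p.1)
      (mul_nonneg (hT0 _) hs.1.le) (by nlinarith [hT0 p.2, hT4 p.2, hs.1, hs.2])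
    rw [norm_mul, Real.norm_of_nonneg hw0]
    calc _ ≤ 1 * C := mul_le_mul hw1 h2 (norm_nonneg _) zero_le_one
      _ = C := one_mul C
  rw [norm_mul, Real.norm_of_nonneg (sq_nonneg _)]
  have h4 : T p.2 ^ 2 ≤ 1 := by nlinarith [hT0 p.2, hT4 p.2]
  rw [sub_zero, abs_one, mul_one] at hb
  calc _ ≤ 1 * C := mul_le_mul h4 hb (norm_nonneg _) zero_le_one
    _ = C := one_mul C

end Averages

/-- The step length `T` is a measurable random variable with values in `[0, 1/4]`, and `U` is
Haar distributed on the orthogonal group. -/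
structure IsStep {L : ℕ} {Ω : Type*} [MeasurableSpace Ω] (P : Measure Ω)
    (U : Ω → Matrix (Fin (L + 1)) (Fin (L + 1)) ℝ) (T : Ω → ℝ) : Prop where
  haar : IsHaarOrth P U
  measurable : Measurable T
  nonneg : ∀ ω, 0 ≤ T ω
  le : ∀ ω, T ω ≤ 1 / 4

section Step

variable {L : ℕ} {Ω : Type*} [MeasurableSpace Ω] {P : Measure Ω}
  {U : Ω → Matrix (Fin (L + 1)) (Fin (L + 1)) ℝ} {μ : Measure (Sph L)} {T : Ω → ℝ}
  {κ₁ κ₂ : Euc (L + 1) → ℝ}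

lemma IsStep.lt_one (hS : IsStep P U T) (ω : Ω) : T ω < 1 := (hS.le ω).trans_lt (by norm_num)

lemma avgGreen_congr (hS : IsStep P U T) (h : ∀ w ≠ 0, κ₁ w = κ₂ w) :
    avgGreen P U μ T κ₁ = avgGreen P U μ T κ₂ := by
  unfold avgGreen
  congr 1
  funext p
  rw [greenInt_congr (norm_eq_of_mem_sphere p.1) (hS.nonneg _) (hS.lt_one _) h]

lemma avgMean_const_mul (c : ℝ) (κ : Euc (L + 1) → ℝ) :
    avgMean P U μ T (fun w => c * κ w) = c * avgMean P U μ T κ := by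
  simp only [avgMean, sphMean, integral_const_mul]

lemma avgGreen_const_mul (c : ℝ) (κ : Euc (L + 1) → ℝ) :
    avgGreen P U μ T (fun w => c * κ w) = c * avgGreen P U μ T κ := by
  simp only [avgGreen, greenInt_const_mul, ← integral_const_mul, mul_left_comm c]

end Step

section Stationary

variable {L : ℕ} {Ω : Type*} [MeasurableSpace Ω] {P : Measure Ω} [IsProbabilityMeasure P]
  {U : Ω → Matrix (Fin (L + 1)) (Fin (L + 1)) ℝ} {μ : Measure (Sph L)} [IsProbabilityMeasure μ]
  {T : Ω → ℝ} {F κ κ₁ κ₂ : Euc (L + 1) → ℝ}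

lemma avgMean_mono (hS : IsStep P U T) (h₁ : ∀ w ≠ 0, ContinuousAt κ₁ w)
    (h₂ : ∀ w ≠ 0, ContinuousAt κ₂ w) (hle : ∀ w ≠ 0, κ₁ w ≤ κ₂ w) :
    avgMean P U μ T κ₁ ≤ avgMean P U μ T κ₂ := by
  refine integral_mono (integrable_sphMean hS.haar hS.measurable hS.nonneg hS.le h₁)
    (integrable_sphMean hS.haar hS.measurable hS.nonneg hS.le h₂) fun p => ?_
  have := isProbabilityMeasure_orbitLaw (P := P) hS.haar.1 p.1
  have hv := norm_eq_of_mem_sphere p.1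
  exact sphMean_mono h₁ h₂ hv (hS.nonneg _) (hS.lt_one _) fun ξ =>
    hle _ (add_smul_ne_zero hv (hS.nonneg _) (hS.lt_one _) ξ)

lemma avgMean_sub (hS : IsStep P U T) (h₁ : ∀ w ≠ 0, ContinuousAt κ₁ w)
    (h₂ : ∀ w ≠ 0, ContinuousAt κ₂ w) :
    avgMean P U μ T (fun w => κ₁ w - κ₂ w) = avgMean P U μ T κ₁ - avgMean P U μ T κ₂ := by
  unfold avgMean
  rw [← integral_sub (integrable_sphMean hS.haar hS.measurable hS.nonneg hS.le h₁)
    (integrable_sphMean hS.haar hS.measurable hS.nonneg hS.le h₂)]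
  congr 1
  funext p
  have := isProbabilityMeasure_orbitLaw (P := P) hS.haar.1 p.1
  have hv := norm_eq_of_mem_sphere p.1
  exact integral_sub (integrable_comp_add_smul h₁ hv (hS.nonneg _) (hS.lt_one _))
    (integrable_comp_add_smul h₂ hv (hS.nonneg _) (hS.lt_one _))

lemma avgGreen_mono (hL : 2 ≤ L) (hS : IsStep P U T) (h₁ : ∀ w ≠ 0, ContinuousAt κ₁ w)
    (h₂ : ∀ w ≠ 0, ContinuousAt κ₂ w) (hle : ∀ w ≠ 0, κ₁ w ≤ κ₂ w) :
    avgGreen P U μ T κ₁ ≤ avgGreen P U μ T κ₂ := by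
  refine integral_mono (integrable_sq_mul_greenInt hL hS.haar hS.measurable hS.nonneg hS.le h₁)
    (integrable_sq_mul_greenInt hL hS.haar hS.measurable hS.nonneg hS.le h₂) fun p => ?_
  have := isProbabilityMeasure_orbitLaw (P := P) hS.haar.1 p.1
  exact mul_le_mul_of_nonneg_left (greenInt_mono hL h₁ h₂ (norm_eq_of_mem_sphere p.1)
    (hS.nonneg _) (hS.lt_one _) hle) (sq_nonneg _)

lemma avgGreen_sub (hL : 2 ≤ L) (hS : IsStep P U T) (h₁ : ∀ w ≠ 0, ContinuousAt κ₁ w)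
    (h₂ : ∀ w ≠ 0, ContinuousAt κ₂ w) :
    avgGreen P U μ T (fun w => κ₁ w - κ₂ w) = avgGreen P U μ T κ₁ - avgGreen P U μ T κ₂ := by
  unfold avgGreen
  rw [← integral_sub (integrable_sq_mul_greenInt hL hS.haar hS.measurable hS.nonneg hS.le h₁)
    (integrable_sq_mul_greenInt hL hS.haar hS.measurable hS.nonneg hS.le h₂)]
  congr 1
  funext p
  have := isProbabilityMeasure_orbitLaw (P := P) hS.haar.1 p.1
  rw [greenInt_sub h₁ h₂ (norm_eq_of_mem_sphere p.1) (hS.nonneg _) (hS.lt_one _), mul_sub]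

lemma continuous_sphere_of_continuousAt (hκ : ∀ w ≠ 0, ContinuousAt κ w) :
    Continuous fun v : Sph L => κ v :=
  continuous_iff_continuousAt.2 fun v => ContinuousAt.comp (f := fun v : Sph L => (v : Euc (L + 1)))
    (hκ _ (ne_zero_of_mem_unit_sphere v)) continuous_subtype_val.continuousAt

lemma avgMean_sub_integral_eq_avgGreen_lap (hL : 2 ≤ L) (hS : IsStep P U T)
    (hF : ∀ w ≠ 0, ContDiffAt ℝ 2 F w) :
    avgMean P U μ T F - ∫ v, F (v : Euc (L + 1)) ∂μ = avgGreen P U μ T (lap F) := by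
  have hc := fun w hw => (hF w hw).continuousAt
  have hi : Integrable (fun v : Sph L => F v) μ :=
    integrable_sphere (continuous_sphere_of_continuousAt hc)
  have e : ∫ v, F (v : Euc (L + 1)) ∂μ = ∫ p : Sph L × Ω, F (p.1 : Euc (L + 1)) ∂μ.prod P := by
    rw [integral_fun_fst (f := fun v : Sph L => F v)]
    simp
  rw [e, avgMean, avgGreen, ← integral_sub
    (integrable_sphMean hS.haar hS.measurable hS.nonneg hS.le hc) (hi.comp_fst P)]
  congr 1
  funext p
  have := isProbabilityMeasure_orbitLaw (P := P) hS.haar.1 p.1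
  exact sphMean_sub_eq_greenInt_lap hL (isRotInv_orbitLaw hS.haar p.1) hF
    (norm_eq_of_mem_sphere p.1) (hS.nonneg _) (hS.lt_one _)

lemma toEuclideanLin_mul_one_add_smul {n : ℕ} (R M : Matrix (Fin n) (Fin n) ℝ) (t : ℝ)
    (v : Euc n) : Matrix.toEuclideanLin (R * (1 + t • M)) v
      = Matrix.toEuclideanLin R (v + t • Matrix.toEuclideanLin M v) := by
  change Matrix.toEuclideanCLM (𝕜 := ℝ) (R * (1 + t • M)) v
    = Matrix.toEuclideanCLM (𝕜 := ℝ) R (v + t • Matrix.toEuclideanCLM (𝕜 := ℝ) M v)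
  simp [map_mul, map_add, map_smul]

lemma measurable_mul_one_add_smul {α : Type*} [MeasurableSpace α] {n : ℕ}
    (R : Matrix (Fin n) (Fin n) ℝ) {t : α → ℝ} {M : α → Matrix (Fin n) (Fin n) ℝ}
    (ht : Measurable t) (hM : Measurable M) : Measurable fun a => R * (1 + t a • M a) := by
  refine measurable_pi_lambda _ fun i => measurable_pi_lambda _ fun j => ?_
  simp only [Matrix.mul_apply, Matrix.add_apply, Matrix.smul_apply, smul_eq_mul]
  exact Finset.measurable_sum _ fun k _ => Measurable.const_mul (Measurable.const_add (ht.mul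
    ((measurable_pi_apply j).comp ((measurable_pi_apply k).comp hM))) _) _

lemma apply_actS_mul_one_add_smul {R M : Matrix (Fin (L + 1)) (Fin (L + 1)) ℝ}
    (hR : ∀ w, w ≠ 0 → Matrix.toEuclideanLin R w ≠ 0)
    (hM : M ∈ Matrix.orthogonalGroup (Fin (L + 1)) ℝ)
    (hF : ∀ (c : ℝ) (w : Euc (L + 1)), 0 < c → F (c • w) = F w) {t : ℝ} (ht : 0 ≤ t) (ht1 : t < 1)
    (v : Sph L) : F (actS (R * (1 + t • M)) v)
      = F (Matrix.toEuclideanLin R ((v : Euc (L + 1)) + t • Matrix.toEuclideanLin M v)) := by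
  have h : Matrix.toEuclideanLin R ((v : Euc (L + 1)) + t • Matrix.toEuclideanLin M v) ≠ 0 := by
    rw [← coe_actS_orthogonal hM]
    exact hR _ (add_smul_ne_zero (norm_eq_of_mem_sphere v) ht ht1 _)
  rw [← toEuclideanLin_mul_one_add_smul] at h ⊢
  rw [coe_actS h, hF _ _ (inv_pos.2 (norm_pos_iff.2 h))]

lemma continuousAt_comp_toEuclideanLin {n : ℕ} {R : Matrix (Fin n) (Fin n) ℝ} {F : Euc n → ℝ}
    {w : Euc n} (hR : ∀ w, w ≠ 0 → Matrix.toEuclideanLin R w ≠ 0)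
    (hF : ∀ w ≠ 0, ContinuousAt F w) (hw : w ≠ 0) :
    ContinuousAt (fun w => F (Matrix.toEuclideanLin R w)) w :=
  ContinuousAt.comp (f := fun w => Matrix.toEuclideanLin R w) (hF _ (hR w hw))
    (Matrix.toEuclideanCLM (𝕜 := ℝ) R).continuous.continuousAt

lemma integral_eq_avgMean_of_invariant (hS : IsStep P U T) (hTU : IndepFun T U P)
    {R : Matrix (Fin (L + 1)) (Fin (L + 1)) ℝ}
    (hR : ∀ w, w ≠ 0 → Matrix.toEuclideanLin R w ≠ 0)
    (hinv : ∀ A : Set (Sph L), MeasurableSet A →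
      μ A = ∫⁻ v, P {ω | actS (R * (1 + T ω • U ω)) v ∈ A} ∂μ)
    (hκ : ∀ w ≠ 0, ContinuousAt F w)
    (hF : ∀ (c : ℝ) (w : Euc (L + 1)), 0 < c → F (c • w) = F w) :
    ∫ v, F (v : Euc (L + 1)) ∂μ = avgMean P U μ T (fun w => F (Matrix.toEuclideanLin R w)) := by
  have hc := continuous_sphere_of_continuousAt hκ
  obtain ⟨C, hC⟩ := isCompact_univ.exists_bound_of_continuousOn hc.continuousOn
  have hm : Measurable fun p : Sph L × Ω => actS (R * (1 + T p.2 • U p.2)) p.1 :=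
    measurable_actS (measurable_mul_one_add_smul R (hS.measurable.comp measurable_snd)
      (hS.haar.1.comp measurable_snd)) measurable_fst
  have hμ : μ = (μ.prod P).map fun p : Sph L × Ω => actS (R * (1 + T p.2 • U p.2)) p.1 := by
    ext A hA
    rw [Measure.map_apply hm hA, Measure.prod_apply (hm hA), hinv A hA]
    rfl
  have hκR : ∀ w ≠ 0, ContinuousAt (fun w => F (Matrix.toEuclideanLin R w)) w := fun w hw =>
    continuousAt_comp_toEuclideanLin hR hκ hw
  have hFR := measurable_of_continuousAt_ne_zero hκR
  have h1 : ∫ v, F (v : Euc (L + 1)) ∂μ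
      = ∫ p : Sph L × Ω, F (actS (R * (1 + T p.2 • U p.2)) p.1) ∂μ.prod P := by
    conv_lhs => rw [hμ]
    exact integral_map hm.aemeasurable hc.aestronglyMeasurable
  rw [h1, avgMean, integral_prod, integral_prod]
  · congr 1
    funext v
    have hg : Measurable fun q : ℝ × Matrix (Fin (L + 1)) (Fin (L + 1)) ℝ =>
        F (actS (R * (1 + q.1 • q.2)) v) := by
      have h := hc.measurable.comp (measurable_actS (measurable_mul_one_add_smul R measurable_fst
        measurable_snd) (measurable_const (a := v)))
      rw [Function.comp_def] at h
      exact h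
    have hTm := hS.measurable
    have hUm := hS.haar.1
    have := Measure.isProbabilityMeasure_map (μ := P) hTm.aemeasurable
    have := Measure.isProbabilityMeasure_map (μ := P) hUm.aemeasurable
    have e1 := integral_map (μ := P) (hTm.prodMk hUm).aemeasurable hg.aestronglyMeasurable
    rw [(indepFun_iff_map_prod_eq_prod_map_map hTm.aemeasurable hUm.aemeasurable).1 hTU,
      integral_prod _ (Integrable.of_bound hg.aestronglyMeasurable C
        (Filter.Eventually.of_forall fun q => hC _ (Set.mem_univ _))),
      integral_map hTm.aemeasurable
        hg.stronglyMeasurable.integral_prod_right'.aestronglyMeasurable] at e1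
    refine e1.symm.trans ?_
    congr 1
    funext ω
    rw [sphMean_orbitLaw hS.haar hFR]
    have hg2 : Measurable fun M : Matrix (Fin (L + 1)) (Fin (L + 1)) ℝ =>
        F (actS (R * (1 + T ω • M)) v) := by
      have h := hg.comp ((measurable_const (a := T ω)).prodMk measurable_id)
      rw [Function.comp_def] at h
      exact h
    rw [integral_map hUm.aemeasurable hg2.aestronglyMeasurable]
    congr 1
    funext ω'
    exact apply_actS_mul_one_add_smul hR (hS.haar.2.1 ω') hF (hS.nonneg ω) (hS.lt_one ω) v
  · exact integrable_sphMean hS.haar hS.measurable hS.nonneg hS.le hκR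
  · have h := hc.measurable.comp hm
    rw [Function.comp_def] at h
    exact Integrable.of_bound h.aestronglyMeasurable C
      (Filter.Eventually.of_forall fun q => hC _ (Set.mem_univ _))

end Stationary

section Contraction

variable {n : ℕ} {d : Fin n → ℝ} {s t : Finset (Fin n)} {ρ : ℝ} {w : Euc n}

lemma toEuclideanLin_diagonal_apply (d : Fin n → ℝ) (w : Euc n) (i : Fin n) :
    Matrix.toEuclideanLin (Matrix.diagonal d) w i = d i * w i :=
  Matrix.mulVec_diagonal d _ i

lemma toEuclideanLin_diagonal_ne_zero (hd : ∀ i, 0 < d i) (w : Euc n) (hw : w ≠ 0) :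
    Matrix.toEuclideanLin (Matrix.diagonal d) w ≠ 0 := by
  refine fun h => hw (PiLp.ext fun i => ?_)
  have hi := congrArg (fun x : Euc n => x i) h
  simp only [toEuclideanLin_diagonal_apply] at hi
  exact (mul_eq_zero.1 hi).resolve_left (hd i).ne'

lemma sqOn_diagonal_le (h : ∀ i ∈ s, d i ^ 2 ≤ ρ) :
    sqOn s (Matrix.toEuclideanLin (Matrix.diagonal d) w) ≤ ρ * sqOn s w := by
  simp only [sqOn, Finset.mul_sum, toEuclideanLin_diagonal_apply, mul_pow]
  exact Finset.sum_le_sum fun i hi => mul_le_mul_of_nonneg_right (h i hi) (sq_nonneg _)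

lemma le_sqOn_diagonal (h : ∀ i ∈ s, ρ ≤ d i ^ 2) :
    ρ * sqOn s w ≤ sqOn s (Matrix.toEuclideanLin (Matrix.diagonal d) w) := by
  simp only [sqOn, Finset.mul_sum, toEuclideanLin_diagonal_apply, mul_pow]
  exact Finset.sum_le_sum fun i hi => mul_le_mul_of_nonneg_right (h i hi) (sq_nonneg _)

lemma sqOn_add_compl (s : Finset (Fin n)) (w : Euc n) : sqOn s w + sqOn sᶜ w = ‖w‖ ^ 2 := by
  rw [← sqOn_univ]
  exact Finset.sum_add_sum_compl s _

lemma sqRatio_compl (s : Finset (Fin n)) (hw : w ≠ 0) : sqRatio sᶜ w = 1 - sqRatio s w := by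
  have h : ‖w‖ ^ 2 ≠ 0 := pow_ne_zero 2 (norm_ne_zero_iff.2 hw)
  rw [sqRatio, sqRatio, eq_sub_iff_add_eq, ← add_mul, add_comm, sqOn_add_compl, mul_inv_cancel₀ h]

lemma sqRatio_le_one (s : Finset (Fin n)) (hw : w ≠ 0) : sqRatio s w ≤ 1 := by
  linarith [sqRatio_compl s hw, sqRatio_nonneg sᶜ w]

lemma sqRatio_smul (s : Finset (Fin n)) (c : ℝ) (w : Euc n) (hc : 0 < c) :
    sqRatio s (c • w) = sqRatio s w := by
  simp only [sqRatio, sqOn, PiLp.smul_apply, smul_eq_mul, mul_pow, ← Finset.mul_sum, norm_smul,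
    Real.norm_of_nonneg hc.le]
  field_simp

lemma sqRatio_diagonal_le_sub {γ : ℝ} (hd : ∀ i, 0 < d i) (hγ : 0 ≤ γ) (hγ1 : γ ≤ 1)
    (hs : ∀ i ∈ s, d i ^ 2 ≤ ρ) (hsc : ∀ i ∉ s, ρ ≤ d i ^ 2) (hst : Disjoint s t)
    (ht : ∀ i ∈ t, (1 + γ) * ρ ≤ d i ^ 2) (hw : w ≠ 0) :
    sqRatio s (Matrix.toEuclideanLin (Matrix.diagonal d) w)
      ≤ sqRatio s w - γ / 2 * (sqRatio s w * sqRatio t w) := by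
  have hst' : t ⊆ sᶜ := fun i hi => Finset.mem_compl.2 fun h => Finset.disjoint_left.1 hst h hi
  have hS' : 0 < ‖Matrix.toEuclideanLin (Matrix.diagonal d) w‖ ^ 2 :=
    pow_pos (norm_pos_iff.2 (toEuclideanLin_diagonal_ne_zero hd w hw)) 2
  have hS : 0 < ‖w‖ ^ 2 := pow_pos (norm_pos_iff.2 hw) 2
  have hA := sqOn_diagonal_le (w := w) hs
  have hB : ρ * (sqOn sᶜ w + γ * sqOn t w)
      ≤ sqOn sᶜ (Matrix.toEuclideanLin (Matrix.diagonal d) w) := by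
    have e : ∀ x : Euc n, sqOn sᶜ x = sqOn (sᶜ \ t) x + sqOn t x := fun x =>
      (Finset.sum_sdiff hst').symm
    have h1 := le_sqOn_diagonal (w := w) (s := sᶜ \ t) fun i hi =>
      hsc i (Finset.mem_compl.1 (Finset.mem_sdiff.1 hi).1)
    have h2 := le_sqOn_diagonal (w := w) ht
    rw [e w, e]
    linarith
  have hA0 := sqOn_nonneg s w
  have hC0 := sqOn_nonneg t w
  have hB0 := sqOn_nonneg sᶜ w
  have hC : sqOn t w ≤ ‖w‖ ^ 2 := by
    rw [← sqOn_univ]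
    exact Finset.sum_le_sum_of_subset_of_nonneg (Finset.subset_univ _) fun _ _ _ => sq_nonneg _
  have e1 := sqOn_add_compl s w
  have e2 := sqOn_add_compl s (Matrix.toEuclideanLin (Matrix.diagonal d) w)
  unfold sqRatio
  rw [← e2] at hS' ⊢
  rw [← e1] at hS hC ⊢
  set A := sqOn s w
  set B := sqOn sᶜ w
  set C := sqOn t w
  set A' := sqOn s (Matrix.toEuclideanLin (Matrix.diagonal d) w)
  set B' := sqOn sᶜ (Matrix.toEuclideanLin (Matrix.diagonal d) w)
  have hK : A' * (B + γ * C) ≤ A * B' :=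
    calc A' * (B + γ * C) ≤ ρ * A * (B + γ * C) :=
          mul_le_mul_of_nonneg_right hA (by positivity)
      _ = A * (ρ * (B + γ * C)) := by ring
      _ ≤ A * B' := mul_le_mul_of_nonneg_left hB hA0
  have hD : 0 < A + B + γ * C := by positivity
  have h3 : A' * (A' + B')⁻¹ ≤ A * (A + B + γ * C)⁻¹ := by
    rw [← div_eq_mul_inv, ← div_eq_mul_inv, div_le_div_iff₀ hS' hD]
    linarith
  refine h3.trans ?_
  have h4 : A * (A + B)⁻¹ - γ / 2 * (A * (A + B)⁻¹ * (C * (A + B)⁻¹))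
      = A * ((A + B - γ / 2 * C) / (A + B) ^ 2) := by
    field_simp
  rw [h4]
  refine mul_le_mul_of_nonneg_left ?_ hA0
  rw [inv_eq_one_div, div_le_div_iff₀ hD (by positivity)]
  have h5 : γ * C ≤ A + B := by nlinarith
  nlinarith [mul_nonneg (mul_nonneg hγ hC0) (sub_nonneg.2 h5)]

lemma sqRatio_diagonal_le (hd : ∀ i, 0 < d i) (hs : ∀ i ∈ s, d i ^ 2 ≤ ρ)
    (hsc : ∀ i ∉ s, ρ ≤ d i ^ 2) (hw : w ≠ 0) :
    sqRatio s (Matrix.toEuclideanLin (Matrix.diagonal d) w) ≤ sqRatio s w := by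
  have h := sqRatio_diagonal_le_sub (t := ∅) hd le_rfl zero_le_one hs hsc
    (Finset.disjoint_empty_right s) (by simp) hw
  simpa using h

end Contraction

section Main

variable {L : ℕ} {Ω : Type*} [MeasurableSpace Ω] {P : Measure Ω} [IsProbabilityMeasure P]
  {U : Ω → Matrix (Fin (L + 1)) (Fin (L + 1)) ℝ} {μ : Measure (Sph L)} [IsProbabilityMeasure μ]
  {T : Ω → ℝ} {ψ : Euc (L + 1) → Euc (L + 1)} {s t : Finset (Fin (L + 1))}

/-- Scale-invariant observables have the same mean with respect to `μ` as after a random step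
followed by `ψ`. -/
def HasStationaryMeans (P : Measure Ω) (U : Ω → Matrix (Fin (L + 1)) (Fin (L + 1)) ℝ)
    (μ : Measure (Sph L)) (T : Ω → ℝ) (ψ : Euc (L + 1) → Euc (L + 1)) : Prop :=
  ∀ F : Euc (L + 1) → ℝ, (∀ w ≠ 0, ContinuousAt F w) →
    (∀ (c : ℝ) (w : Euc (L + 1)), 0 < c → F (c • w) = F w) →
    (∀ w ≠ 0, ContinuousAt (fun w => F (ψ w)) w) ∧
      ∫ v, F (v : Euc (L + 1)) ∂μ = avgMean P U μ T fun w => F (ψ w)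

lemma continuousAt_inv_normSq_mul {n : ℕ} {κ : Euc n → ℝ} {w : Euc n} (hw : w ≠ 0)
    (hκ : ContinuousAt κ w) : ContinuousAt (fun y => (‖y‖ ^ 2)⁻¹ * κ y) w :=
  (continuousAt_inv_normSq hw).mul hκ

lemma avgGreen_sqRatio_pow_succ_le (hL : 2 ≤ L) (hS : IsStep P U T)
    (hst : HasStationaryMeans P U μ T ψ) (hle : ∀ w ≠ 0, sqRatio s (ψ w) ≤ sqRatio s w) (k : ℕ) :
    (((L + 1 : ℕ) : ℝ) + 2 * k) * avgGreen P U μ T (fun w => (‖w‖ ^ 2)⁻¹ * sqRatio s w ^ (k + 1))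
      ≤ (s.card + 2 * k) * avgGreen P U μ T (fun w => (‖w‖ ^ 2)⁻¹ * sqRatio s w ^ k) := by
  have hc : ∀ k : ℕ, ∀ w : Euc (L + 1), w ≠ 0 → ContinuousAt (fun y => sqRatio s y ^ k) w :=
    fun k w hw => (continuousAt_sqRatio s hw).pow k
  have hi : ∀ (b : ℝ) (k : ℕ), ∀ w : Euc (L + 1), w ≠ 0 →
      ContinuousAt (fun y => b * ((‖y‖ ^ 2)⁻¹ * sqRatio s y ^ k)) w := fun b k w hw =>
    (continuousAt_inv_normSq_mul hw (hc k w hw)).const_mul b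
  obtain ⟨h1, h2⟩ := hst (fun w => sqRatio s w ^ (k + 1)) (hc _) fun c w h => by
    rw [sqRatio_smul s c w h]
  have h3 := avgMean_mono (μ := μ) hS h1 (hc (k + 1)) fun w hw =>
    pow_le_pow_left₀ (sqRatio_nonneg s _) (hle w hw) _
  have h4 := avgMean_sub_integral_eq_avgGreen_lap (μ := μ) hL hS
    (F := fun w => sqRatio s w ^ (k + 1)) fun w hw => (contDiffAt_sqRatio s hw).pow _
  have h5 : 0 ≤ avgGreen P U μ T (lap fun w => sqRatio s w ^ (k + 1)) := by linarith
  rw [avgGreen_congr (κ₂ := fun w => 2 * ((k : ℝ) + 1) *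
      ((s.card + 2 * k) * ((‖w‖ ^ 2)⁻¹ * sqRatio s w ^ k)
        - (((L + 1 : ℕ) : ℝ) + 2 * k) * ((‖w‖ ^ 2)⁻¹ * sqRatio s w ^ (k + 1)))) hS
    (fun w hw => by rw [lap_sqRatio_pow s k hw]; ring), avgGreen_const_mul,
    avgGreen_sub hL hS (hi _ _) (hi _ _), avgGreen_const_mul, avgGreen_const_mul] at h5
  have := nonneg_of_mul_nonneg_right h5 (by positivity)
  linarith

lemma avgGreen_sqRatio_pow_le {p q : ℝ} (hL : 2 ≤ L) (hS : IsStep P U T)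
    (hst : HasStationaryMeans P U μ T ψ) (hle : ∀ w ≠ 0, sqRatio s (ψ w) ≤ sqRatio s w)
    (hp : 0 < p) (hq : 0 < q) (hs : (s.card : ℝ) = 2 * q) (hpq : ((L + 1 : ℕ) : ℝ) = 2 * (q + p))
    (k : ℕ) : avgGreen P U μ T (fun w => (‖w‖ ^ 2)⁻¹ * sqRatio s w ^ k)
      ≤ ratioProd p q k * avgGreen P U μ T (fun w => (‖w‖ ^ 2)⁻¹) := by
  induction k with
  | zero => simp [ratioProd]
  | succ k ih =>
    have h := avgGreen_sqRatio_pow_succ_le hL hS hst hle k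
    rw [hs, hpq] at h
    have hk : 0 < q + p + k := by positivity
    have h2 : avgGreen P U μ T (fun w => (‖w‖ ^ 2)⁻¹ * sqRatio s w ^ (k + 1))
        ≤ (q + k) / (q + p + k) * avgGreen P U μ T (fun w => (‖w‖ ^ 2)⁻¹ * sqRatio s w ^ k) := by
      rw [div_mul_eq_mul_div, le_div_iff₀ hk]
      linarith
    refine h2.trans ?_
    rw [ratioProd, Finset.prod_range_succ, ← ratioProd]
    calc _ ≤ (q + k) / (q + p + k) *
          (ratioProd p q k * avgGreen P U μ T (fun w => (‖w‖ ^ 2)⁻¹)) := by gcongr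
      _ = _ := by ring

lemma avgMean_mul_le {γ : ℝ} (hL : 2 ≤ L) (hS : IsStep P U T) (hst : HasStationaryMeans P U μ T ψ)
    (hle : ∀ w ≠ 0, sqRatio s (ψ w) ≤ sqRatio s w - γ / 2 * (sqRatio s w * sqRatio t w)) :
    γ / 2 * avgMean P U μ T (fun w => sqRatio s w * sqRatio t w)
      ≤ 2 * s.card * avgGreen P U μ T (fun w => (‖w‖ ^ 2)⁻¹) := by
  have hc : ∀ w : Euc (L + 1), w ≠ 0 → ContinuousAt (sqRatio s) w := fun w hw =>
    continuousAt_sqRatio s hw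
  have hm : ∀ w : Euc (L + 1), w ≠ 0 →
      ContinuousAt (fun w => γ / 2 * (sqRatio s w * sqRatio t w)) w := fun w hw =>
    (continuousAt_sqRatio_mul s t hw).const_mul _
  obtain ⟨h1, h2⟩ := hst (sqRatio s) hc (sqRatio_smul s)
  have h3 := avgMean_mono (μ := μ) hS
    (κ₂ := fun w => sqRatio s w - γ / 2 * (sqRatio s w * sqRatio t w)) h1
    (fun w hw => (hc w hw).sub (hm w hw)) hle
  rw [avgMean_sub hS hc hm, avgMean_const_mul] at h3
  have h4 := avgMean_sub_integral_eq_avgGreen_lap (μ := μ) hL hS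
    (F := sqRatio s) fun w hw => contDiffAt_sqRatio s hw
  have h5 := avgGreen_mono (μ := μ) hL hS (κ₁ := lap (sqRatio s))
    (κ₂ := fun w => 2 * s.card * (‖w‖ ^ 2)⁻¹)
    (fun w hw => continuousAt_lap (contDiffAt_sqRatio s hw))
    (fun w hw => (continuousAt_inv_normSq hw).const_mul _) fun w hw => by
      rw [lap_sqRatio s hw, mul_comm]
      refine mul_le_mul_of_nonneg_right ?_ (inv_nonneg.2 (sq_nonneg _))
      have := sqRatio_nonneg s w
      have : 0 ≤ 2 * ((L + 1 : ℕ) : ℝ) * sqRatio s w := by positivity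
      linarith
  rw [avgGreen_const_mul] at h5
  linarith

lemma avgGreen_mul_le {lam : ℝ} (hL : 3 ≤ L) (hS : IsStep P U T) (hlam : ∀ ω, T ω ≤ lam)
    (hd : Disjoint s t) :
    avgGreen P U μ T (fun w => (‖w‖ ^ 2)⁻¹ * (sqRatio s w * sqRatio t w))
      ≤ lam ^ 2 * (4 / (3 * (L + 1))) * avgMean P U μ T (fun w => sqRatio s w * sqRatio t w) := by
  have hm : ∀ w : Euc (L + 1), w ≠ 0 → ContinuousAt (fun w => sqRatio s w * sqRatio t w) w :=
    fun w hw => continuousAt_sqRatio_mul s t hw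
  rw [avgGreen, avgMean, ← integral_const_mul]
  refine integral_mono (integrable_sq_mul_greenInt (by omega) hS.haar hS.measurable hS.nonneg hS.le
    fun w hw => continuousAt_inv_normSq_mul hw (hm w hw))
    ((integrable_sphMean hS.haar hS.measurable hS.nonneg hS.le hm).const_mul _) fun p => ?_
  have := isProbabilityMeasure_orbitLaw (P := P) hS.haar.1 p.1
  have h := greenInt_inv_normSq_mul_sqRatio_mul_le hL (isRotInv_orbitLaw hS.haar p.1) hd
    (norm_eq_of_mem_sphere p.1) (hS.nonneg p.2) (hS.le p.2)
  have h0 : 0 ≤ sphMean (orbitLaw P U p.1) p.1 (fun w => sqRatio s w * sqRatio t w) (T p.2) :=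
    integral_nonneg fun ξ => mul_nonneg (sqRatio_nonneg _ _) (sqRatio_nonneg _ _)
  have hT : T p.2 ^ 2 ≤ lam ^ 2 := pow_le_pow_left₀ (hS.nonneg _) (hlam _) 2
  calc _ ≤ T p.2 ^ 2 * _ := mul_le_mul_of_nonneg_left h (sq_nonneg _)
    _ ≤ lam ^ 2 * _ := mul_le_mul_of_nonneg_right hT (by positivity)
    _ = _ := (mul_assoc _ _ _).symm

lemma IsStep.integrable_sq (hS : IsStep P U T) : Integrable (fun ω => T ω ^ 2) P :=
  Integrable.of_bound (hS.measurable.pow_const 2).aestronglyMeasurable 1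
    (Filter.Eventually.of_forall fun ω => by
      rw [Real.norm_of_nonneg (sq_nonneg _)]
      nlinarith [hS.nonneg ω, hS.le ω])

lemma avgGreen_inv_normSq_le (hL : 3 ≤ L) (hS : IsStep P U T) :
    avgGreen P U μ T (fun w => (‖w‖ ^ 2)⁻¹) ≤ (∫ ω, T ω ^ 2 ∂P) * (1 / (2 * (L + 1))) := by
  have e : (∫ ω, T ω ^ 2 ∂P) * (1 / (2 * (L + 1)))
      = ∫ p : Sph L × Ω, T p.2 ^ 2 * (1 / (2 * ((L : ℝ) + 1))) ∂μ.prod P := by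
    rw [integral_mul_const, integral_fun_snd (f := fun ω => T ω ^ 2)]
    simp
  rw [e]
  refine integral_mono (integrable_sq_mul_greenInt (by omega) hS.haar hS.measurable hS.nonneg hS.le
    fun w hw => continuousAt_inv_normSq hw) ((hS.integrable_sq.comp_snd μ).mul_const _) fun p => ?_
  have := isProbabilityMeasure_orbitLaw (P := P) hS.haar.1 p.1
  exact mul_le_mul_of_nonneg_left (greenInt_inv_normSq_le hL (isRotInv_orbitLaw hS.haar p.1)
    (norm_eq_of_mem_sphere p.1) (hS.nonneg p.2) (hS.lt_one p.2)) (sq_nonneg _)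

lemma integral_sqRatio_le_avgGreen (hL : 3 ≤ L) (hS : IsStep P U T) (s : Finset (Fin (L + 1))) :
    7 / 8 * ((∫ ω, T ω ^ 2 ∂P) * (1 / (2 * (L + 1)))) * ∫ v, sqRatio s (v : Euc (L + 1)) ∂μ
      ≤ avgGreen P U μ T (fun w => (‖w‖ ^ 2)⁻¹ * sqRatio s w) := by
  have hi : Integrable (fun v : Sph L => sqRatio s (v : Euc (L + 1))) μ :=
    integrable_sphere (continuous_sphere_of_continuousAt fun w hw => continuousAt_sqRatio s hw)
  have e := integral_prod_mul (μ := μ) (ν := P) (fun v : Sph L => sqRatio s (v : Euc (L + 1)))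
    (fun ω => T ω ^ 2)
  have e2 : 7 / 8 * ((∫ ω, T ω ^ 2 ∂P) * (1 / (2 * (L + 1))))
        * ∫ v, sqRatio s (v : Euc (L + 1)) ∂μ
      = ∫ p : Sph L × Ω, 7 / 8 * (1 / (2 * ((L : ℝ) + 1))) *
        (sqRatio s (p.1 : Euc (L + 1)) * T p.2 ^ 2) ∂μ.prod P := by
    rw [integral_const_mul, e]
    ring
  rw [e2]
  refine integral_mono ((hi.mul_prod hS.integrable_sq).const_mul _)
    (integrable_sq_mul_greenInt (by omega) hS.haar hS.measurable hS.nonneg hS.le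
      fun w hw => continuousAt_inv_normSq_mul hw (continuousAt_sqRatio s hw)) fun p => ?_
  have := isProbabilityMeasure_orbitLaw (P := P) hS.haar.1 p.1
  have h := mul_le_mul_of_nonneg_left (le_greenInt_inv_normSq_mul_sqRatio hL
    (isRotInv_orbitLaw hS.haar p.1) s (norm_eq_of_mem_sphere p.1) (hS.nonneg p.2) (hS.le p.2))
    (sq_nonneg (T p.2))
  refine le_trans (le_of_eq ?_) h
  ring

lemma avgGreen_sqRatio_le {c : ℝ} (hL : 2 ≤ L) (hS : IsStep P U T) (j : ℕ)
    (hc0 : 0 ≤ c) (hc : c < 1) :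
    avgGreen P U μ T (fun w => (‖w‖ ^ 2)⁻¹ * sqRatio s w)
      ≤ ((j : ℝ) + 1) / (1 + j * c)
          * avgGreen P U μ T (fun w => (‖w‖ ^ 2)⁻¹ * (sqRatio s w * sqRatio tᶜ w))
        + 1 / ((1 - c) ^ j * (1 + j * c))
          * avgGreen P U μ T (fun w => (‖w‖ ^ 2)⁻¹ * sqRatio t w ^ (j + 1)) := by
  have h₁ : ∀ w : Euc (L + 1), w ≠ 0 → ContinuousAt (fun w => (‖w‖ ^ 2)⁻¹ * sqRatio s w) w :=
    fun w hw => continuousAt_inv_normSq_mul hw (continuousAt_sqRatio s hw)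
  have h₂ : ∀ w : Euc (L + 1), w ≠ 0 → ContinuousAt (fun w => ((j : ℝ) + 1) / (1 + j * c)
      * ((‖w‖ ^ 2)⁻¹ * (sqRatio s w * sqRatio tᶜ w))) w := fun w hw =>
    (continuousAt_inv_normSq_mul hw (continuousAt_sqRatio_mul s tᶜ hw)).const_mul _
  have h₃ : ∀ w : Euc (L + 1), w ≠ 0 → ContinuousAt (fun w => 1 / ((1 - c) ^ j * (1 + j * c))
      * ((‖w‖ ^ 2)⁻¹ * sqRatio t w ^ (j + 1))) w := fun w hw =>
    (continuousAt_inv_normSq_mul hw ((continuousAt_sqRatio t hw).pow _)).const_mul _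
  have h := avgGreen_mono (μ := μ) hL hS (κ₁ := fun w => (‖w‖ ^ 2)⁻¹ * sqRatio s w
      - ((j : ℝ) + 1) / (1 + j * c) * ((‖w‖ ^ 2)⁻¹ * (sqRatio s w * sqRatio tᶜ w)))
    (fun w hw => (h₁ w hw).sub (h₂ w hw)) h₃ fun w hw => by
    have h1 := one_le_tangent (sqRatio_nonneg t w) j hc0 hc
    have h2 := sqRatio_compl t hw
    have h3 := sqRatio_le_one s hw
    have h4 := sqRatio_nonneg s w
    have h5 : 0 ≤ (‖w‖ ^ 2)⁻¹ := inv_nonneg.2 (sq_nonneg _)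
    have h6 : 0 ≤ sqRatio t w ^ (j + 1) / ((1 - c) ^ j * (1 + j * c)) := by
      have := sqRatio_nonneg t w
      have := sub_pos.2 hc
      positivity
    rw [h2, sub_le_iff_le_add]
    calc (‖w‖ ^ 2)⁻¹ * sqRatio s w = (‖w‖ ^ 2)⁻¹ * sqRatio s w * 1 := (mul_one _).symm
      _
          ≤ (‖w‖ ^ 2)⁻¹ * sqRatio s w * _ := mul_le_mul_of_nonneg_left h1 (mul_nonneg h5 h4)
      _ = ((j : ℝ) + 1) / (1 + j * c) * ((‖w‖ ^ 2)⁻¹ * (sqRatio s w * (1 - sqRatio t w)))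
          + (‖w‖ ^ 2)⁻¹ *
            (sqRatio s w * (sqRatio t w ^ (j + 1) / ((1 - c) ^ j * (1 + j * c)))) := by
        ring
      _ ≤ ((j : ℝ) + 1) / (1 + j * c) * ((‖w‖ ^ 2)⁻¹ * (sqRatio s w * (1 - sqRatio t w)))
          + (‖w‖ ^ 2)⁻¹ * (1 * (sqRatio t w ^ (j + 1) / ((1 - c) ^ j * (1 + j * c)))) := by
        gcongr
      _ = _ := by rw [one_mul]; ring
  rw [avgGreen_sub hL hS h₁ h₂, avgGreen_const_mul, avgGreen_const_mul] at h
  linarith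

end Main

section Bound

variable {L : ℕ} {Ω : Type*} [MeasurableSpace Ω] {P : Measure Ω} [IsProbabilityMeasure P]
  {U : Ω → Matrix (Fin (L + 1)) (Fin (L + 1)) ℝ} {μ : Measure (Sph L)} [IsProbabilityMeasure μ]
  {T : Ω → ℝ} {ψ : Euc (L + 1) → Euc (L + 1)} {s t : Finset (Fin (L + 1))}

lemma integral_sqRatio_le_one (s : Finset (Fin (L + 1))) :
    ∫ v, sqRatio s (v : Euc (L + 1)) ∂μ ≤ 1 := by
  have hi : Integrable (fun v : Sph L => sqRatio s (v : Euc (L + 1))) μ :=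
    integrable_sphere (continuous_sphere_of_continuousAt fun w hw => continuousAt_sqRatio s hw)
  refine (integral_mono hi (integrable_const 1) fun v =>
    sqRatio_le_one s (ne_zero_of_mem_unit_sphere v)).trans ?_
  simp

lemma integral_sqRatio_le_rpow {p q γ lam : ℝ} (hL : 3 ≤ L) (hS : IsStep P U T)
    (hTlam : ∀ ω, T ω ≤ lam) (hT : 0 < ∫ ω, T ω ^ 2 ∂P) (hst : HasStationaryMeans P U μ T ψ)
    (hsub : s ⊆ t) (hs0 : 0 < s.card) (ht : ∀ w ≠ 0, sqRatio t (ψ w) ≤ sqRatio t w)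
    (hs : ∀ w ≠ 0, sqRatio s (ψ w) ≤ sqRatio s w - γ / 2 * (sqRatio s w * sqRatio tᶜ w))
    (hγ : 0 < γ) (hlam : 0 < lam) (hp : 1 ≤ 2 * p) (hq : 3 / 2 ≤ q)
    (htc : (t.card : ℝ) = 2 * q) (hpq : ((L + 1 : ℕ) : ℝ) = 2 * (q + p)) :
    ∫ v, sqRatio s (v : Euc (L + 1)) ∂μ ≤ 2 * ((q + p) / q) ^ ((q - 1) / (p + 1))
      * (6 / γ * (s.card / (2 * p)) * lam ^ 2) ^ (p / (p + 1)) := by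
  have hp0 : 0 < p := by linarith
  have hq0 : 0 < q := by linarith
  have hs0' : (0 : ℝ) < s.card := by exact_mod_cast hs0
  have hn : (L : ℝ) + 1 = 2 * (q + p) := by rw [← hpq]; push_cast; rfl
  refine le_of_forall_nat_bound hp hq (by positivity) (integral_sqRatio_le_one s)
    fun j c hc0 hc => ?_
  have hG0 := avgGreen_inv_normSq_le (μ := μ) hL hS
  have hlow := integral_sqRatio_le_avgGreen (μ := μ) hL hS s
  rw [hn] at hG0 hlow
  set Z := (∫ ω, T ω ^ 2 ∂P) * (1 / (2 * (2 * (q + p)))) with hZ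
  have hZ0 : 0 < Z := by positivity
  have htan := avgGreen_sqRatio_le (μ := μ) (s := s) (t := t) (by omega) hS j hc0 hc
  have hpow := avgGreen_sqRatio_pow_le (by omega) hS hst ht hp0 hq0 htc hpq (j + 1)
  have hd : Disjoint s tᶜ := Finset.disjoint_left.2 fun i hi hi' =>
    Finset.mem_compl.1 hi' (hsub hi)
  have hM := avgMean_mul_le (by omega) hS hst hs
  have hac := avgGreen_mul_le (μ := μ) hL hS hTlam hd
  rw [hn] at hac
  set G := avgGreen P U μ T (fun w => (‖w‖ ^ 2)⁻¹)
  set M := avgMean P U μ T (fun w => sqRatio s w * sqRatio tᶜ w)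
  have hM2 : M ≤ 4 * s.card / γ * Z := by
    rw [div_mul_eq_mul_div, le_div_iff₀ hγ]
    nlinarith
  have hac2 : avgGreen P U μ T (fun w => (‖w‖ ^ 2)⁻¹ * (sqRatio s w * sqRatio tᶜ w))
      ≤ 8 / 9 * (6 / γ * (s.card / (2 * p)) * lam ^ 2) * (p / (q + p)) * Z := by
    refine hac.trans ((mul_le_mul_of_nonneg_left hM2 (by positivity)).trans (le_of_eq ?_))
    field_simp
    ring
  have hpow2 := hpow.trans (mul_le_mul_of_nonneg_left hG0 (ratioProd_pos hp0 hq0 (j + 1)).le)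
  have hc1 := sub_pos.2 hc
  have hfin : 7 / 8 * Z * ∫ v, sqRatio s (v : Euc (L + 1)) ∂μ
      ≤ ((j : ℝ) + 1) / (1 + j * c)
          * (8 / 9 * (6 / γ * (s.card / (2 * p)) * lam ^ 2) * (p / (q + p)) * Z)
        + 1 / ((1 - c) ^ j * (1 + j * c)) * (ratioProd p q (j + 1) * Z) := by
    refine hlow.trans (htan.trans ?_)
    gcongr
  refine le_of_mul_le_mul_left ?_ (mul_pos (by norm_num : (0 : ℝ) < 7 / 8) hZ0)
  refine hfin.trans (le_of_eq ?_)
  ring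

lemma naSq_eq_sqRatio (La : ℕ) (v : Sph L) : naSq La (v : Euc (L + 1))
    = sqRatio (Finset.univ.filter fun k : Fin (L + 1) => (k : ℕ) < La) (v : Euc (L + 1)) := by
  rw [naSq, sqRatio, sqOn, Finset.sum_filter, norm_eq_of_mem_sphere]
  simp

lemma card_filter_val_lt {n m : ℕ} (h : m ≤ n) :
    (Finset.univ.filter fun k : Fin n => (k : ℕ) < m).card = m := by
  rw [Fin.card_filter_val_lt, min_eq_right h]

lemma integral_sq_const_mul_pos {r : Ω → ℝ} {lam : ℝ} (hlam : 0 < lam)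
    (hi : Integrable (fun ω => (lam * r ω) ^ 2) P) (hr0 : P {ω | r ω = 0} < 1) :
    0 < ∫ ω, (lam * r ω) ^ 2 ∂P := by
  refine (integral_nonneg fun ω => sq_nonneg _).lt_of_ne' fun h => hr0.ne ?_
  have h0 := (integral_eq_zero_iff_of_nonneg (fun ω => sq_nonneg _) hi).1 h
  have h1 : {ω | r ω = 0} =ᵐ[P] Set.univ := by
    refine Filter.eventuallyEq_univ.2 (h0.mono fun ω hω => ?_)
    simpa [hlam.ne'] using hω
  rw [measure_congr h1, measure_univ]

end Bound

theorem stmt5 {L : ℕ} (hL : 2 ≤ L) {Ω : Type*} [MeasurableSpace Ω]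
    (P : Measure Ω) [IsProbabilityMeasure P]
    (lam : ℝ) (hlam : 0 < lam) (hlam4 : lam ≤ 1/4)
    (r : Ω → ℝ) (hr : Measurable r) (hr01 : ∀ ω, r ω ∈ Set.Icc (0:ℝ) 1)
    (hr0 : P {ω | r ω = 0} < 1)
    (U : Ω → Matrix (Fin (L+1)) (Fin (L+1)) ℝ) (hU : IsHaarOrth P U)
    (hrU : IndepFun r U P)
    (κ : ℕ → ℝ) (hκpos : ∀ i, 1 ≤ i → i ≤ L+1 → 0 < κ i)
    (hκmono : ∀ i j, 1 ≤ i → i ≤ j → j ≤ L+1 → κ j ≤ κ i)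
    (R : Matrix (Fin (L+1)) (Fin (L+1)) ℝ)
    (hR : R = Matrix.diagonal fun k : Fin (L+1) => κ (L+1-(k:ℕ)))
    (La Lb Lc : ℕ) (hLa : 1 ≤ La) (hLb : 1 ≤ Lb) (hLc : 1 ≤ Lc)
    (hsum : La + Lb + Lc = L + 1) (hab : (La, Lb) ≠ (1, 1))
    (γ : ℝ) (hγdef : γ = min 1 ((κ Lc)^2 / (κ (Lb+Lc+1))^2 - 1)) (hγ : 0 < γ)
    (μ : Measure (Sph L)) [IsProbabilityMeasure μ]
    (hinv : ∀ A : Set (Sph L), MeasurableSet A →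
      μ A = ∫⁻ v, P {ω | actS (R * (1 + (lam * r ω) • U ω)) v ∈ A} ∂μ) :
    (∫ v, naSq La (v : EuclideanSpace ℝ (Fin (L+1))) ∂μ)
      ≤ 2 * (((L:ℝ)+1) / ((La:ℝ)+(Lb:ℝ))) ^ ((((La:ℝ)+(Lb:ℝ)-2)) / ((Lc:ℝ)+2))
          * ((6/γ) * ((La:ℝ)/(Lc:ℝ)) * lam^2) ^ ((Lc:ℝ) / ((Lc:ℝ)+2)) := by
  have hLab : 3 ≤ La + Lb := by
    by_contra! h
    exact hab (Prod.ext (by simp only; omega) (by simp only; omega))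
  have hS : IsStep P U (fun ω => lam * r ω) :=
    ⟨hU, hr.const_mul lam, fun ω => mul_nonneg hlam.le (hr01 ω).1, fun ω => by
      nlinarith [(hr01 ω).1, (hr01 ω).2]⟩
  have hlamle : ∀ ω, lam * r ω ≤ lam := fun ω => by nlinarith [(hr01 ω).2]
  have hTU : IndepFun (fun ω => lam * r ω) U P := by
    have h := hrU.comp (measurable_const_mul lam) measurable_id
    rw [Function.comp_def] at h
    exact h
  have hd : ∀ k : Fin (L + 1), 0 < κ (L + 1 - (k : ℕ)) := fun k => hκpos _ (by omega) (by omega)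
  subst hR
  have hR0 := toEuclideanLin_diagonal_ne_zero hd
  have hst : HasStationaryMeans P U μ (fun ω => lam * r ω)
      (fun w => Matrix.toEuclideanLin
        (Matrix.diagonal fun k : Fin (L + 1) => κ (L + 1 - (k : ℕ))) w) := fun F hF hF' =>
    ⟨fun w hw => continuousAt_comp_toEuclideanLin hR0 hF hw,
      integral_eq_avgMean_of_invariant hS hTU hR0 hinv hF hF'⟩
  set s : Finset (Fin (L + 1)) := Finset.univ.filter fun k => (k : ℕ) < La with hs
  set t : Finset (Fin (L + 1)) := Finset.univ.filter fun k => (k : ℕ) < La + Lb with ht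
  have hκsq : ∀ i j, 1 ≤ i → i ≤ j → j ≤ L + 1 → κ j ^ 2 ≤ κ i ^ 2 := fun i j hi hij hj =>
    pow_le_pow_left₀ (hκpos j (by omega) hj).le (hκmono i j hi hij hj) 2
  have hγ1 : γ ≤ 1 := hγdef.trans_le (min_le_left _ _)
  have hγκ : (1 + γ) * κ (Lb + Lc + 1) ^ 2 ≤ κ Lc ^ 2 := by
    have h := hγdef.trans_le (min_le_right _ _)
    have h0 : 0 < κ (Lb + Lc + 1) ^ 2 := pow_pos (hκpos _ (by omega) (by omega)) 2
    rw [← le_div_iff₀ h0]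
    linarith
  have hst' : s ⊆ t := fun i hi => by
    simp only [hs, ht, Finset.mem_filter_univ] at hi ⊢
    omega
  have hLa' : s.card = La := card_filter_val_lt (by omega)
  have hLab' : t.card = La + Lb := card_filter_val_lt (by omega)
  have hmain := integral_sqRatio_le_rpow (p := (Lc : ℝ) / 2) (q := ((La : ℝ) + Lb) / 2)
    (by omega) hS hlamle (integral_sq_const_mul_pos hlam hS.integrable_sq hr0) hst hst'
    (by omega)
    (fun w hw => sqRatio_diagonal_le (ρ := κ Lc ^ 2) hd
      (fun i hi => hκsq _ _ hLc
        (by simp only [ht, Finset.mem_filter_univ] at hi; omega) (by omega))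
      (fun i hi => hκsq _ _ (by omega)
        (by simp only [ht, Finset.mem_filter_univ] at hi; omega) (by omega)) hw)
    (fun w hw => sqRatio_diagonal_le_sub (ρ := κ (Lb + Lc + 1) ^ 2) hd hγ.le hγ1
      (fun i hi => hκsq _ _ (by omega)
        (by simp only [hs, Finset.mem_filter_univ] at hi; omega) (by omega))
      (fun i hi => hκsq _ _ (by omega)
        (by simp only [hs, Finset.mem_filter_univ] at hi; omega) (by omega))
      (Finset.disjoint_left.2 fun i hi hi' => Finset.mem_compl.1 hi' (hst' hi))
      (fun i hi => hγκ.trans (hκsq _ _ (by omega)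
        (by simp only [ht, Finset.mem_compl, Finset.mem_filter_univ] at hi; omega) (by omega))) hw)
    hγ hlam (by have : (1 : ℝ) ≤ Lc := by exact_mod_cast hLc
                linarith)
    (by have : (3 : ℝ) ≤ La + Lb := by exact_mod_cast hLab
        linarith)
    (by rw [hLab']; push_cast; ring) (by rw [← hsum]; push_cast; ring)
  simp only [naSq_eq_sqRatio]
  have hn : (L : ℝ) + 1 = La + Lb + Lc := by exact_mod_cast hsum.symm
  have hab0 : (0 : ℝ) < La + Lb := by positivity
  have e1 : (((La : ℝ) + Lb) / 2 + Lc / 2) / (((La : ℝ) + Lb) / 2)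
      = (La + Lb + Lc) / (La + Lb) := by
    field_simp
  have e2 : (((La : ℝ) + Lb) / 2 - 1) / ((Lc : ℝ) / 2 + 1) = (La + Lb - 2) / (Lc + 2) := by
    field_simp
  have e3 : (Lc : ℝ) / 2 / (Lc / 2 + 1) = Lc / (Lc + 2) := by
    field_simp
  rw [e1, e2, e3, hLa', mul_div_cancel₀ (Lc : ℝ) two_ne_zero] at hmain
  rw [hn]
  exact hmain
end
end

section
/- For every v ∈ 𝕊^L, the random variable ⟨v, (1+λrU)·v⟩ takes values in the interval [√(1−λ²), 1]. Moreover, its distribution does not depend on v: for any v, w ∈ 𝕊^L the random variables ⟨v, (1+λrU)·v⟩ and ⟨w, (1+λrU)·w⟩ have the same distribution. -/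
open MeasureTheory ProbabilityTheory Matrix Real
open scoped ENNReal

noncomputable section

section Measurability

variable {l m n : Type*}

lemma measurable_entry {α : Type*} [MeasurableSpace α] (i : l) (j : m) :
    Measurable fun X : Matrix l m α => X i j :=
  (measurable_pi_apply (X := fun _ : m => α) j).comp
    (measurable_pi_apply (X := fun _ : l => m → α) i)

lemma measurable_matrix {Ω : Type*} [MeasurableSpace Ω] {X : Ω → Matrix l n ℝ}
    (h : ∀ i j, Measurable fun ω => X ω i j) : Measurable X :=
  measurable_pi_lambda (X := fun _ : l => n → ℝ) _ fun i => measurable_pi_lambda _ fun j => h i j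

lemma measurable_matrix_transpose : Measurable fun X : Matrix l n ℝ => Xᵀ :=
  measurable_matrix fun i j => measurable_entry j i

lemma Measurable.matrix_mul [Fintype m] {Ω : Type*} [MeasurableSpace Ω] {X : Ω → Matrix l m ℝ}
    {Y : Ω → Matrix m n ℝ} (hX : Measurable X) (hY : Measurable Y) :
    Measurable fun ω => X ω * Y ω := by
  refine measurable_matrix fun i j => ?_
  simp only [Matrix.mul_apply]
  exact Finset.measurable_sum _ fun k _ =>
    ((measurable_entry i k).comp hX).mul ((measurable_entry k j).comp hY)

end Measurability

section Haar

variable {L : ℕ} {Ω : Type*} [MeasurableSpace Ω] {P : Measure Ω}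
  {U : Ω → Matrix (Fin (L+1)) (Fin (L+1)) ℝ}

lemma transpose_mem_orthogonalGroup {n : Type*} [Fintype n] [DecidableEq n] {O : Matrix n n ℝ}
    (hO : O ∈ Matrix.orthogonalGroup n ℝ) : Oᵀ ∈ Matrix.orthogonalGroup n ℝ :=
  Matrix.transpose_mem_unitaryGroup_iff.mpr hO

/-- Inversion invariance of Haar measure on the (compact) orthogonal group. -/
lemma IsHaarOrth.map_transpose [IsProbabilityMeasure P] (hU : IsHaarOrth P U) :
    P.map (fun ω => (U ω)ᵀ) = P.map U := by
  obtain ⟨hm, hO, hinv⟩ := hU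
  have hmT : Measurable fun ω => (U ω)ᵀ := measurable_matrix_transpose.comp hm
  have key : ∀ f : Matrix (Fin (L+1)) (Fin (L+1)) ℝ → ℝ≥0∞, Measurable f →
      ∀ O ∈ Matrix.orthogonalGroup (Fin (L+1)) ℝ, ∫⁻ ω, f (O * U ω) ∂P = ∫⁻ ω, f (U ω) ∂P := by
    intro f hf O hOO
    rw [← lintegral_map hf (measurable_const.matrix_mul hm), ← lintegral_map hf hm, hinv O hOO]
  refine Measure.ext_of_lintegral _ fun f hf => ?_
  rw [lintegral_map hf hmT, lintegral_map hf hm]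
  have hfT : Measurable fun X : Matrix (Fin (L+1)) (Fin (L+1)) ℝ => f Xᵀ :=
    hf.comp measurable_matrix_transpose
  calc ∫⁻ ω, f (U ω)ᵀ ∂P
      = ∫⁻ _, ∫⁻ ω, f (U ω)ᵀ ∂P ∂P := by simp
    _ = ∫⁻ ω', ∫⁻ ω, f ((U ω)ᵀ * U ω') ∂P ∂P := by
        refine lintegral_congr fun ω' => ?_
        rw [← key _ hfT _ (transpose_mem_orthogonalGroup (hO ω'))]
        simp [Matrix.transpose_mul]
    _ = ∫⁻ ω, ∫⁻ ω', f ((U ω)ᵀ * U ω') ∂P ∂P :=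
        lintegral_lintegral_swap (hf.comp <|
          (hmT.comp measurable_snd).matrix_mul (hm.comp measurable_fst)).aemeasurable
    _ = ∫⁻ _, ∫⁻ ω', f (U ω') ∂P ∂P :=
        lintegral_congr fun ω => key f hf _ (transpose_mem_orthogonalGroup (hO ω))
    _ = ∫⁻ ω, f (U ω) ∂P := by simp

lemma IsHaarOrth.map_mul_right [IsProbabilityMeasure P] (hU : IsHaarOrth P U)
    {O : Matrix (Fin (L+1)) (Fin (L+1)) ℝ} (hO : O ∈ Matrix.orthogonalGroup (Fin (L+1)) ℝ) :
    P.map (fun ω => U ω * O) = P.map U := by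
  have hm := hU.1
  have hmul : Measurable fun X : Matrix (Fin (L+1)) (Fin (L+1)) ℝ => (Oᵀ * X)ᵀ :=
    measurable_matrix_transpose.comp (measurable_const.matrix_mul measurable_id)
  calc P.map (fun ω => U ω * O)
      = (P.map fun ω => (U ω)ᵀ).map (fun X => (Oᵀ * X)ᵀ) := by
        have hmT : Measurable fun ω => (U ω)ᵀ := measurable_matrix_transpose.comp hm
        rw [Measure.map_map hmul hmT]
        simp [Function.comp_def, Matrix.transpose_mul]
    _ = (P.map fun ω => Oᵀ * U ω).map (fun X => Xᵀ) := by
        rw [hU.map_transpose, Measure.map_map hmul hm, Measure.map_map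
          measurable_matrix_transpose (measurable_const.matrix_mul hm)]
        rfl
    _ = P.map U := by
        rw [hU.2.2 _ (transpose_mem_orthogonalGroup hO),
          Measure.map_map measurable_matrix_transpose hm]
        exact hU.map_transpose

lemma IsHaarOrth.map_conj [IsProbabilityMeasure P] (hU : IsHaarOrth P U)
    {O : Matrix (Fin (L+1)) (Fin (L+1)) ℝ} (hO : O ∈ Matrix.orthogonalGroup (Fin (L+1)) ℝ) :
    P.map (fun ω => Oᵀ * U ω * O) = P.map U := by
  have hm := hU.1
  have hmul : Measurable fun X : Matrix (Fin (L+1)) (Fin (L+1)) ℝ => X * O :=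
    measurable_id.matrix_mul measurable_const
  calc P.map (fun ω => Oᵀ * U ω * O)
      = (P.map fun ω => Oᵀ * U ω).map (fun X => X * O) := by
        rw [Measure.map_map hmul (measurable_const.matrix_mul hm)]; rfl
    _ = P.map (fun ω => U ω * O) := by
        rw [hU.2.2 _ (transpose_mem_orthogonalGroup hO), Measure.map_map hmul hm]; rfl
    _ = P.map U := hU.map_mul_right hO

end Haar

section Geometry

open scoped RealInnerProductSpace

variable {n : Type*} [Fintype n] [DecidableEq n]

lemma inner_toEuclideanLin_transpose (A : Matrix n n ℝ) (v w : EuclideanSpace ℝ n) :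
    ⟪v, Matrix.toEuclideanLin Aᵀ w⟫ = ⟪Matrix.toEuclideanLin A v, w⟫ := by
  rw [← Matrix.conjTranspose_eq_transpose_of_trivial, Matrix.toEuclideanLin_conjTranspose_eq_adjoint,
    LinearMap.adjoint_inner_right]

lemma norm_toEuclideanLin_of_mem_orthogonalGroup {O : Matrix n n ℝ}
    (hO : O ∈ Matrix.orthogonalGroup n ℝ) (v : EuclideanSpace ℝ n) :
    ‖Matrix.toEuclideanLin O v‖ = ‖v‖ := by
  have h : Oᵀ * O = 1 := (Matrix.mem_orthogonalGroup_iff' (n := n) (R := ℝ)).1 hO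
  rw [← sq_eq_sq₀ (norm_nonneg _) (norm_nonneg _), ← real_inner_self_eq_norm_sq,
    ← real_inner_self_eq_norm_sq, ← inner_toEuclideanLin_transpose, ← LinearMap.comp_apply,
    ← Matrix.toLpLin_mul_same, h, Matrix.toLpLin_one, LinearMap.id_apply]

lemma exists_mem_orthogonalGroup_apply_eq {v w : EuclideanSpace ℝ n} (h : ‖v‖ = ‖w‖) :
    ∃ O ∈ Matrix.orthogonalGroup n ℝ, Matrix.toEuclideanLin O v = w := by
  let b := EuclideanSpace.basisFun n ℝ
  let R := (Submodule.span ℝ {v - w})ᗮ.reflection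
  refine ⟨_, R.toMatrix_mem_unitaryGroup b b, ?_⟩
  rw [Matrix.toEuclideanLin_eq_toLin_orthonormal, Matrix.toLin_toMatrix]
  exact Submodule.reflection_sub h

lemma inner_toEuclideanLin_conj {O : Matrix n n ℝ} {v w : EuclideanSpace ℝ n}
    (h : Matrix.toEuclideanLin O v = w) (A : Matrix n n ℝ) :
    ⟪v, Matrix.toEuclideanLin (Oᵀ * A * O) v⟫ = ⟪w, Matrix.toEuclideanLin A w⟫ := by
  rw [Matrix.toLpLin_mul_same, Matrix.toLpLin_mul_same, LinearMap.comp_apply, h,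
    LinearMap.comp_apply, inner_toEuclideanLin_transpose, h]

lemma measurable_inner_toEuclideanLin (v : EuclideanSpace ℝ n) :
    Measurable fun X : Matrix n n ℝ => ⟪v, Matrix.toEuclideanLin X v⟫ := by
  simp only [PiLp.inner_apply, Matrix.toLpLin_apply, Matrix.mulVec, dotProduct]
  exact Finset.measurable_sum _ fun i _ => Measurable.const_inner <|
    Finset.measurable_sum _ fun j _ => (measurable_entry i j).mul_const _

end Geometry

open scoped RealInnerProductSpace in
lemma abs_inner_orthogonal_le_one {L : ℕ} {A : Matrix (Fin (L+1)) (Fin (L+1)) ℝ}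
    (hA : A ∈ Matrix.orthogonalGroup (Fin (L+1)) ℝ) (v : Sph L) :
    |⟪(v : EuclideanSpace ℝ (Fin (L+1))), Matrix.toEuclideanLin A v⟫| ≤ 1 := by
  have hv : ‖(v : EuclideanSpace ℝ (Fin (L+1)))‖ = 1 := mem_sphere_zero_iff_norm.1 v.2
  simpa [norm_toEuclideanLin_of_mem_orthogonalGroup hA, hv] using
    abs_real_inner_le_norm (v : EuclideanSpace ℝ (Fin (L+1))) (Matrix.toEuclideanLin A v)

open scoped RealInnerProductSpace in
lemma inner_actS_one_add_smul {L : ℕ} {A : Matrix (Fin (L+1)) (Fin (L+1)) ℝ}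
    (hA : A ∈ Matrix.orthogonalGroup (Fin (L+1)) ℝ) {a : ℝ} (ha : |a| < 1) (v : Sph L) :
    ⟪(v : EuclideanSpace ℝ (Fin (L+1))),
        (actS (1 + a • A) v : EuclideanSpace ℝ (Fin (L+1)))⟫
      = (√(1 + 2 * a * ⟪(v : EuclideanSpace ℝ (Fin (L+1))), Matrix.toEuclideanLin A v⟫ + a^2))⁻¹ *
        (1 + a * ⟪(v : EuclideanSpace ℝ (Fin (L+1))), Matrix.toEuclideanLin A v⟫) := by
  have hv : ‖(v : EuclideanSpace ℝ (Fin (L+1)))‖ = 1 := mem_sphere_zero_iff_norm.1 v.2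
  have happ : Matrix.toEuclideanLin (1 + a • A) (v : EuclideanSpace ℝ (Fin (L+1)))
      = (v : EuclideanSpace ℝ (Fin (L+1))) + a • Matrix.toEuclideanLin A v := by
    rw [map_add, map_smul, Matrix.toLpLin_one]; rfl
  have hsq : ‖Matrix.toEuclideanLin (1 + a • A) (v : EuclideanSpace ℝ (Fin (L+1)))‖
      = √(1 + 2 * a * ⟪(v : EuclideanSpace ℝ (Fin (L+1))), Matrix.toEuclideanLin A v⟫ + a^2) := by
    rw [happ, ← Real.sqrt_sq (norm_nonneg _), norm_add_sq_real, norm_smul, inner_smul_right,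
      norm_toEuclideanLin_of_mem_orthogonalGroup hA, hv, Real.norm_eq_abs, mul_one, sq_abs]
    ring_nf
  have hne : ‖Matrix.toEuclideanLin (1 + a • A) (v : EuclideanSpace ℝ (Fin (L+1)))‖ ≠ 0 := by
    intro h0
    rw [happ, norm_eq_zero, add_eq_zero_iff_eq_neg] at h0
    have := congrArg norm h0
    rw [norm_neg, norm_smul, norm_toEuclideanLin_of_mem_orthogonalGroup hA, hv, Real.norm_eq_abs]
      at this
    linarith
  rw [actS, dif_neg hne]
  simp only [act]
  rw [inner_smul_right, hsq, happ, inner_add_right, inner_smul_right, real_inner_self_eq_norm_sq,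
    hv, one_pow]

lemma inv_sqrt_mul_mem_Icc {a lam t : ℝ} (ha : |a| ≤ lam) (hlam : lam < 1) (ht : |t| ≤ 1) :
    (√(1 + 2 * a * t + a^2))⁻¹ * (1 + a * t) ∈ Set.Icc √(1 - lam^2) 1 := by
  have hat : |a * t| < 1 := by
    rw [abs_mul]; nlinarith [abs_nonneg a, abs_nonneg t]
  have hpos : 0 < 1 + a * t := by linarith [(abs_lt.1 hat).1]
  have ha2 : a^2 ≤ lam^2 := by rw [← sq_abs]; gcongr
  have ht2 : t^2 ≤ 1 := by rw [← sq_abs]; nlinarith [abs_nonneg t]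
  have hD : (1 + a * t)^2 ≤ 1 + 2 * a * t + a^2 := by nlinarith [sq_nonneg a]
  have hDpos : 0 < 1 + 2 * a * t + a^2 := (pow_pos hpos 2).trans_le hD
  have hs := Real.sqrt_pos.2 hDpos
  rw [inv_mul_eq_div]
  constructor
  · rw [le_div_iff₀ hs, ← Real.sqrt_mul' _ hDpos.le]
    refine Real.sqrt_le_iff.2 ⟨hpos.le, ?_⟩
    nlinarith [mul_nonneg (sub_nonneg.2 ha2) hDpos.le, sq_nonneg (a * (t + a))]
  · rw [div_le_one hs]
    exact Real.le_sqrt_of_sq_le hD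

open scoped RealInnerProductSpace in
theorem stmt6 {L : ℕ} (hL : 2 ≤ L) {Ω : Type*} [MeasurableSpace Ω]
    (P : Measure Ω) [IsProbabilityMeasure P]
    (lam : ℝ) (hlam : lam ∈ Set.Ioo (0:ℝ) 1)
    (r : Ω → ℝ) (hr : Measurable r) (hr01 : ∀ ω, r ω ∈ Set.Icc (0:ℝ) 1)
    (U : Ω → Matrix (Fin (L+1)) (Fin (L+1)) ℝ) (hU : IsHaarOrth P U)
    (hrU : IndepFun r U P) :
    (∀ v : Sph L, ∀ ω,
      ⟪(v : EuclideanSpace ℝ (Fin (L+1))),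
        (actS (1 + (lam * r ω) • U ω) v : EuclideanSpace ℝ (Fin (L+1)))⟫
        ∈ Set.Icc (Real.sqrt (1 - lam^2)) 1) ∧
    (∀ v w : Sph L,
      Measure.map (fun ω =>
        ⟪(v : EuclideanSpace ℝ (Fin (L+1))),
          (actS (1 + (lam * r ω) • U ω) v : EuclideanSpace ℝ (Fin (L+1)))⟫) P
      = Measure.map (fun ω =>
        ⟪(w : EuclideanSpace ℝ (Fin (L+1))),
          (actS (1 + (lam * r ω) • U ω) w : EuclideanSpace ℝ (Fin (L+1)))⟫) P) := by
  have ha : ∀ ω, |lam * r ω| ≤ lam := fun ω => by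
    rw [abs_mul, abs_of_pos hlam.1, abs_of_nonneg (hr01 ω).1]
    exact mul_le_of_le_one_right hlam.1.le (hr01 ω).2
  have hform := fun (v : Sph L) ω =>
    inner_actS_one_add_smul (hU.2.1 ω) ((ha ω).trans_lt hlam.2) v
  refine ⟨fun v ω => ?_, fun v w => ?_⟩
  · rw [hform]
    exact inv_sqrt_mul_mem_Icc (ha ω) hlam.2 (abs_inner_orthogonal_le_one (hU.2.1 ω) v)
  simp only [hform]
  obtain ⟨O, hO, hOv⟩ := exists_mem_orthogonalGroup_apply_eq
    (v := (v : EuclideanSpace ℝ (Fin (L+1)))) (w := w)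
    ((mem_sphere_zero_iff_norm.1 v.2).trans (mem_sphere_zero_iff_norm.1 w.2).symm)
  have hconj : Measurable fun X : Matrix (Fin (L+1)) (Fin (L+1)) ℝ => Oᵀ * X * O :=
    (measurable_const.matrix_mul measurable_id).matrix_mul measurable_const
  have hUconj : Measurable fun ω => Oᵀ * U ω * O := hconj.comp hU.1
  have hq := measurable_inner_toEuclideanLin (v : EuclideanSpace ℝ (Fin (L+1)))
  have hlaw : P.map (fun ω => (r ω, U ω)) = P.map (fun ω => (r ω, Oᵀ * U ω * O)) := by
    rw [(indepFun_iff_map_prod_eq_prod_map_map hr.aemeasurable hU.1.aemeasurable).1 hrU,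
      (indepFun_iff_map_prod_eq_prod_map_map hr.aemeasurable
        hUconj.aemeasurable).1 (hrU.comp measurable_id hconj)]
    exact congrArg _ (hU.map_conj hO).symm
  have hF : Measurable fun p : ℝ × Matrix (Fin (L+1)) (Fin (L+1)) ℝ =>
      (√(1 + 2 * (lam * p.1) *
        ⟪(v : EuclideanSpace ℝ (Fin (L+1))), Matrix.toEuclideanLin p.2 v⟫ + (lam * p.1)^2))⁻¹ *
        (1 + lam * p.1 *
          ⟪(v : EuclideanSpace ℝ (Fin (L+1))), Matrix.toEuclideanLin p.2 v⟫) := by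
    have hq2 : Measurable fun p : ℝ × Matrix (Fin (L+1)) (Fin (L+1)) ℝ =>
        ⟪(v : EuclideanSpace ℝ (Fin (L+1))), Matrix.toEuclideanLin p.2 v⟫ :=
      hq.comp measurable_snd
    fun_prop
  have hmap := (Measure.map_map hF (hr.prodMk hU.1)).symm.trans
    ((congrArg _ hlaw).trans (Measure.map_map hF (hr.prodMk hUconj)))
  simpa only [Function.comp_def, inner_toEuclideanLin_conj hOv] using hmap
end
end
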